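/- arXiv:2004.08266 — 2 statements merged into one kernel-verified Lean document; each statement's English description precedes it below -/
import Mathlib

section
/- The class number of 𝕂 = ℚ(√(n·ε₀·√l)) is odd if and only if n = 1. -/
/-- `ε` is the fundamental unit of the real quadratic field `ℚ(√l)` (viewed inside `ℝ`):
it lies in `ℚ(√l)`, it is a unit of the ring of integers (both `ε` and `ε⁻¹` are
algebraic integers), `ε > 1`, and it is the smallest such unit. -/
def IsFundamentalUnit (l : ℕ) (ε : ℝ) : Prop :=
  1 < ε ∧ ε ∈ IntermediateField.adjoin ℚ ({Real.sqrt (l : ℝ)} : Set ℝ) ∧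
    IsIntegral ℤ ε ∧ IsIntegral ℤ ε⁻¹ ∧
    ∀ x : ℝ, 1 < x → x ∈ IntermediateField.adjoin ℚ ({Real.sqrt (l : ℝ)} : Set ℝ) →
      IsIntegral ℤ x → IsIntegral ℤ x⁻¹ → ε ≤ x

/-- The Legendre symbol `(a/p)`, via Euler's criterion (so that no `Fact p.Prime`
instance is needed): for an odd prime `p` it is `1` if `a` is a nonzero square mod `p`,
`0` if `p ∣ a`, and `-1` otherwise. -/
def legSym (p : ℕ) (a : ℤ) : ℤ :=
  if (a : ZMod p) ^ ((p - 1) / 2) = 1 then 1 else if (a : ZMod p) = 0 then 0 else -1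

/-- The rational fourth power residue symbol `(a/p)₄ ∈ {±1}`, meaningful when
`(a/p) = 1`; it is determined by `(a/p)₄ ≡ a ^ ((p-1)/4) (mod p)`. -/
def quartSym (p : ℕ) (a : ℤ) : ℤ :=
  if (a : ZMod p) ^ ((p - 1) / 4) = 1 then 1 else -1

/-- The cardinality of the 2-torsion subgroup of the class group of `K`.
For a number field `K` this equals `2 ^ r₂(H)`, where `r₂(H)` is the rank of the
2-class group `H` of `K` (i.e. `dim_{𝔽₂} Cl(K)/Cl(K)²`); in particular
`r₂(H) = r` iff this cardinality is `2 ^ r`. -/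
noncomputable def twoTorsCard (K : IntermediateField ℚ ℝ) : ℕ :=
  Nat.card {x : ClassGroup (NumberField.RingOfIntegers K) // x ^ 2 = 1}

section

open NumberField NumberField.Units
open scoped Pointwise

/-- If the inertia group of a prime `P` is trivial, then every Galois invariant ideal divisible by
`P` is divisible by the extension of the prime below `P`. -/
theorem map_under_dvd_of_inertia_eq_bot {A B G : Type*} [CommRing A] [CommRing B]
    [IsDedekindDomain A] [IsDedekindDomain B] [Algebra A B] [Module.Finite A B]
    [Module.IsTorsionFree A B] [Group G] [Finite G]
    [MulSemiringAction G B] [IsGaloisGroup G A B] (P : Ideal B) [P.IsPrime] (hP : P ≠ ⊥)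
    [PerfectField (P.under A).ResidueField]
    (hI : ∀ g : G, (∀ x, g • x - x ∈ P) → g = 1)
    (J : Ideal B) (hJ : ∀ g : G, g • J = J) (hPJ : P ∣ J) :
    (P.under A).map (algebraMap A B) ∣ J := by
  have hp0 : P.under A ≠ ⊥ := Ideal.IsIntegral.comap_ne_bot A hP
  have hmax : (P.under A).IsMaximal := Ideal.IsPrime.isMaximal inferInstance hp0
  have hin : P.inertia G = ⊥ := by
    rw [eq_bot_iff]
    intro g hg
    exact hI g hg
  have hcard := Ideal.card_inertia_eq_ramificationIdxIn (G := G) (P.under A) P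
  rw [hin, Subgroup.card_bot] at hcard
  rw [Ideal.map_algebraMap_eq_finsetProd_pow hp0]
  apply Finset.prod_dvd_of_coprime
  · intro Q hQ Q' hQ' hne
    simp only [Set.coe_toFinset] at hQ hQ'
    obtain ⟨hQ1, hQ2⟩ := hQ
    obtain ⟨hQ1', hQ2'⟩ := hQ'
    apply IsCoprime.pow
    have h1 : Q ≠ ⊥ := Ideal.ne_bot_of_liesOver_of_ne_bot hp0 Q
    have h2 : Q' ≠ ⊥ := Ideal.ne_bot_of_liesOver_of_ne_bot hp0 Q'
    have m1 := Ideal.IsPrime.isMaximal hQ1 h1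
    have m2 := Ideal.IsPrime.isMaximal hQ1' h2
    rw [Ideal.isCoprime_iff_sup_eq]
    exact m1.coprime_of_ne m2 hne
  · intro Q hQ
    simp only [Set.mem_toFinset] at hQ
    obtain ⟨hQ1, hQ2⟩ := hQ
    rw [← Ideal.ramificationIdxIn_eq_ramificationIdx (P.under A) Q G, ← hcard, pow_one]
    obtain ⟨g, rfl⟩ := Ideal.exists_smul_eq_of_isGaloisGroup (P.under A) P Q G
    rw [Ideal.dvd_iff_le] at hPJ ⊢
    rw [← hJ g]
    exact Ideal.pointwise_smul_le_pointwise_smul_iff.mpr hPJ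

section

variable (K L : Type*) [Field K] [NumberField K] [Field L] [NumberField L] [Algebra K L] [IsGalois K L]
open Ideal
/-- An ideal of `𝓞 L` invariant under the Galois group of an extension `L / K` that is unramified
outside an invariant prime `Λ` is extended from `𝓞 K` up to a power of `Λ`. -/
theorem exists_map_mul_pow_eq_of_smul_eq (Λ : Ideal (𝓞 L)) (hΛ : ∀ g : Gal(L/K), g • Λ = Λ)
    (hΛ0 : Λ ≠ ⊥)
    (hur : ∀ P : Ideal (𝓞 L), P.IsPrime → P ≠ ⊥ → P ≠ Λ →
      ∀ g : Gal(L/K), (∀ x : 𝓞 L, g • x - x ∈ P) → g = 1)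
    (J : Ideal (𝓞 L)) (hJ : ∀ g : Gal(L/K), g • J = J) (hJ0 : J ≠ ⊥) :
    ∃ (I : Ideal (𝓞 K)) (j : ℕ), I.map (algebraMap (𝓞 K) (𝓞 L)) * Λ ^ j = J := by
  induction h : J.absNorm using Nat.strong_induction_on generalizing J with
  | _ N ih =>
  by_cases h1 : J = ⊤
  · exact ⟨⊤, 0, by rw [h1, Ideal.map_top, pow_zero, mul_one]⟩
  obtain ⟨P, hPm, hPJ⟩ := Ideal.exists_le_maximal J h1
  have hP0 : P ≠ ⊥ := fun h => hJ0 (le_bot_iff.mp (h ▸ hPJ))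
  have hPp := hPm.isPrime
  have key : ∀ M : Ideal (𝓞 L), M ∣ J → (∀ g : Gal(L/K), g • M = M) → M ≠ ⊤ → M ≠ ⊥ →
      ∃ (I : Ideal (𝓞 K)) (j : ℕ), M * (I.map (algebraMap (𝓞 K) (𝓞 L)) * Λ ^ j) = J := by
    rintro M ⟨J', hJ'⟩ hM hMt hM0
    have hJ0' : J' ≠ ⊥ := by
      rintro rfl
      exact hJ0 (by simpa using hJ')
    have hinv : ∀ g : Gal(L/K), g • J' = J' := by
      intro g
      have h2 := hJ g
      rw [hJ', Ideal.pointwise_smul_def, Ideal.map_mul, ← Ideal.pointwise_smul_def,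
        ← Ideal.pointwise_smul_def, hM g] at h2
      exact mul_left_cancel₀ hM0 h2
    obtain ⟨I, j, hI⟩ := ih _ (by
      rw [← h, hJ', map_mul]
      have : 0 < absNorm J' := Nat.pos_of_ne_zero (by rwa [Ne, Ideal.absNorm_eq_zero_iff])
      refine lt_mul_of_one_lt_left this ?_
      have a1 : absNorm M ≠ 0 := by rwa [Ne, Ideal.absNorm_eq_zero_iff]
      have a2 : absNorm M ≠ 1 := by rwa [Ne, Ideal.absNorm_eq_one_iff]
      omega) J' hinv hJ0' rfl
    exact ⟨I, j, by rw [hI, hJ']⟩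
  by_cases hPΛ : P = Λ
  · subst hPΛ
    obtain ⟨I, j, hI⟩ := key P (Ideal.dvd_iff_le.mpr hPJ) hΛ hPm.ne_top hP0
    exact ⟨I, j + 1, by rw [← hI, pow_succ']; ac_rfl⟩
  obtain ⟨I, j, hI⟩ := key ((P.under (𝓞 K)).map (algebraMap (𝓞 K) (𝓞 L)))
    (map_under_dvd_of_inertia_eq_bot P hP0 (hur P hPp hP0 hPΛ) J hJ (Ideal.dvd_iff_le.mpr hPJ))
    (fun g => by
      rw [Ideal.pointwise_smul_def, Ideal.map_map]
      congr 1
      ext x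
      simp)
    (fun h5 => hPm.ne_top (top_le_iff.mp (h5 ▸ Ideal.map_comap_le)))
    (by
      rw [Ne, Ideal.map_eq_bot_iff_of_injective (FaithfulSMul.algebraMap_injective _ _)]
      exact Ideal.IsIntegral.comap_ne_bot (𝓞 K) hP0)
  exact ⟨P.under (𝓞 K) * I, j, by rw [Ideal.map_mul, ← hI, mul_assoc]⟩

end

/-- The group theoretic core of Hilbert's Theorem 94 for a quadratic extension: if every element of
norm `1` is of the form `w / τ w`, then the index of the squares in `E` is small. -/
theorem two_mul_index_sq_le {E F : Type*} [CommGroup E] [CommGroup F] (j : F →* E) (N : E →* F)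
    (τ : E →* E) (hj : Function.Injective j) (hN : ∀ x, j (N x) = x * τ x)
    (hτ : ∀ a, τ (j a) = j a) (hH : ∀ x, N x = 1 → ∃ w, x = w / τ w)
    (m : F) (hm1 : m ≠ 1) (hm2 : m ^ 2 = 1) (hsq : ∀ z : E, z ^ 2 = 1 → z = 1 ∨ z = j m)
    (hfin : (powMonoidHom 2 : F →* F).range.index ≠ 0) :
    2 * (powMonoidHom 2 : E →* E).range.index ≤ (powMonoidHom 2 : F →* F).range.index ^ 2 := by
  set S := (powMonoidHom 2 : E →* E).range
  set Q := (powMonoidHom 2 : F →* F).range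
  have hNj : ∀ a, N (j a) = a ^ 2 := fun a => hj (by rw [hN, hτ, map_pow, sq])
  have hle : ((QuotientGroup.mk' Q).comp N).ker ≤ j.range ⊔ S := by
    intro x hx
    have hx' : N x ∈ Q := by
      rwa [MonoidHom.mem_ker, MonoidHom.comp_apply, ← MonoidHom.mem_ker, QuotientGroup.ker_mk'] at hx
    obtain ⟨a, ha⟩ := hx'
    obtain ⟨w, hw⟩ := hH (x / j a) (by rw [map_div, hNj, ← ha]; simp)
    have hx2 : x = j (a / N w) * w ^ 2 := by
      rw [div_eq_iff_eq_mul] at hw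
      rw [hw, map_div, hN, div_mul_eq_mul_div, div_mul_eq_mul_div, div_eq_div_iff_mul_eq_mul, sq]
      ac_rfl
    rw [hx2]
    exact Subgroup.mul_mem_sup ⟨_, rfl⟩ ⟨w, rfl⟩
  have h1 : (j.range ⊔ S).index ∣ Q.index := by
    refine (Subgroup.index_dvd_of_le hle).trans ?_
    rw [Subgroup.index_ker]
    exact Subgroup.card_subgroup_dvd_card _
  have hS : S.index = (S.comap j).index * (j.range ⊔ S).index := by
    rw [← Subgroup.relIndex_mul_index (le_sup_right : S ≤ j.range ⊔ S), Subgroup.relIndex_sup_right,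
      Subgroup.index_comap]
  have hQle : Q ≤ S.comap j := by
    rintro _ ⟨a, rfl⟩
    exact ⟨j a, by simp⟩
  have hrel : Q.relIndex (S.comap j) ≠ 1 := by
    intro h
    rw [Subgroup.relIndex_eq_one] at h
    have hNm : N (j m) = 1 := by rw [hNj, hm2]
    obtain ⟨y, hy⟩ := hH (j m) hNm
    have hy2 : j (m * N y) = y ^ 2 := by
      rw [map_mul, hN, hy, sq, div_mul_eq_mul_div, div_eq_iff_eq_mul]
      ac_rfl
    obtain ⟨b, hb⟩ := h (x := m * N y) ⟨y, by rw [hy2]; rfl⟩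
    have hyb : (y / j b) ^ 2 = 1 := by
      rw [div_pow, ← hy2, ← hb, powMonoidHom_apply, map_pow, div_self']
    have hyr : ∃ c, y = j c := by
      rcases hsq _ hyb with h | h
      · exact ⟨b, div_eq_one.mp h⟩
      · exact ⟨m * b, by rw [map_mul, ← h, div_mul_cancel]⟩
    obtain ⟨c, rfl⟩ := hyr
    rw [hτ, div_self', ← map_one j] at hy
    exact hm1 (hj hy)
  have h2 := Subgroup.relIndex_mul_index hQle
  rw [hS]
  have h3 : (j.range ⊔ S).index ≤ Q.index := Nat.le_of_dvd (Nat.pos_of_ne_zero hfin) h1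
  have h4 : 2 ≤ Q.relIndex (S.comap j) := by
    have : Q.relIndex (S.comap j) ≠ 0 := by
      intro h0
      rw [h0, zero_mul] at h2
      exact hfin h2.symm
    omega
  calc 2 * ((S.comap j).index * (j.range ⊔ S).index)
      = (2 * (S.comap j).index) * (j.range ⊔ S).index := by ring
    _ ≤ Q.index * Q.index := by
        refine Nat.mul_le_mul ?_ h3
        rw [← h2]
        exact Nat.mul_le_mul_right _ h4
    _ = Q.index ^ 2 := by ring

theorem NumberField.IsTotallyReal.sq_eq_one_of_mem_torsion {K : Type*} [Field K] [NumberField K]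
    [IsTotallyReal K] {ζ : (𝓞 K)ˣ} (hζ : ζ ∈ torsion K) : ζ = 1 ∨ ζ = -1 := by
  obtain ⟨φ⟩ := (inferInstance : Nonempty (K →+* ℂ))
  have hr := IsTotallyReal.complexEmbedding_isReal φ
  have h1 : ‖φ (ζ : K)‖ = 1 := (mem_torsion K).mp hζ (InfinitePlace.mk φ)
  have h2 : ((hr.embedding (ζ : K) : ℝ) : ℂ) = φ (ζ : K) := hr.coe_embedding_apply _
  rw [← h2, Complex.norm_real, Real.norm_eq_abs, abs_eq (by norm_num)] at h1
  have hinj := hr.embedding.injective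
  rcases h1 with h | h
  · left
    ext
    apply hinj
    simp [h]
  · right
    ext
    apply hinj
    simp [h]

theorem NumberField.Units.index_range_sq (K : Type*) [Field K] [NumberField K] [IsTotallyReal K] :
    (powMonoidHom 2 : (𝓞 K)ˣ →* (𝓞 K)ˣ).range.index = 2 ^ (Module.finrank ℚ K) := by
  have hne : (1 : (𝓞 K)ˣ) ≠ -1 := by
    intro h
    have h2 : ((1 : (𝓞 K)ˣ) : K) = ((-1 : (𝓞 K)ˣ) : K) := by rw [← h]
    simp at h2
    norm_num [eq_neg_iff_add_eq_zero] at h2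
  have hsq : ∀ ζ ∈ torsion K, ζ ^ 2 = 1 := by
    intro ζ hζ
    rcases IsTotallyReal.sq_eq_one_of_mem_torsion hζ with rfl | rfl <;> simp
  have hcard : Nat.card (torsion K) = 2 := by
    rw [Nat.card_eq_two_iff]
    refine ⟨1, ⟨-1, ?_⟩, ?_, ?_⟩
    · rw [torsion, CommGroup.mem_torsion, isOfFinOrder_iff_pow_eq_one]
      exact ⟨2, by norm_num, by simp⟩
    · intro h
      exact hne (congrArg Subtype.val h)
    · ext ⟨ζ, hζ⟩
      rcases IsTotallyReal.sq_eq_one_of_mem_torsion hζ with rfl | rfl <;> simp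
  let F : torsion K × (Fin (rank K) → Fin 2) → (𝓞 K)ˣ ⧸ (powMonoidHom 2 : (𝓞 K)ˣ →* (𝓞 K)ˣ).range :=
    fun p => QuotientGroup.mk (p.1 * ∏ i, fundSystem K i ^ ((p.2 i : ℕ) : ℤ))
  have hF : Function.Bijective F := by
    constructor
    · rintro ⟨ζ, a⟩ ⟨ζ', a'⟩ h
      obtain ⟨s, hs⟩ := QuotientGroup.eq.mp h
      obtain ⟨⟨ξ, b⟩, hξ, -⟩ := exist_unique_eq_mul_prod K s
      simp only at hξ
      have e1 : (ζ' : (𝓞 K)ˣ) * ∏ i, fundSystem K i ^ ((a' i : ℕ) : ℤ) =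
          ζ * ∏ i, fundSystem K i ^ (((a i : ℕ) : ℤ) + b i * 2) := by
        have e0 := eq_inv_mul_iff_mul_eq.mp hs
        rw [← e0, hξ]
        simp only [powMonoidHom_apply, mul_pow, hsq _ ξ.2, zpow_add, zpow_mul,
          Finset.prod_mul_distrib, one_mul]
        rw [mul_assoc]
        simp [← Finset.prod_pow, zpow_ofNat]
      have hu := (exist_unique_eq_mul_prod K
        (ζ' * ∏ i, fundSystem K i ^ ((a' i : ℕ) : ℤ))).unique
        (y₁ := (ζ', fun i => ((a' i : ℕ) : ℤ))) (y₂ := (ζ, fun i => ((a i : ℕ) : ℤ) + b i * 2)) rfl e1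
      simp only [Prod.mk.injEq, funext_iff] at hu
      ext i
      · rw [hu.1]
      · have := hu.2 i
        have h1 := (a i).2
        have h2 := (a' i).2
        dsimp only
        omega
    · intro q
      obtain ⟨x, rfl⟩ := QuotientGroup.mk_surjective q
      obtain ⟨⟨ξ, b⟩, hξ, -⟩ := exist_unique_eq_mul_prod K x
      simp only at hξ
      have hnn : ∀ i, 0 ≤ b i % 2 := fun i => Int.emod_nonneg _ (by norm_num)
      have hlt : ∀ i, b i % 2 < 2 := fun i => Int.emod_lt_of_pos _ (by norm_num)
      refine ⟨(ξ, fun i => ⟨(b i % 2).toNat, by have := hnn i; have := hlt i; omega⟩), ?_⟩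
      refine QuotientGroup.eq.mpr ⟨∏ i, fundSystem K i ^ (b i / 2), ?_⟩
      rw [eq_inv_mul_iff_mul_eq, hξ]
      simp only [powMonoidHom_apply]
      rw [mul_assoc, ← Finset.prod_pow, ← Finset.prod_mul_distrib]
      congr 1
      refine Finset.prod_congr rfl fun i _ => ?_
      rw [Int.toNat_of_nonneg (hnn i), ← zpow_ofNat, ← zpow_mul, ← zpow_add]
      congr 1
      have := Int.emod_add_mul_ediv (b i) 2
      omega
  have hr : rank K + 1 = Module.finrank ℚ K := by
    rw [IsTotallyReal.finrank K, rank, InfinitePlace.card_eq_nrRealPlaces_add_nrComplexPlaces,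
      IsTotallyReal.nrComplexPlaces_eq_zero]
    have : 0 < Fintype.card (InfinitePlace K) := Fintype.card_pos
    rw [InfinitePlace.card_eq_nrRealPlaces_add_nrComplexPlaces,
      IsTotallyReal.nrComplexPlaces_eq_zero] at this
    omega
  rw [Subgroup.index, ← Nat.card_congr (Equiv.ofBijective F hF), Nat.card_prod, hcard, ← hr]
  simp [pow_succ, mul_comm]

section

open Ideal
variable (K L : Type*) [Field K] [NumberField K] [Field L] [NumberField L] [Algebra K L] [IsGalois K L]

/-- The action of an automorphism on the units of the ring of integers. -/
noncomputable def unitsAut {K L : Type*} [Field K] [Field L] [Algebra K L] [NumberField L]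
    [NumberField K] (g : Gal(L/K)) : (𝓞 L)ˣ →* (𝓞 L)ˣ :=
  Units.map (MulSemiringAction.toRingHom Gal(L/K) (𝓞 L) g : 𝓞 L →* 𝓞 L)

@[simp] theorem coe_unitsAut {K L : Type*} [Field K] [Field L] [Algebra K L] [NumberField L]
    [NumberField K] (g : Gal(L/K)) (u : (𝓞 L)ˣ) : ((unitsAut g u : (𝓞 L)ˣ) : 𝓞 L) = g • (u : 𝓞 L) :=
  rfl

/-- A real quadratic extension of totally real fields, unramified at all finite primes, forces the
class number of the base to be even. -/
theorem even_classNumber_of_unramified [IsTotallyReal K] [IsTotallyReal L]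
    (τ : Gal(L/K)) (hτ1 : τ ≠ 1) (hτ : ∀ g : Gal(L/K), g = 1 ∨ g = τ)
    (hur : ∀ P : Ideal (𝓞 L), P.IsPrime → P ≠ ⊥ →
      ∀ g : Gal(L/K), (∀ x : 𝓞 L, g • x - x ∈ P) → g = 1) :
    ¬ Odd (classNumber K) := by
  classical
  intro hodd
  have hττ : τ * τ = 1 := by
    rcases hτ (τ * τ) with h | h
    · exact h
    · exact absurd (mul_eq_left.mp h) hτ1
  have hττ' : ∀ x : 𝓞 L, τ • τ • x = x := fun x => by rw [smul_smul, hττ, one_smul]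
  have huniv : (Finset.univ : Finset Gal(L/K)) = {1, τ} := by
    ext g
    simpa using hτ g
  have hdeg : Module.finrank K L = 2 := by
    rw [← IsGalois.card_aut_eq_finrank, Nat.card_eq_fintype_card, ← Finset.card_univ, huniv,
      Finset.card_pair hτ1.symm]
  have hnorm : ∀ x : 𝓞 L, algebraMap (𝓞 K) (𝓞 L) (RingOfIntegers.norm K x) = x * τ • x := by
    intro x
    apply RingOfIntegers.ext
    rw [RingOfIntegers.coe_algebraMap_norm, Algebra.norm_eq_prod_automorphisms, huniv,
      Finset.prod_pair hτ1.symm]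
    rfl
  have hjinj : Function.Injective (algebraMap (𝓞 K) (𝓞 L)) := FaithfulSMul.algebraMap_injective _ _
  have hH : ∀ η : (𝓞 L)ˣ, (η : 𝓞 L) * τ • (η : 𝓞 L) = 1 →
      ∃ w : (𝓞 L)ˣ, η = w / unitsAut τ w := by
    intro η hη
    obtain ⟨β, hβ0, hβ⟩ : ∃ β : 𝓞 L, β ≠ 0 ∧ β = η * τ • β := by
      by_cases h : (1 : 𝓞 L) + η = 0
      · obtain ⟨x, hx⟩ : ∃ x : 𝓞 L, τ • x ≠ x := by
          by_contra! hc
          have := IsGaloisGroup.faithful (G := Gal(L/K)) (A := 𝓞 K) (B := 𝓞 L)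
          exact hτ1 (FaithfulSMul.eq_of_smul_eq_smul (α := 𝓞 L) fun x => by rw [hc, one_smul])
        refine ⟨x - τ • x, sub_ne_zero.mpr hx.symm, ?_⟩
        rw [smul_sub, hττ', eq_neg_of_add_eq_zero_right h]
        ring
      · refine ⟨1 + η, h, ?_⟩
        rw [smul_add, smul_one, mul_add, hη]
        ring
    have hsp : span {τ • β} = span {β} := by
      rw [span_singleton_eq_span_singleton]
      exact ⟨η, by rw [mul_comm]; exact hβ.symm⟩
    obtain ⟨I, _, hI⟩ := exists_map_mul_pow_eq_of_smul_eq K L ⊤ (fun g => Ideal.map_top _) top_ne_bot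
      (fun P hP hP0 _ => hur P hP hP0) (span {β}) (by
      intro g
      rcases hτ g with rfl | rfl
      · rw [one_smul]
      · rw [Ideal.pointwise_smul_def, Ideal.map_span, Set.image_singleton]
        exact hsp) (by simpa using hβ0)
    rw [← Ideal.one_eq_top, one_pow, mul_one] at hI
    have hI2 : (I ^ 2).IsPrincipal := by
      refine ⟨RingOfIntegers.norm K β, ?_⟩
      change I ^ 2 = span {_}
      have : (I ^ 2).map (algebraMap (𝓞 K) (𝓞 L)) =
          (span {RingOfIntegers.norm K β}).map (algebraMap (𝓞 K) (𝓞 L)) := by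
        rw [Ideal.map_pow, hI, Ideal.map_span, Set.image_singleton, hnorm, sq,
          ← Ideal.span_singleton_mul_span_singleton, hsp]
      rw [← Ideal.comap_map_eq_self_of_faithfullyFlat (B := 𝓞 L) (I ^ 2), this,
        Ideal.comap_map_eq_self_of_faithfullyFlat]
    obtain ⟨a, ha⟩ := Ideal.IsPrincipal.of_isPrincipal_pow_of_coprime
      ((Nat.coprime_two_left).mpr hodd) hI2
    change I = span {a} at ha
    rw [ha, Ideal.map_span, Set.image_singleton, Ideal.span_singleton_eq_span_singleton] at hI
    obtain ⟨w, hw⟩ := hI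
    refine ⟨w, ?_⟩
    rw [eq_div_iff_mul_eq']
    apply Units.ext
    rw [← hw, smul_mul', smul_algebraMap] at hβ
    have ha0 : algebraMap (𝓞 K) (𝓞 L) a ≠ 0 := by
      rintro h0
      rw [h0, zero_mul] at hw
      exact hβ0 hw.symm
    have : (w : 𝓞 L) = η * τ • (w : 𝓞 L) := by
      apply mul_left_cancel₀ ha0
      linear_combination hβ
    rw [Units.val_mul, coe_unitsAut]
    exact this.symm
  have hcount := two_mul_index_sq_le (Units.map (algebraMap (𝓞 K) (𝓞 L) : 𝓞 K →* 𝓞 L))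
    (Units.map (RingOfIntegers.norm K : 𝓞 L →* 𝓞 K)) (unitsAut τ)
    (Units.map_injective hjinj) (fun x => Units.ext (by simpa using hnorm x))
    (fun a => Units.ext (by simp))
    (fun x hx => hH x (by
      rw [← hnorm]
      have := congrArg (fun u : (𝓞 K)ˣ => algebraMap (𝓞 K) (𝓞 L) u) hx
      simpa using this))
    (-1) (by
      intro h
      have h2 := congrArg (fun u : (𝓞 K)ˣ => ((u : 𝓞 K) : K)) h
      norm_num [neg_eq_iff_add_eq_zero] at h2) (by simp)
    (by
      intro z hz
      have hz' : (z : 𝓞 L) ^ 2 = 1 := by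
        rw [← Units.val_pow_eq_pow_val, hz, Units.val_one]
      rcases mul_self_eq_one_iff.mp ((sq _).symm.trans hz') with h | h
      · exact Or.inl (Units.ext h)
      · exact Or.inr (Units.ext (by simpa using h)))
    (by rw [NumberField.Units.index_range_sq]; positivity)
  rw [NumberField.Units.index_range_sq, NumberField.Units.index_range_sq,
    ← Module.finrank_mul_finrank ℚ K L, hdeg, ← pow_mul] at hcount
  have : 0 < 2 ^ (Module.finrank ℚ K * 2) := by positivity
  omega

end

section
open Ideal

theorem exists_generator_of_smul_eq {K : Type*} [Field K] [NumberField K] [IsGalois ℚ K] (σ : Gal(K/ℚ))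
    (hσ : ∀ g : Gal(K/ℚ), g ∈ Subgroup.zpowers σ) (lam : 𝓞 K) (hlam : lam ≠ 0) (e : (𝓞 K)ˣ)
    (he : σ • lam = e * lam)
    (hur : ∀ P : Ideal (𝓞 K), P.IsPrime → P ≠ ⊥ → P ≠ span {lam} → ∀ g : Gal(K/ℚ),
      (∀ x : 𝓞 K, g • x - x ∈ P) → g = 1)
    (J : Ideal (𝓞 K)) (hJ0 : J ≠ ⊥) (hJ : σ • J = J) :
    ∃ (c : 𝓞 K) (j : ℕ), J = span {c} ∧ σ • c = e ^ j * c := by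
  have hz : ∀ I : Ideal (𝓞 K), σ • I = I → ∀ g : Gal(K/ℚ), g • I = I := by
    intro I hI g
    have h : Subgroup.zpowers σ ≤ MulAction.stabilizer Gal(K/ℚ) I := by
      rw [Subgroup.zpowers_le]
      exact hI
    exact h (hσ g)
  obtain ⟨I, j, hI⟩ := exists_map_mul_pow_eq_of_smul_eq ℚ K (span {lam})
    (hz _ (by
      rw [Ideal.pointwise_smul_def, Ideal.map_span, Set.image_singleton]
      change span {σ • lam} = _
      rw [he, span_singleton_eq_span_singleton]
      exact ⟨e⁻¹, by rw [mul_comm, Units.inv_mul_cancel_left]⟩)) (by simpa using hlam) hur J (hz J hJ) hJ0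
  have : IsPrincipalIdealRing (𝓞 ℚ) := classNumber_eq_one_iff.mp Rat.classNumber_eq
  obtain ⟨a, rfl⟩ := IsPrincipalIdealRing.principal I
  refine ⟨algebraMap (𝓞 ℚ) (𝓞 K) a * lam ^ j, j, ?_, ?_⟩
  · rw [← hI, Ideal.span_singleton_pow]
    change Ideal.map _ (span {a}) * _ = _
    rw [Ideal.map_span, Set.image_singleton, Ideal.span_singleton_mul_span_singleton]
  · rw [smul_mul', smul_algebraMap, smul_pow', he]
    ring

theorem exists_mul_eq_mul_smul_of_norm_eq {K : Type} [Field K] [NumberField K] [IsGalois ℚ K]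
    (σ : Gal(K/ℚ)) (hσ : ∀ g : Gal(K/ℚ), g ∈ Subgroup.zpowers σ) (a b : 𝓞 K) (ha : a ≠ 0)
    (hab : Algebra.norm ℚ (a : K) = Algebra.norm ℚ (b : K)) :
    ∃ β : 𝓞 K, β ≠ 0 ∧ a * β = b * σ • β := by
  have : IsCyclic Gal(K/ℚ) := ⟨σ, hσ⟩
  have ha' : (a : K) ≠ 0 := by simpa using ha
  have hx : Algebra.norm ℚ ((b : K) / a) = 1 := by
    have h := map_mul (Algebra.norm ℚ) ((b : K) / a) a
    rw [div_mul_cancel₀ _ ha', ← hab] at h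
    have ha0 : Algebra.norm ℚ (a : K) ≠ 0 := by simpa [Algebra.norm_eq_zero_iff] using ha
    exact (eq_div_of_mul_eq ha0 h.symm).trans (div_self ha0)
  obtain ⟨y, hy⟩ := groupCohomology.exists_div_of_norm_eq_one hσ hx
  obtain ⟨z, hz0, hz⟩ := exists_integral_multiples ℤ ℚ ({(y : K)} : Finset K)
  have hz' := hz y (Finset.mem_singleton_self _)
  refine ⟨⟨z • (y : K), hz'⟩, ?_, ?_⟩
  · intro h
    have h' := congrArg (fun x : 𝓞 K => (x : K)) h
    simp at h'
    exact hz0 h'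
  · apply RingOfIntegers.ext
    change (a : K) * (z • (y : K)) = b * σ (z • (y : K))
    have hσy : σ (y : K) ≠ 0 := by simp
    rw [map_zsmul, zsmul_eq_mul, zsmul_eq_mul]
    rw [div_eq_div_iff hσy ha'] at hy
    linear_combination (z : K) * hy

/-- The relative Hilbert 90 quotient for units is generated by `e`. -/
theorem exists_unit_of_norm_eq_one {K : Type} [Field K] [NumberField K] [IsGalois ℚ K]
    (σ : Gal(K/ℚ)) (hσ : ∀ g : Gal(K/ℚ), g ∈ Subgroup.zpowers σ) (lam : 𝓞 K) (hlam : lam ≠ 0)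
    (e : (𝓞 K)ˣ) (he : σ • lam = e * lam)
    (hur : ∀ P : Ideal (𝓞 K), P.IsPrime → P ≠ ⊥ → P ≠ span {lam} → ∀ g : Gal(K/ℚ),
      (∀ x : 𝓞 K, g • x - x ∈ P) → g = 1)
    (η : (𝓞 K)ˣ) (hη : Algebra.norm ℚ ((η : 𝓞 K) : K) = 1) :
    ∃ (w : (𝓞 K)ˣ) (j : ℕ), w = η * e ^ j * unitsAut σ w := by
  obtain ⟨β, hβ0, hβ⟩ := exists_mul_eq_mul_smul_of_norm_eq σ hσ 1 η one_ne_zero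
    (by rw [hη]; simp)
  rw [one_mul] at hβ
  obtain ⟨c, j, hc, hσc⟩ := exists_generator_of_smul_eq σ hσ lam hlam e he hur (span {β})
    (by simpa using hβ0) (by
      rw [Ideal.pointwise_smul_def, Ideal.map_span, Set.image_singleton]
      change span {σ • β} = _
      rw [span_singleton_eq_span_singleton]
      exact ⟨η, by rw [mul_comm]; exact hβ.symm⟩)
  rw [span_singleton_eq_span_singleton] at hc
  obtain ⟨w, hw⟩ := hc.symm
  have hc0 : c ≠ 0 := by
    rintro rfl
    rw [zero_mul] at hw
    exact hβ0 hw.symm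
  refine ⟨w, j, ?_⟩
  apply Units.ext
  rw [Units.val_mul, Units.val_mul, coe_unitsAut, Units.val_pow_eq_pow_val]
  apply mul_left_cancel₀ hc0
  rw [← hw, smul_mul', hσc] at hβ
  linear_combination hβ

theorem exists_unit_norm_eq_neg_one {K : Type} [Field K] [NumberField K] [IsGalois ℚ K]
    [IsTotallyReal K] (hdeg : Module.finrank ℚ K = 4)
    (σ : Gal(K/ℚ)) (hσ : ∀ g : Gal(K/ℚ), g ∈ Subgroup.zpowers σ) (lam : 𝓞 K) (hlam : lam ≠ 0)
    (e : (𝓞 K)ˣ) (he : σ • lam = e * lam) (hee : unitsAut σ e * e = -1)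
    (hur : ∀ P : Ideal (𝓞 K), P.IsPrime → P ≠ ⊥ → P ≠ span {lam} → ∀ g : Gal(K/ℚ),
      (∀ x : 𝓞 K, g • x - x ∈ P) → g = 1) :
    ∃ η : (𝓞 K)ˣ, Algebra.norm ℚ ((η : 𝓞 K) : K) = -1 := by
  by_contra! hno
  have hone : ∀ η : (𝓞 K)ˣ, Algebra.norm ℚ ((η : 𝓞 K) : K) = 1 := by
    intro η
    have h := NumberField.Units.norm K η
    rcases eq_or_eq_neg_of_abs_eq h with h | h
    · simpa using h
    · exact absurd (by simpa using h) (hno η)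
  have hσ4 : σ ^ 4 = 1 := by
    rw [← hdeg, ← IsGalois.card_aut_eq_finrank]
    exact pow_card_eq_one'
  have hσσ : ∀ w : (𝓞 K)ˣ, unitsAut σ (unitsAut σ (unitsAut σ (unitsAut σ w))) = w := by
    intro w
    apply Units.ext
    simp only [coe_unitsAut, smul_smul]
    rw [show σ * (σ * (σ * σ)) = σ ^ 4 by simp only [pow_succ, pow_zero, one_mul, mul_assoc], hσ4, one_smul]
  let H : Subgroup (𝓞 K)ˣ := Subgroup.zpowers (-1) ⊔ Subgroup.zpowers e ⊔
    (powMonoidHom 2 : (𝓞 K)ˣ →* (𝓞 K)ˣ).range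
  have hneg : (-1 : (𝓞 K)ˣ) ∈ H :=
    Subgroup.mem_sup_left (Subgroup.mem_sup_left (Subgroup.mem_zpowers _))
  have heH : e ∈ H := Subgroup.mem_sup_left (Subgroup.mem_sup_right (Subgroup.mem_zpowers _))
  have hsqH : ∀ w : (𝓞 K)ˣ, w ^ 2 ∈ H := fun w => Subgroup.mem_sup_right ⟨w, rfl⟩
  have hσe : unitsAut σ e = -1 * e⁻¹ := by rw [← hee, mul_inv_cancel_right]
  have hHσ : H ≤ H.comap (unitsAut σ) := by
    refine sup_le (sup_le ?_ ?_) ?_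
    · rw [Subgroup.zpowers_le, Subgroup.mem_comap]
      convert hneg
      apply Units.ext
      simp
    · rw [Subgroup.zpowers_le, Subgroup.mem_comap, hσe]
      exact mul_mem hneg (inv_mem heH)
    · rintro _ ⟨w, rfl⟩
      rw [Subgroup.mem_comap, powMonoidHom_apply, map_pow]
      exact hsqH _
  have key : ∀ x : (𝓞 K)ˣ, ∃ w : (𝓞 K)ˣ, ∃ h ∈ H, x = h * (w / unitsAut σ w) := by
    intro x
    obtain ⟨w, j, hw⟩ := exists_unit_of_norm_eq_one σ hσ lam hlam e he hur x (hone x)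
    refine ⟨w, (e ^ j)⁻¹, inv_mem (pow_mem heH _), ?_⟩
    rw [eq_inv_mul_iff_mul_eq, eq_div_iff_mul_eq']
    conv_rhs => rw [hw]
    simp only [mul_comm]
  have hD : ∀ h ∈ H, h / unitsAut σ h ∈ H := fun h hh => div_mem hh (hHσ hh)
  have key4 : ∀ x : (𝓞 K)ˣ, x ∈ H := by
    intro x
    obtain ⟨w₁, h₁, hh₁, rfl⟩ := key x
    obtain ⟨w₂, h₂, hh₂, rfl⟩ := key w₁
    obtain ⟨w₃, h₃, hh₃, rfl⟩ := key w₂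
    obtain ⟨w₄, h₄, hh₄, rfl⟩ := key w₃
    refine mul_mem hh₁ ?_
    have hDmul : ∀ a b : (𝓞 K)ˣ, a * b / unitsAut σ (a * b) =
        (a / unitsAut σ a) * (b / unitsAut σ b) := fun a b => by
      rw [map_mul, mul_div_mul_comm]
    rw [hDmul]
    refine mul_mem (hD _ hh₂) ?_
    rw [hDmul, hDmul]
    refine mul_mem (hD _ (hD _ hh₃)) ?_
    rw [hDmul, hDmul, hDmul]
    refine mul_mem (hD _ (hD _ (hD _ hh₄))) ?_
    simp only [map_div]
    set a := unitsAut σ w₄ with ha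
    set b := unitsAut σ a with hb
    set c := unitsAut σ b with hc
    have hd : unitsAut σ c = w₄ := hσσ w₄
    rw [hd]
    convert hsqH (w₄ * b ^ 3 / (a ^ 2 * c ^ 2)) using 1
    apply Additive.ofMul.injective
    simp only [ofMul_div, ofMul_mul, ofMul_pow]
    abel
  let f : Bool × Bool → (𝓞 K)ˣ ⧸ (powMonoidHom 2 : (𝓞 K)ˣ →* (𝓞 K)ˣ).range := fun p =>
    QuotientGroup.mk ((if p.1 then -1 else 1) * (if p.2 then e else 1))
  have hf : Function.Surjective f := by
    intro q
    obtain ⟨x, rfl⟩ := QuotientGroup.mk_surjective q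
    obtain ⟨y, hy, z, ⟨s, hs⟩, hyz⟩ := Subgroup.mem_sup.mp (key4 x)
    obtain ⟨_, ⟨i, rfl⟩, _, ⟨k, rfl⟩, rfl⟩ := Subgroup.mem_sup.mp hy
    have hp : ∀ (u : (𝓞 K)ˣ) (i : ℤ), ∃ (b : Bool) (t : (𝓞 K)ˣ), u ^ i = (if b then u else 1) * t ^ 2 := by
      intro u i
      rcases Int.even_or_odd' i with ⟨m, rfl | rfl⟩
      · exact ⟨false, u ^ m, by rw [zpow_mul', zpow_ofNat]; simp⟩
      · exact ⟨true, u ^ m, by rw [zpow_add_one, zpow_mul', zpow_ofNat]; simp [mul_comm]⟩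
    obtain ⟨b₁, t₁, h₁⟩ := hp (-1) i
    obtain ⟨b₂, t₂, h₂⟩ := hp e k
    refine ⟨(b₁, b₂), QuotientGroup.eq.mpr ⟨t₁ * t₂ * s, ?_⟩⟩
    rw [eq_inv_mul_iff_mul_eq, ← hyz, ← hs]
    simp only [h₁, h₂, powMonoidHom_apply, mul_pow]
    ac_rfl
  have hle := Nat.card_le_card_of_surjective f hf
  have hidx := NumberField.Units.index_range_sq K
  rw [Subgroup.index, hdeg] at hidx
  rw [hidx, Nat.card_prod, Nat.card_eq_fintype_card, Fintype.card_bool] at hle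
  omega

theorem isPrincipal_of_sq_of_mul_smul {K : Type} [Field K] [NumberField K] [IsGalois ℚ K]
    (σ : Gal(K/ℚ)) (hσ : ∀ g : Gal(K/ℚ), g ∈ Subgroup.zpowers σ) (lam : 𝓞 K) (hlam : lam ≠ 0)
    (e : (𝓞 K)ˣ) (he : σ • lam = e * lam)
    (hur : ∀ P : Ideal (𝓞 K), P.IsPrime → P ≠ ⊥ → P ≠ span {lam} → ∀ g : Gal(K/ℚ),
      (∀ x : 𝓞 K, g • x - x ∈ P) → g = 1)
    (η : (𝓞 K)ˣ) (hη : Algebra.norm ℚ ((η : 𝓞 K) : K) = -1)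
    (J : Ideal (𝓞 K)) (hJ0 : J ≠ ⊥) (h2 : (J ^ 2).IsPrincipal) (hT : (J * σ • J).IsPrincipal) :
    J.IsPrincipal := by
  obtain ⟨a, ha⟩ := h2
  obtain ⟨b, hb⟩ := hT
  change J ^ 2 = span {a} at ha
  change J * σ • J = span {b} at hb
  have hsmul : ∀ c : 𝓞 K, σ • (span {c} : Ideal (𝓞 K)) = span {σ • c} := by
    intro c
    rw [Ideal.pointwise_smul_def, Ideal.map_span, Set.image_singleton]
    rfl
  have ha0 : a ≠ 0 := by
    rintro rfl
    apply pow_ne_zero 2 hJ0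
    rw [ha]
    simp
  have hnσ : Algebra.norm ℚ ((σ • a : 𝓞 K) : K) = Algebra.norm ℚ (a : K) :=
    Algebra.norm_eq_of_algEquiv σ (a : K)
  have hab : |Algebra.norm ℚ (b : K)| = |Algebra.norm ℚ (a : K)| := by
    have h : span {a * σ • a} = span {b ^ 2} := by
      rw [← span_singleton_mul_span_singleton, ← hsmul, ← ha, ← Ideal.span_singleton_pow, ← hb,
        smul_pow', mul_pow]
    rw [span_singleton_eq_span_singleton] at h
    obtain ⟨u, hu⟩ := h
    have h1 := congrArg (fun x : 𝓞 K => |Algebra.norm ℚ (x : K)|) hu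
    simp only [map_mul, map_pow, abs_mul, abs_pow, hnσ, NumberField.Units.norm, mul_one] at h1
    have h2 : |Algebra.norm ℚ (b : K)| ^ 2 = |Algebra.norm ℚ (a : K)| ^ 2 := by
      linear_combination -h1
    exact (pow_left_inj₀ (abs_nonneg _) (abs_nonneg _) two_ne_zero).mp h2
  obtain ⟨b', hb', hab'⟩ : ∃ b' : 𝓞 K, span {b'} = span {b} ∧
      Algebra.norm ℚ (a : K) = Algebra.norm ℚ (b' : K) := by
    rcases abs_eq_abs.mp hab with h | h
    · exact ⟨b, rfl, h.symm⟩
    · refine ⟨b * η, ?_, ?_⟩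
      · rw [span_singleton_eq_span_singleton]
        exact ⟨η⁻¹, by rw [Units.mul_inv_cancel_right]⟩
      · change _ = Algebra.norm ℚ ((b : K) * (η : 𝓞 K))
        rw [map_mul, hη, h]
        ring
  obtain ⟨β, hβ0, hβ⟩ := exists_mul_eq_mul_smul_of_norm_eq σ hσ a b' ha0 hab'
  have hspan0 : ∀ c : 𝓞 K, c ≠ 0 → (span {c} : Ideal (𝓞 K)) ≠ 0 := by
    intro c hc
    rwa [Ne, Ideal.zero_eq_bot, span_singleton_eq_bot]
  have hJ0' : J ≠ 0 := by rwa [Ideal.zero_eq_bot]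
  have hinv : σ • (span {β} * J) = span {β} * J := by
    apply mul_left_cancel₀ (hspan0 a ha0)
    have h1 : span {a} * span {β} = J * σ • J * span {σ • β} := by
      rw [hb, ← hb', span_singleton_mul_span_singleton, span_singleton_mul_span_singleton, hβ]
    rw [← mul_assoc (span {a}) (span {β}), h1, smul_mul', hsmul, ← ha]
    ring
  have hβJ0 : span {β} * J ≠ ⊥ := by
    rw [← Ideal.zero_eq_bot]
    exact mul_ne_zero (hspan0 β hβ0) hJ0'
  obtain ⟨c, -, hc, -⟩ := exists_generator_of_smul_eq σ hσ lam hlam e he hur (span {β} * J) hβJ0 hinv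
  have hcβ : c ∈ span {β} := by
    have : c ∈ span {β} * J := hc ▸ mem_span_singleton_self c
    exact Ideal.mul_le_left this
  obtain ⟨d, rfl⟩ := mem_span_singleton.mp hcβ
  refine ⟨d, ?_⟩
  change J = span {d}
  rw [← span_singleton_mul_span_singleton] at hc
  exact mul_left_cancel₀ (hspan0 β hβ0) hc

theorem odd_classNumber_of_cyclic_quartic {K : Type} [Field K] [NumberField K] [IsGalois ℚ K]
    [IsTotallyReal K] (hdeg : Module.finrank ℚ K = 4)
    (σ : Gal(K/ℚ)) (hσ : ∀ g : Gal(K/ℚ), g ∈ Subgroup.zpowers σ) (lam : 𝓞 K) (hlam : lam ≠ 0)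
    (e : (𝓞 K)ˣ) (he : σ • lam = e * lam) (hee : unitsAut σ e * e = -1)
    (hur : ∀ P : Ideal (𝓞 K), P.IsPrime → P ≠ ⊥ → P ≠ span {lam} → ∀ g : Gal(K/ℚ),
      (∀ x : 𝓞 K, g • x - x ∈ P) → g = 1) :
    Odd (classNumber K) := by
  obtain ⟨η, hη⟩ := exists_unit_norm_eq_neg_one hdeg σ hσ lam hlam e he hee hur
  have hσ4 : σ ^ 4 = 1 := by
    rw [← hdeg, ← IsGalois.card_aut_eq_finrank]
    exact pow_card_eq_one'
  have hpr := isPrincipal_of_sq_of_mul_smul σ hσ lam hlam e he hur η hη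
  have hmul : ∀ I J : Ideal (𝓞 K), I.IsPrincipal → J.IsPrincipal → (I * J).IsPrincipal := by
    rintro _ _ ⟨a, rfl⟩ ⟨b, rfl⟩
    exact ⟨a * b, span_singleton_mul_span_singleton a b⟩
  have hsm : ∀ I : Ideal (𝓞 K), I.IsPrincipal → (σ • I).IsPrincipal := by
    rintro _ ⟨a, rfl⟩
    refine ⟨σ • a, ?_⟩
    change σ • (span {a} : Ideal (𝓞 K)) = span {σ • a}
    rw [Ideal.pointwise_smul_def, Ideal.map_span, Set.image_singleton]
    rfl
  have hsm0 : ∀ I : Ideal (𝓞 K), I ≠ ⊥ → σ • I ≠ ⊥ := by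
    intro I hI h
    apply hI
    have : σ⁻¹ • σ • I = σ⁻¹ • ⊥ := by rw [h]
    rw [inv_smul_smul] at this
    rw [this]
    exact Ideal.map_bot
  have hmul0 : ∀ I J : Ideal (𝓞 K), I ≠ ⊥ → J ≠ ⊥ → I * J ≠ ⊥ := by
    intro I J hI hJ
    rw [← Ideal.zero_eq_bot] at hI hJ ⊢
    exact mul_ne_zero hI hJ
  have hprin : ∀ I : Ideal (𝓞 K), I ≠ ⊥ → (I ^ 2).IsPrincipal → I.IsPrincipal := by
    intro I hI hI2
    have hstep : ∀ J : Ideal (𝓞 K), J ≠ ⊥ → (J ^ 2).IsPrincipal →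
        J * σ • J ≠ ⊥ ∧ ((J * σ • J) ^ 2).IsPrincipal := by
      intro J hJ hJ2
      refine ⟨hmul0 _ _ hJ (hsm0 J hJ), ?_⟩
      rw [mul_pow, ← smul_pow']
      exact hmul _ _ hJ2 (hsm _ hJ2)
    obtain ⟨h10, h12⟩ := hstep I hI hI2
    obtain ⟨h20, h22⟩ := hstep _ h10 h12
    obtain ⟨h30, h32⟩ := hstep _ h20 h22
    refine hpr I hI hI2 (hpr _ h10 h12 (hpr _ h20 h22 (hpr _ h30 h32 ?_)))
    have h1 := hsm _ hI2
    have h2 := hsm _ h1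
    have h3 := hsm _ h2
    have hI4 : σ • σ • σ • σ • I = I := by
      simp only [smul_smul]
      rw [show σ * (σ * (σ * σ)) = σ ^ 4 by simp only [pow_succ, pow_zero, one_mul, mul_assoc],
        hσ4, one_smul]
    simp only [smul_mul', smul_pow', hI4] at h1 h2 h3 ⊢
    have h := hmul _ _ hI2 (hmul _ _ (hmul _ _ h1 h1) (hmul _ _ (hmul _ _ h2 (hmul _ _ h2 h2))
      (hmul _ _ h3 h3)))
    convert h using 1
    ring
  by_contra hodd
  rw [Nat.not_odd_iff_even, even_iff_two_dvd] at hodd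
  have : Fact (Nat.Prime 2) := ⟨Nat.prime_two⟩
  obtain ⟨c, hc⟩ := exists_prime_orderOf_dvd_card (G := ClassGroup (𝓞 K)) 2 hodd
  obtain ⟨I, rfl⟩ := ClassGroup.mk0_surjective c
  have hI2 : ((I : Ideal (𝓞 K)) ^ 2).IsPrincipal := by
    have h := pow_orderOf_eq_one (ClassGroup.mk0 I)
    rw [hc, ← map_pow] at h
    obtain ⟨Q, hQ⟩ : ∃ Q, Q = I ^ 2 := ⟨_, rfl⟩
    rw [← hQ] at h
    have h' := (ClassGroup.mk0_eq_one_iff Q.2).mp h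
    rwa [hQ, SubmonoidClass.coe_pow] at h'
  have hI := hprin I (nonZeroDivisors.ne_zero I.2) hI2
  rw [(ClassGroup.mk0_eq_one_iff I.2).mpr hI, orderOf_one] at hc
  norm_num at hc

end

/-- An odd positive integer dividing `a ^ 2 + 1` is congruent to `1` modulo `4`. -/
theorem Nat.mod_four_eq_one_of_dvd_sq_add_one {m : ℕ} {a : ℤ} (hm : Odd m)
    (h : (m : ℤ) ∣ a ^ 2 + 1) : m % 4 = 1 := by
  have hsq : IsSquare (-1 : ZMod m) := by
    refine ⟨a, ?_⟩
    have := (ZMod.intCast_zmod_eq_zero_iff_dvd (a ^ 2 + 1) m).mpr h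
    push_cast at this
    linear_combination -this
  obtain ⟨x, y, rfl⟩ := Nat.eq_sq_add_sq_of_isSquare_mod_neg_one hsq
  obtain ⟨k, hk⟩ := hm
  rcases Nat.even_or_odd' x with ⟨s, rfl | rfl⟩ <;> rcases Nat.even_or_odd' y with ⟨t, rfl | rfl⟩ <;>
    ring_nf at hk ⊢ <;> omega

theorem exists_int_of_isIntegral_unit {l : ℕ} (hl : l.Prime) (hl8 : l % 8 = 1) {ε : ℝ} (h1 : 1 < ε)
    (h_int : IsIntegral ℤ ε) (h_int' : IsIntegral ℤ ε⁻¹) {u v : ℚ}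
    (he : ε = (u : ℝ) + (v : ℝ) * √(l : ℝ)) (hn : (u : ℝ) ^ 2 - (v : ℝ) ^ 2 * (l : ℝ) = -1) :
    ∃ U V : ℤ, ε = U + V * √(l : ℝ) ∧ U ^ 2 + 1 = l * V ^ 2 ∧ 0 < V ∧ V % 4 = 1 ∧ U % 4 = 0 := by
  have hr : √(l : ℝ) ^ 2 = l := Real.sq_sqrt (by positivity)
  have hrpos : 0 < √(l : ℝ) := Real.sqrt_pos.mpr (by exact_mod_cast hl.pos)
  have hinv : ε⁻¹ = -(u : ℝ) + v * √(l : ℝ) := by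
    refine inv_eq_of_mul_eq_one_right ?_
    rw [he]
    linear_combination -hn + (v : ℝ) ^ 2 * hr
  have hnq : u ^ 2 - v ^ 2 * l = -1 := by exact_mod_cast hn
  have hcoe : ∀ q : ℚ, IsIntegral ℤ ((q : ℚ) : ℝ) → ∃ z : ℤ, (z : ℚ) = q := by
    intro q hq
    have : IsIntegral ℤ (algebraMap ℚ ℝ q) := hq
    rw [isIntegral_algebraMap_iff (algebraMap ℚ ℝ).injective] at this
    exact IsIntegrallyClosed.isIntegral_iff.mp this
  obtain ⟨A, hA⟩ : ∃ z : ℤ, (z : ℚ) = 2 * u := hcoe _ (by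
    have h2 : ((2 * u : ℚ) : ℝ) = ε - ε⁻¹ := by
      rw [hinv, he]
      push_cast
      ring
    rw [h2]
    exact h_int.sub h_int')
  obtain ⟨C, hC⟩ : ∃ z : ℤ, (z : ℚ) = 2 * v * l := by
    have : IsIntegral ℤ (2 * v * l) := by
      refine IsIntegral.of_pow (n := 2) two_pos ?_
      have : (2 * v * l) ^ 2 = ((l * (A ^ 2 + 4) : ℤ) : ℚ) := by
        push_cast
        rw [hA]
        linear_combination -4 * (l : ℚ) * hnq
      rw [this]
      exact isIntegral_algebraMap
    exact IsIntegrallyClosed.isIntegral_iff.mp this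
  have hCA : C ^ 2 = l * (A ^ 2 + 4) := by
    have : (C : ℚ) ^ 2 = l * (A ^ 2 + 4) := by
      rw [hA, hC]
      linear_combination -4 * (l : ℚ) * hnq
    exact_mod_cast this
  have hl0 : (l : ℤ) ≠ 0 := by exact_mod_cast hl.ne_zero
  obtain ⟨B, rfl⟩ : (l : ℤ) ∣ C :=
    (Nat.prime_iff_prime_int.mp hl).dvd_of_dvd_pow (Dvd.intro _ hCA.symm)
  have hB : (B : ℚ) = 2 * v := by
    have hl0' : (l : ℚ) ≠ 0 := by exact_mod_cast hl.ne_zero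
    apply mul_left_cancel₀ hl0'
    push_cast at hC
    linear_combination hC
  have hBA : l * B ^ 2 = A ^ 2 + 4 := by
    apply mul_left_cancel₀ hl0
    linear_combination hCA
  obtain ⟨k, hk⟩ : ∃ k : ℤ, (l : ℤ) = 8 * k + 1 := ⟨l / 8, by omega⟩
  have h8 : ∀ x : ℤ, x ^ 2 % 8 = 0 ∨ x ^ 2 % 8 = 1 ∨ x ^ 2 % 8 = 4 := by
    intro x
    have : x % 8 = 0 ∨ x % 8 = 1 ∨ x % 8 = 2 ∨ x % 8 = 3 ∨ x % 8 = 4 ∨ x % 8 = 5 ∨ x % 8 = 6 ∨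
      x % 8 = 7 := by omega
    rcases this with h | h | h | h | h | h | h | h <;> simp [pow_two, Int.mul_emod, h]
  have hpar : ∀ x : ℤ, x ^ 2 % 2 = x % 2 := by
    intro x
    rcases Int.emod_two_eq_zero_or_one x with h | h <;> simp [pow_two, Int.mul_emod, h]
  have hBA' : 8 * (k * B ^ 2) + B ^ 2 = A ^ 2 + 4 := by rw [← hBA, hk]; ring
  have hAe : A % 2 = 0 := by
    have := h8 A
    have := h8 B
    have := hpar A
    omega
  have hBe : B % 2 = 0 := by
    have := hpar A
    have := hpar B
    omega
  obtain ⟨U, rfl⟩ := Int.dvd_of_emod_eq_zero hAe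
  obtain ⟨V, rfl⟩ := Int.dvd_of_emod_eq_zero hBe
  have huU : u = U := by
    push_cast at hA
    linarith
  have hvV : v = V := by
    push_cast at hB
    linarith
  subst huU hvV
  have hUV : U ^ 2 + 1 = l * V ^ 2 := by linarith
  have hVpos : 0 < V := by
    have h3 : 0 < ε⁻¹ := by positivity
    have h4 : 0 < (V : ℝ) * √(l : ℝ) := by
      push_cast at he hinv
      linarith
    have h5 := pos_of_mul_pos_left h4 hrpos.le
    exact_mod_cast h5
  have hUV' : 8 * (k * V ^ 2) + V ^ 2 = U ^ 2 + 1 := by rw [hUV, hk]; ring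
  have hU8 : U ^ 2 % 8 = 0 := by
    have := h8 U
    have := h8 V
    omega
  have hVo : V % 2 = 1 := by
    have := hpar V
    omega
  refine ⟨U, V, by push_cast at he; exact he, hUV, hVpos, ?_, ?_⟩
  · have h := Nat.mod_four_eq_one_of_dvd_sq_add_one (m := V.toNat) (a := U) (by
      rw [Nat.odd_iff]
      omega) (by
      rw [hUV, Int.toNat_of_nonneg hVpos.le]
      exact Dvd.intro_left (l * V) (by ring))
    omega
  · have : U % 8 = 0 ∨ U % 8 = 1 ∨ U % 8 = 2 ∨ U % 8 = 3 ∨ U % 8 = 4 ∨ U % 8 = 5 ∨ U % 8 = 6 ∨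
      U % 8 = 7 := by omega
    rcases this with h | h | h | h | h | h | h | h <;>
      simp [pow_two, Int.mul_emod, h] at hU8 <;> omega

theorem eq_one_of_squarefree_of_eq_sq {m : ℕ} (hm : Squarefree m) {q : ℚ} (h : (m : ℚ) = q ^ 2) :
    m = 1 := by
  have : IsSquare (m : ℚ) := ⟨q, by rw [h, sq]⟩
  rw [Rat.isSquare_natCast_iff] at this
  obtain ⟨a, rfl⟩ := this
  have := hm a dvd_rfl
  rw [Nat.isUnit_iff.mp this]

section

open Polynomial

theorem irreducible_quartic_of_prime {l : ℕ} (hl : l.Prime) {a b : ℤ} (ha : (l : ℤ) ∣ a)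
    (hb : (l : ℤ) ∣ b) (hb2 : ¬ (l : ℤ) ^ 2 ∣ b) :
    Irreducible (X ^ 4 + C (a : ℚ) * X ^ 2 + C (b : ℚ) : ℚ[X]) := by
  set P : ℤ[X] := X ^ 4 + C a * X ^ 2 + C b with hP
  have hdeg : P.natDegree = 4 := by rw [hP]; compute_degree!
  have hmon : P.Monic := by rw [hP]; monicity!
  have hprime : (Ideal.span {(l : ℤ)}).IsPrime := by
    rw [Ideal.span_singleton_prime (by exact_mod_cast hl.ne_zero)]
    exact Nat.prime_iff_prime_int.mp hl
  have hE : P.IsEisensteinAt (Ideal.span {(l : ℤ)}) := by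
    refine ⟨?_, ?_, ?_⟩
    · rw [hmon.leadingCoeff, ← Ideal.ne_top_iff_one]
      exact hprime.ne_top
    · intro m hm
      rw [hdeg] at hm
      rw [Ideal.mem_span_singleton]
      simp only [hP, coeff_add, coeff_C_mul, coeff_X_pow, coeff_C]
      interval_cases m <;> simp [ha, hb]
    · rw [Ideal.span_singleton_pow, Ideal.mem_span_singleton]
      simpa [hP] using hb2
  have hirr := hE.irreducible hprime hmon.isPrimitive (by rw [hdeg]; norm_num)
  rw [hmon.irreducible_iff_irreducible_map_fraction_map (K := ℚ)] at hirr
  simpa [hP] using hirr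

/-- The field generated by a root of `X ^ 4 - 2 n V l X ^ 2 + n ^ 2 l`, where `U ^ 2 + 1 = l V ^ 2`,
is a cyclic quartic field. -/
theorem cyclic_quartic_of_root {K : Type} [Field K] [NumberField K] {l n : ℕ} {U V : ℤ}
    (hl : l.Prime) (hnl : n.Coprime l) (hn0 : 0 < n) (hUV : U ^ 2 + 1 = l * V ^ 2)
    (μ : K) (hgen : ∀ F : Subfield K, μ ∈ F → F = ⊤)
    (hμ : μ ^ 4 - 2 * n * V * l * μ ^ 2 + n ^ 2 * l = 0) :
    Module.finrank ℚ K = 4 ∧ IsGalois ℚ K ∧ Algebra.norm ℚ μ = n ^ 2 * l ∧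
      ∃ (r : K) (σ : Gal(K/ℚ)), r ^ 2 = l ∧ μ ^ 2 = n * (V * l + U * r) ∧ σ μ * μ = n * r ∧
        σ r = -r ∧ (∀ g : Gal(K/ℚ), g ∈ Subgroup.zpowers σ) ∧ (σ * σ) μ = -μ := by
  have hU0 : U ≠ 0 := by
    rintro rfl
    have h1 : (l : ℤ) ∣ 1 := Dvd.intro _ (by rw [← hUV]; ring)
    exact hl.one_lt.ne' (by exact_mod_cast Int.eq_one_of_dvd_one (by positivity) h1)
  have hUK : (U : K) ≠ 0 := by exact_mod_cast hU0
  have hnK : (n : K) ≠ 0 := by exact_mod_cast hn0.ne'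
  have hlK : (l : K) ≠ 0 := by exact_mod_cast hl.ne_zero
  have hUVK : (U : K) ^ 2 + 1 = l * (V : K) ^ 2 := by exact_mod_cast congrArg (Int.cast : ℤ → K) hUV
  have hμ0 : μ ≠ 0 := by
    rintro rfl
    have : (n : K) ^ 2 * l = 0 := by linear_combination hμ
    exact mul_ne_zero (pow_ne_zero 2 hnK) hlK this
  set P : ℚ[X] := X ^ 4 + C ((-(2 * n * V * l) : ℤ) : ℚ) * X ^ 2 + C ((n ^ 2 * l : ℤ) : ℚ) with hP
  have hPirr : Irreducible P := by
    refine irreducible_quartic_of_prime hl (Dvd.intro_left (-(2 * n * V)) (by ring))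
      (Dvd.intro_left _ rfl) ?_
    rw [sq (l : ℤ), mul_dvd_mul_iff_right (by exact_mod_cast hl.ne_zero)]
    intro h
    have h2 : l ∣ n ^ 2 := by exact_mod_cast h
    have h3 := Nat.Coprime.eq_one_of_dvd (hnl.symm.pow_right 2) h2
    exact hl.one_lt.ne' h3
  have hPmon : P.Monic := by rw [hP]; monicity!
  have hPdeg : P.natDegree = 4 := by rw [hP]; compute_degree!
  have hPaeval : ∀ x : K, aeval x P = x ^ 4 - 2 * n * V * l * x ^ 2 + n ^ 2 * l := by
    intro x
    rw [hP]
    simp only [map_add, map_mul, map_pow, aeval_X, aeval_C, eq_ratCast]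
    push_cast
    ring
  have hmin : minpoly ℚ μ = P :=
    (minpoly.eq_of_irreducible_of_monic hPirr (by rw [hPaeval, hμ]) hPmon).symm
  have h_int : IsIntegral ℚ μ := Algebra.IsIntegral.isIntegral μ
  have htop : IntermediateField.adjoin ℚ {μ} = ⊤ := by
    have h := hgen (IntermediateField.adjoin ℚ {μ}).toSubfield
      (IntermediateField.mem_adjoin_simple_self ℚ μ)
    rw [eq_top_iff]
    intro x _
    have : x ∈ (IntermediateField.adjoin ℚ {μ}).toSubfield := by rw [h]; trivial
    exact this
  have htop' : Algebra.adjoin ℚ {μ} = ⊤ := by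
    rw [← IntermediateField.adjoin_simple_toSubalgebra_of_isAlgebraic h_int.isAlgebraic, htop]
    rfl
  let pb := PowerBasis.ofAdjoinEqTop h_int htop'
  have hpbgen : pb.gen = μ := rfl
  have hdeg : Module.finrank ℚ K = 4 := by
    rw [pb.finrank, PowerBasis.ofAdjoinEqTop_dim, hmin, hPdeg]
  have hnorm : Algebra.norm ℚ μ = n ^ 2 * l := by
    rw [← hpbgen, Algebra.PowerBasis.norm_gen_eq_coeff_zero_minpoly, hpbgen, ← pb.finrank, hdeg, hmin,
      hP]
    simp only [coeff_add, coeff_C_mul, coeff_X_pow, coeff_C]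
    norm_num
  obtain ⟨r, hr⟩ : ∃ r : K, r = (μ ^ 2 / n - V * l) / U := ⟨_, rfl⟩
  have hr1 : μ ^ 2 = n * (V * l + U * r) := by
    rw [hr]
    field_simp
    ring
  have hr2 : r ^ 2 = l := by
    have h4 : (n : K) ^ 2 * U ^ 2 * (r ^ 2 - l) = 0 := by
      have : μ ^ 4 = (n * (V * l + U * r)) ^ 2 := by rw [← hr1]; ring
      rw [this, hr1] at hμ
      linear_combination hμ - (n : K) ^ 2 * l * hUVK
    have := (mul_eq_zero.mp h4).resolve_left (by positivity)
    exact sub_eq_zero.mp this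
  have hr0 : r ≠ 0 := by
    rintro h
    rw [h] at hr2
    exact hlK (by rw [← hr2]; ring)
  let s : K →ₐ[ℚ] K := pb.lift (n * r / μ) (by
    rw [hpbgen, hmin, hPaeval]
    have hy : (n * r / μ) ^ 2 * μ ^ 2 = n ^ 2 * l := by
      rw [← mul_pow, div_mul_cancel₀ _ hμ0, mul_pow, hr2]
    apply mul_left_cancel₀ (pow_ne_zero 4 hμ0)
    linear_combination (n ^ 2 * l : K) * hμ +
      (μ ^ 2 * (n * r / μ) ^ 2 + n ^ 2 * l - 2 * n * V * l * μ ^ 2) * hy)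
  have hs : s μ = n * r / μ := pb.lift_gen _ _
  let σ : Gal(K/ℚ) := AlgEquiv.ofBijective s (Algebra.IsAlgebraic.algHom_bijective s)
  have hσμ : σ μ * μ = n * r := by
    change s μ * μ = n * r
    rw [hs, div_mul_cancel₀ _ hμ0]
  have hσr : σ r = -r := by
    have h1 := congrArg σ hr1
    simp only [map_pow, map_mul, map_add, map_natCast, map_intCast] at h1
    have h2 : (σ μ * μ) ^ 2 = (n * r) ^ 2 := by rw [hσμ]
    rw [mul_pow, h1] at h2
    have h3 : μ ^ 2 * (n * U * (σ r + r)) = 0 := by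
      linear_combination h2 - (n : K) * (V * l - U * r) * hr1 +
        (n : K) ^ 2 * (1 + U ^ 2) * hr2 + (n : K) ^ 2 * l * hUVK
    have h4 := (mul_eq_zero.mp h3).resolve_left (pow_ne_zero 2 hμ0)
    exact eq_neg_of_add_eq_zero_left ((mul_eq_zero.mp h4).resolve_left (mul_ne_zero hnK hUK))
  have hσσ : (σ * σ) μ = -μ := by
    change σ (σ μ) = -μ
    have h1 := congrArg σ hσμ
    rw [map_mul, map_mul, hσr, map_natCast] at h1
    have h0 : σ μ ≠ 0 := by simpa using hμ0
    apply mul_right_cancel₀ h0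
    linear_combination h1 + hσμ
  have hσ4 : σ ^ 4 = 1 := by
    have hfix : ((σ * σ) * (σ * σ)) μ = μ := by
      rw [AlgEquiv.mul_apply (σ * σ), hσσ, map_neg, hσσ, neg_neg]
    have h := hgen ((((σ * σ) * (σ * σ) : Gal(K/ℚ)) : K →+* K).eqLocusField (RingHom.id K)) hfix
    rw [show 4 = 2 * 2 by norm_num, pow_mul, sq σ, sq]
    ext x
    have hx : x ∈ (((σ * σ) * (σ * σ) : Gal(K/ℚ)) : K →+* K).eqLocusField (RingHom.id K) := by
      rw [h]
      trivial
    exact hx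
  have hord : orderOf σ = 4 := by
    have h22 : (4 : ℕ) = 2 ^ (1 + 1) := rfl
    rw [h22]
    refine orderOf_eq_prime_pow ?_ (by rw [← h22, hσ4])
    intro h
    rw [pow_one, sq] at h
    rw [h] at hσσ
    change μ = -μ at hσσ
    have : (2 : K) * μ = 0 := by linear_combination hσσ
    exact mul_ne_zero two_ne_zero hμ0 this
  have hcard : Nat.card Gal(K/ℚ) = 4 := by
    apply le_antisymm
    · rw [Nat.card_eq_fintype_card, ← hdeg]
      exact AlgEquiv.card_le
    · rw [← hord]
      exact orderOf_le_card
  refine ⟨hdeg, IsGalois.of_card_aut_eq_finrank ℚ K (by rw [hcard, hdeg]), hnorm, r, σ, hr2, hr1,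
    hσμ, hσr, ?_, hσσ⟩
  intro g
  have : Subgroup.zpowers σ = ⊤ := by
    apply Subgroup.eq_top_of_card_eq
    rw [Nat.card_zpowers, hord, hcard]
  rw [this]
  trivial

end

theorem Complex.star_eq_of_sq_eq {z : ℂ} {t : ℝ} (ht : 0 ≤ t) (h : z ^ 2 = t) : star z = z := by
  have h1 : z ^ 2 = ((√t : ℝ) : ℂ) ^ 2 := by
    rw [h, ← Complex.ofReal_pow, Real.sq_sqrt ht]
  rcases sq_eq_sq_iff_eq_or_eq_neg.mp h1 with rfl | rfl <;> simp

theorem NumberField.isTotallyReal_of_forall_mem {K : Type*} [Field K] [NumberField K]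
    (h : ∀ x : K, x ∈ maximalRealSubfield K) : IsTotallyReal K := by
  rw [← isTotallyReal_top_iff, isTotallyReal_iff_le_maximalRealSubfield]
  exact fun x _ => h x

theorem isTotallyReal_of_root {K : Type*} [Field K] [NumberField K] {l n : ℕ} {U V : ℤ}
    (hUV : U ^ 2 + 1 = l * V ^ 2) (hV : 0 < V) (μ r : K) (hgen : ∀ F : Subfield K, μ ∈ F → F = ⊤)
    (hr : r ^ 2 = l) (hμ : μ ^ 2 = n * (V * l + U * r)) : IsTotallyReal K := by
  refine NumberField.isTotallyReal_of_forall_mem fun x => ?_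
  rw [hgen (maximalRealSubfield K) ?_]
  · trivial
  intro φ
  have hφr : φ r ^ 2 = ((l : ℝ) : ℂ) := by rw [← map_pow, hr]; simp
  obtain ⟨ρ, hρ⟩ := Complex.conj_eq_iff_real.mp
    (Complex.star_eq_of_sq_eq (Nat.cast_nonneg l) hφr)
  have hρ2 : ρ ^ 2 = l := by
    rw [hρ] at hφr
    exact_mod_cast hφr
  have hUVR : (U : ℝ) ^ 2 + 1 = l * (V : ℝ) ^ 2 := by exact_mod_cast congrArg (Int.cast : ℤ → ℝ) hUV
  have hV' : (0 : ℝ) < V := by exact_mod_cast hV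
  refine Complex.star_eq_of_sq_eq (t := n * (V * l + U * ρ)) ?_ ?_
  · apply mul_nonneg (Nat.cast_nonneg n)
    have h1 : |U * ρ| ≤ V * l := by
      apply abs_le_of_sq_le_sq _ (by positivity)
      rw [mul_pow, hρ2]
      have hl : (0 : ℝ) ≤ l := Nat.cast_nonneg l
      have : ((V : ℝ) * l) ^ 2 = U ^ 2 * l + l := by linear_combination -(l : ℝ) * hUVR
      rw [this]
      linarith
    have := (abs_le.mp h1).1
    linarith
  · rw [← map_pow, hμ, map_mul, map_add, map_mul, map_mul, hρ]
    simp

theorem isIntegral_half_one_add {L : Type*} [Field L] [CharZero L] {y r : L} {l : ℕ} {U V : ℤ}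
    (hr : r ^ 2 = l) (hy : y ^ 2 = V * l + U * r) (hl : l % 4 = 1) (hV : V % 4 = 1)
    (hU : U % 4 = 0) : IsIntegral ℤ ((1 + y) / 2) := by
  have hrint : IsIntegral ℤ r := by
    refine IsIntegral.of_pow (n := 2) two_pos ?_
    rw [hr]
    exact_mod_cast isIntegral_algebraMap (R := ℤ) (A := L) (x := (l : ℤ))
  obtain ⟨k, hk⟩ : ∃ k : ℤ, V * l = 4 * k + 1 := by
    refine ⟨V * l / 4, ?_⟩
    have : V * l % 4 = 1 := by
      rw [Int.mul_emod, hV, show (l : ℤ) % 4 = 1 by omega]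
      rfl
    omega
  obtain ⟨m, rfl⟩ := Int.dvd_of_emod_eq_zero hU
  have hk' : (V : L) * l = 4 * k + 1 := by exact_mod_cast congrArg (Int.cast : ℤ → L) hk
  have h1 : IsIntegral ℤ ((k : L) + m * r) := by
    have h2 (z : ℤ) : IsIntegral ℤ (z : L) := isIntegral_algebraMap (R := ℤ) (x := z)
    exact (h2 k).add ((h2 m).mul hrint)
  refine IsIntegral.of_aeval_monic (p := Polynomial.X ^ 2 - Polynomial.X) (by monicity!)
    (by
      have : (Polynomial.X ^ 2 - Polynomial.X : Polynomial ℤ).natDegree = 2 := by compute_degree!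
      rw [this]
      norm_num) ?_
  have h2 : Polynomial.aeval ((1 + y) / 2) (Polynomial.X ^ 2 - Polynomial.X : Polynomial ℤ) =
      (k : L) + m * r := by
    rw [map_sub, map_pow, Polynomial.aeval_X]
    push_cast at hy
    linear_combination hy / 4 + hk' / 4
  rw [h2]
  exact h1

theorem odd_classNumber_of_root {K : Type} [Field K] [NumberField K] {l : ℕ} {U V : ℤ}
    (hl : l.Prime) (hl4 : l % 4 = 1) (hUV : U ^ 2 + 1 = l * V ^ 2) (hV : 0 < V) (hV4 : V % 4 = 1)
    (hU4 : U % 4 = 0) (μ : K) (hgen : ∀ F : Subfield K, μ ∈ F → F = ⊤)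
    (hμ : μ ^ 4 - 2 * V * l * μ ^ 2 + l = 0) : Odd (classNumber K) := by
  obtain ⟨hdeg, hgal, hnorm, r, σ, hr, hμr, hσμ, hσr, hσ, hσσ⟩ :=
    cyclic_quartic_of_root hl (Nat.coprime_one_left l) one_pos hUV μ hgen
      (by push_cast; linear_combination hμ)
  have := isTotallyReal_of_root hUV hV μ r hgen hr hμr
  rw [Nat.cast_one, one_mul] at hμr hσμ
  rw [Nat.cast_one, one_pow, one_mul] at hnorm
  have hUVK : (U : K) ^ 2 + 1 = l * (V : K) ^ 2 := by exact_mod_cast congrArg (Int.cast : ℤ → K) hUV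
  have hμ0 : μ ≠ 0 := by
    rintro rfl
    have : (l : K) = 0 := by linear_combination hμ
    exact hl.ne_zero (by exact_mod_cast this)
  have hrint : IsIntegral ℤ r := by
    refine IsIntegral.of_pow (n := 2) two_pos ?_
    rw [hr]
    exact_mod_cast isIntegral_algebraMap (R := ℤ) (A := K) (x := (l : ℤ))
  have hθint := isIntegral_half_one_add hr hμr hl4 hV4 hU4
  obtain ⟨R, hR⟩ : ∃ R : 𝓞 K, (R : K) = r := ⟨⟨r, hrint⟩, rfl⟩
  obtain ⟨θ, hθ⟩ : ∃ θ : 𝓞 K, (θ : K) = (1 + μ) / 2 := ⟨⟨(1 + μ) / 2, hθint⟩, rfl⟩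
  obtain ⟨lam, hlam⟩ : ∃ lam : 𝓞 K, (lam : K) = μ := ⟨2 * θ - 1, by
    change 2 * (θ : K) - 1 = μ
    rw [hθ]
    ring⟩
  have hlam0 : lam ≠ 0 := by
    rintro rfl
    exact hμ0 (by simpa using hlam.symm)
  have hsmul : ∀ x : 𝓞 K, ((σ • x : 𝓞 K) : K) = σ x := fun _ => rfl
  have hR2 : R ^ 2 = l := RingOfIntegers.ext (by simpa [hR] using hr)
  have hUVO : (U : 𝓞 K) ^ 2 + 1 = l * (V : 𝓞 K) ^ 2 := by
    exact_mod_cast congrArg (Int.cast : ℤ → 𝓞 K) hUV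
  let e : (𝓞 K)ˣ := ⟨V * R - U, V * R + U, by linear_combination (V : 𝓞 K) ^ 2 * hR2 - hUVO,
    by linear_combination (V : 𝓞 K) ^ 2 * hR2 - hUVO⟩
  have he : (e : 𝓞 K) = V * R - U := rfl
  have hσR : σ • R = -R := RingOfIntegers.ext (by rw [hsmul, hR, hσr, ← hR]; simp)
  refine odd_classNumber_of_cyclic_quartic hdeg σ hσ lam hlam0 e ?_ ?_ ?_
  · apply RingOfIntegers.ext
    rw [hsmul, he]
    simp only [map_mul, map_sub, map_intCast, hR, hlam]
    apply mul_right_cancel₀ hμ0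
    rw [hσμ]
    linear_combination (-(V * r - U) : K) * hμr - (U * V : K) * hr + r * hUVK
  · apply Units.ext
    rw [Units.val_mul, coe_unitsAut, he, smul_sub, smul_mul', hσR]
    have h1 (z : ℤ) : σ • (z : 𝓞 K) = z := RingOfIntegers.ext (by simp [hsmul])
    rw [h1, h1, Units.val_neg, Units.val_one]
    linear_combination -(V : 𝓞 K) ^ 2 * hR2 + hUVO
  · have hprime : (Ideal.span {lam}).IsPrime := by
      apply Ideal.isPrime_of_irreducible_absNorm
      rw [Ideal.absNorm_span_singleton]
      have h1 : Algebra.norm ℤ lam = (l : ℤ) := by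
        have h2 := Algebra.coe_norm_int lam
        rw [hlam, hnorm] at h2
        exact_mod_cast h2
      rw [h1, Int.natAbs_natCast]
      exact hl
    intro P hP hP0 hPl g hg
    by_contra hg1
    have hlamP : lam ∉ P := by
      intro h
      have hmax := hprime.isMaximal (by simpa using hlam0)
      exact hPl (hmax.eq_of_le hP.ne_top (by simpa [Ideal.span_singleton_le_iff_mem] using h)).symm
    have hmul : ∀ x : 𝓞 K, (g * g) • x - x ∈ P := by
      intro x
      have := P.add_mem (hg (g • x)) (hg x)
      rwa [sub_add_sub_cancel, smul_smul] at this
    have hkey : ∀ h : Gal(K/ℚ), (∀ x : 𝓞 K, h • x - x ∈ P) → h ≠ σ * σ := by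
      rintro _ h rfl
      apply hlamP
      have h1 : (σ * σ) • θ - θ = -lam := by
        apply RingOfIntegers.ext
        push_cast
        change (σ * σ) (θ : K) - θ = -lam
        rw [hθ, map_div₀, map_add, hσσ, hlam, map_one, map_ofNat]
        ring
      have h2 := h θ
      rw [h1] at h2
      simpa using h2
    have hσ4 : σ ^ 4 = 1 := by
      rw [← hdeg, ← IsGalois.card_aut_eq_finrank]
      exact pow_card_eq_one'
    obtain ⟨k, rfl⟩ := hσ g
    have hmod : ∀ k : ℤ, σ ^ k = σ ^ (k % 4) := fun k => by
      conv_lhs => rw [← Int.emod_add_mul_ediv k 4, zpow_add, zpow_mul]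
      rw [show σ ^ (4 : ℤ) = 1 from hσ4, one_zpow, mul_one]
    have hk : k % 4 = 0 ∨ k % 4 = 2 ∨ (k + k) % 4 = 2 := by omega
    rcases hk with h | h | h
    · apply hg1
      change σ ^ k = 1
      rw [hmod, h, zpow_zero]
    · apply hkey _ hg
      change σ ^ k = _
      rw [hmod, h, zpow_two]
    · apply hkey _ hmul
      change σ ^ k * σ ^ k = _
      rw [← zpow_add, hmod, h, zpow_two]

theorem not_exists_sq_eq_of_squarefree {K : Type*} [Field K] [NumberField K] [IsGalois ℚ K]
    {l n : ℕ} (hl : l.Prime) (hn : Squarefree n) (hnl : n.Coprime l) (hn1 : n ≠ 1) {r : K}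
    {σ : Gal(K/ℚ)} (hr : r ^ 2 = l) (hσr : σ r = -r) (hσ : ∀ g, g ∈ Subgroup.zpowers σ) (s : K) :
    s ^ 2 ≠ n := by
  intro hs
  have hfix : ∀ x : K, σ x = x → ∃ q : ℚ, algebraMap ℚ K q = x := by
    intro x hx
    have hmem : ∀ g : Gal(K/ℚ), g x = x := by
      intro g
      have h1 : Subgroup.zpowers σ ≤ MulAction.stabilizer Gal(K/ℚ) x := by
        rw [Subgroup.zpowers_le]
        exact hx
      exact h1 (hσ g)
    exact (IsGalois.mem_range_algebraMap_iff_fixed x).mpr hmem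
  have hσs : σ s = s ∨ σ s = -s := by
    apply sq_eq_sq_iff_eq_or_eq_neg.mp
    rw [← map_pow, hs, map_natCast]
  rcases hσs with h | h
  · obtain ⟨q, hq⟩ := hfix s h
    refine hn1 (eq_one_of_squarefree_of_eq_sq hn (q := q) ?_)
    apply (algebraMap ℚ K).injective
    rw [map_pow, hq, hs, map_natCast]
  · obtain ⟨q, hq⟩ := hfix (s * r) (by rw [map_mul, h, hσr, neg_mul_neg])
    have hnl1 : n * l = 1 := by
      refine eq_one_of_squarefree_of_eq_sq
        ((Nat.squarefree_mul hnl).mpr ⟨hn, hl.prime.irreducible.squarefree⟩) (q := q) ?_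
      apply (algebraMap ℚ K).injective
      rw [map_pow, hq, mul_pow, hs, hr, map_natCast, Nat.cast_mul]
    exact hl.one_lt.ne' (Nat.eq_one_of_mul_eq_one_left hnl1)

theorem PowerBasis.isTotallyReal_of_gen_sq_eq {K L : Type*} [Field K] [NumberField K] [Field L]
    [NumberField L] [Algebra K L] [IsTotallyReal K] (pb : PowerBasis K L) {n : ℕ}
    (hs : pb.gen ^ 2 = n) : IsTotallyReal L := by
  refine NumberField.isTotallyReal_of_forall_mem fun x => ?_
  have hK : ∀ a : K, algebraMap K L a ∈ maximalRealSubfield L := by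
    intro a φ
    have ha : a ∈ maximalRealSubfield K := by
      rw [IsTotallyReal.maximalRealSubfield_eq_top]
      trivial
    exact ha (φ.comp (algebraMap K L))
  have hgen : pb.gen ∈ maximalRealSubfield L := by
    intro φ
    refine Complex.star_eq_of_sq_eq (t := n) (Nat.cast_nonneg n) ?_
    rw [← map_pow, hs]
    simp
  obtain ⟨f, rfl⟩ := pb.exists_eq_aeval' x
  rw [Polynomial.aeval_eq_sum_range]
  refine sum_mem fun i _ => ?_
  rw [Algebra.smul_def]
  exact mul_mem (hK _) (pow_mem hgen _)

theorem PowerBasis.exists_neg_gen {K L : Type*} [Field K] [CharZero K] [Field L] [Algebra K L]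
    (pb : PowerBasis K L) {n : ℕ} (hs : pb.gen ^ 2 = n) (hK : ∀ a : K, a ^ 2 ≠ n) :
    IsGalois K L ∧ ∃ τ : Gal(L/K), τ pb.gen = -pb.gen ∧ ∀ g, g = 1 ∨ g = τ := by
  have := pb.finite
  have hroot : Polynomial.aeval pb.gen (Polynomial.X ^ 2 - Polynomial.C (n : K)) = 0 := by
    simp [hs]
  have hroot' : Polynomial.aeval (-pb.gen) (Polynomial.X ^ 2 - Polynomial.C (n : K)) = 0 := by
    simp [hs]
  have hmin : minpoly K pb.gen = Polynomial.X ^ 2 - Polynomial.C (n : K) := by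
    symm
    apply minpoly.eq_of_irreducible_of_monic _ hroot
      (Polynomial.monic_X_pow_sub_C _ two_ne_zero)
    exact X_pow_sub_C_irreducible_of_prime Nat.prime_two hK
  have hroot'' : Polynomial.aeval (-pb.gen) (minpoly K pb.gen) = 0 := by rwa [hmin]
  let τ : Gal(L/K) := AlgEquiv.ofBijective (pb.lift (-pb.gen) hroot'')
    (Algebra.IsAlgebraic.algHom_bijective _)
  have hτ : τ pb.gen = -pb.gen := pb.lift_gen _ hroot''
  have hg : ∀ g : Gal(L/K), g = 1 ∨ g = τ := by
    intro g
    have h1 : g pb.gen = pb.gen ∨ g pb.gen = -pb.gen := by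
      apply sq_eq_sq_iff_eq_or_eq_neg.mp
      rw [← map_pow, hs, map_natCast]
    refine h1.imp (fun h => ?_) (fun h => ?_)
    · exact AlgEquiv.coe_toAlgHom_injective (pb.algHom_ext (by simpa using h))
    · exact AlgEquiv.coe_toAlgHom_injective (pb.algHom_ext (by simpa [hτ] using h))
  refine ⟨?_, τ, hτ, hg⟩
  have hτ1 : τ ≠ 1 := by
    intro h
    have := charZero_of_injective_algebraMap (algebraMap K L).injective
    rw [h] at hτ
    have h2 : pb.gen = 0 := self_eq_neg.mp hτ
    rw [h2] at hs
    apply hK 0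
    apply (algebraMap K L).injective
    simpa using hs
  apply IsGalois.of_card_aut_eq_finrank
  rw [pb.finrank, ← pb.natDegree_minpoly, hmin, Polynomial.natDegree_X_pow_sub_C]
  rw [Nat.card_eq_two_iff]
  exact ⟨1, τ, hτ1.symm, Set.eq_univ_of_forall fun g => by simpa using hg g⟩

theorem even_classNumber_of_root {K : Type} [Field K] [NumberField K] {l n : ℕ} {U V : ℤ}
    (hl : l.Prime) (hl4 : l % 4 = 1) (hn0 : 0 < n) (hn : Squarefree n) (hnl : n.Coprime l)
    (hn1 : n ≠ 1) (hUV : U ^ 2 + 1 = l * V ^ 2) (hV : 0 < V) (hV4 : V % 4 = 1)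
    (hU4 : U % 4 = 0) (μ : K) (hgen : ∀ F : Subfield K, μ ∈ F → F = ⊤)
    (hμ : μ ^ 4 - 2 * n * V * l * μ ^ 2 + n ^ 2 * l = 0) : ¬ Odd (classNumber K) := by
  obtain ⟨-, hgal, -, r, σ, hr, hμr, -, hσr, hσ, -⟩ :=
    cyclic_quartic_of_root hl hnl hn0 hUV μ hgen hμ
  have hKreal := isTotallyReal_of_root hUV hV μ r hgen hr hμr
  have hnK := not_exists_sq_eq_of_squarefree hl hn hnl hn1 hr hσr hσ
  obtain ⟨s, hs⟩ := IsAlgClosed.exists_pow_nat_eq (n : AlgebraicClosure K) two_pos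
  have hsint : IsIntegral K s := (AlgebraicClosure.isAlgebraic K).isAlgebraic s |>.isIntegral
  let L := IntermediateField.adjoin K {s}
  have : FiniteDimensional K L := IntermediateField.adjoin.finiteDimensional hsint
  have : NumberField L := NumberField.of_module_finite K L
  let pb : PowerBasis K L := IntermediateField.adjoin.powerBasis hsint
  have hpb : pb.gen ^ 2 = n := by
    apply Subtype.ext
    simpa [pb] using hs
  clear_value pb
  have := pb.isTotallyReal_of_gen_sq_eq hpb
  obtain ⟨hLgal, τ, hτ, hg⟩ := pb.exists_neg_gen hpb hnK
  set t := pb.gen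
  have hnL : (n : L) ≠ 0 := by exact_mod_cast hn0.ne'
  have ht0 : t ≠ 0 := by
    intro h
    apply hnL
    rw [← hpb, h, zero_pow two_ne_zero]
  have hτ1 : τ ≠ 1 := by
    intro h
    rw [h] at hτ
    exact ht0 (self_eq_neg.mp hτ)
  refine even_classNumber_of_unramified K L τ hτ1 hg fun P hP _ g hgP => ?_
  rcases hg g with h | rfl
  · exact h
  exfalso
  set ρ := algebraMap K L r
  have hρ : ρ ^ 2 = l := by rw [← map_pow, hr, map_natCast]
  obtain ⟨y, hy, hy2⟩ : ∃ y : L, g y = -y ∧ y ^ 2 = V * l + U * ρ := by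
    refine ⟨algebraMap K L μ / t, ?_, ?_⟩
    · rw [map_div₀, hτ, AlgEquiv.commutes, div_neg]
    · rw [div_pow, hpb, ← map_pow, hμr, div_eq_iff hnL]
      simp only [map_mul, map_add, map_natCast, map_intCast]
      ring
  have h_int {a : L} {m : ℕ} (ha : a ^ 2 = m) : IsIntegral ℤ a := by
    refine IsIntegral.of_pow (n := 2) two_pos ?_
    rw [ha]
    exact_mod_cast isIntegral_algebraMap (R := ℤ) (A := L) (x := (m : ℤ))
  obtain ⟨θ, hθ⟩ : ∃ θ : 𝓞 L, (θ : L) = (1 + y) / 2 :=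
    ⟨⟨_, isIntegral_half_one_add hρ hy2 hl4 hV4 hU4⟩, rfl⟩
  obtain ⟨T, hT⟩ : ∃ T : 𝓞 L, (T : L) = t := ⟨⟨t, h_int hpb⟩, rfl⟩
  obtain ⟨R, hR⟩ : ∃ R : 𝓞 L, (R : L) = ρ := ⟨⟨ρ, h_int hρ⟩, rfl⟩
  have hT2 : T ^ 2 = n := RingOfIntegers.ext (by simpa [hT] using hpb)
  have hR2 : R ^ 2 = l := RingOfIntegers.ext (by simpa [hR] using hρ)
  have hθ2 : (2 * θ - 1) ^ 2 = V * l + U * R := by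
    apply RingOfIntegers.ext
    simp only [map_mul, map_sub, map_add, map_pow, map_one, map_ofNat, map_intCast, map_natCast,
      hθ, hR]
    rw [← hy2]
    ring
  have hUVO : (U : 𝓞 L) ^ 2 + 1 = l * (V : 𝓞 L) ^ 2 := by
    exact_mod_cast congrArg (Int.cast : ℤ → 𝓞 L) hUV
  have hYP : 2 * θ - 1 ∈ P := by
    rw [← neg_mem_iff]
    convert hgP θ using 1
    apply RingOfIntegers.ext
    simp only [map_neg, map_mul, map_sub, map_one, map_ofNat, hθ]
    change _ = g (θ : L) - _
    rw [hθ, map_div₀, map_add, hy, map_one, map_ofNat]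
    ring
  have hTP : 2 * T ∈ P := by
    rw [← neg_mem_iff]
    convert hgP T using 1
    apply RingOfIntegers.ext
    simp only [map_neg, map_mul, map_sub, map_ofNat, hT]
    change _ = g (T : L) - _
    rw [hT, hτ]
    ring
  have hlP : (l : 𝓞 L) ∈ P := by
    have h1 := P.mul_mem_left (R * (V * R - U) * (2 * θ - 1)) hYP
    convert h1 using 1
    linear_combination (-R * (V * R - U)) * hθ2 +
      (U ^ 2 - U * V * R - V ^ 2 * l) * hR2 + l * hUVO
  have hnP : ((4 * n : ℕ) : 𝓞 L) ∈ P := by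
    have h1 := P.mul_mem_left (2 * T) hTP
    convert h1 using 1
    push_cast
    linear_combination -4 * hT2
  have hcop : (4 * n).Coprime l := by
    refine Nat.Coprime.mul_left ?_ hnl
    rw [show 4 = 2 ^ 2 by rfl]
    apply Nat.Coprime.pow_left
    rw [Nat.coprime_two_left, Nat.odd_iff]
    omega
  obtain ⟨a, b, hab⟩ := Nat.isCoprime_iff_coprime.mpr hcop
  apply hP.ne_top
  rw [Ideal.eq_top_iff_one]
  have h1 : (a : 𝓞 L) * ((4 * n : ℕ) : 𝓞 L) + b * (l : 𝓞 L) = 1 := by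
    exact_mod_cast congrArg (Int.cast : ℤ → 𝓞 L) hab
  rw [← h1]
  exact add_mem (P.mul_mem_left _ hnP) (P.mul_mem_left _ hlP)

end

/-- `l ≡ 1 (mod 8)` prime, `n` a squarefree positive integer coprime
to `l`, `𝕂 = ℚ(√(n·ε₀·√l))`.  The class number of `𝕂` is odd iff `n = 1`. -/
theorem stmt_12 (l : ℕ) (hl : l.Prime) (hl8 : l % 8 = 1)
    (ε₀ : ℝ) (hε : IsFundamentalUnit l ε₀)
    (hεnorm : ∃ u v : ℚ, ε₀ = (u : ℝ) + (v : ℝ) * Real.sqrt (l : ℝ) ∧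
      (u : ℝ) ^ 2 - (v : ℝ) ^ 2 * (l : ℝ) = -1)
    (n : ℕ) (hn0 : 0 < n) (hnsq : Squarefree n) (hnl : n.Coprime l)
    (K : IntermediateField ℚ ℝ)
    (hK : K = IntermediateField.adjoin ℚ
      ({Real.sqrt ((n : ℝ) * ε₀ * Real.sqrt (l : ℝ))} : Set ℝ))
    [NumberField K] :
    Odd (NumberField.classNumber K) ↔ n = 1 := by
  obtain ⟨u, v, huv, hnorm⟩ := hεnorm
  obtain ⟨h1, -, h_int, h_int', -⟩ := hε
  obtain ⟨U, V, hUVε, hUV, hV, hV4, hU4⟩ :=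
    exists_int_of_isIntegral_unit hl hl8 h1 h_int h_int' huv (by exact_mod_cast hnorm)
  subst hK
  set m := Real.sqrt ((n : ℝ) * ε₀ * Real.sqrt (l : ℝ)) with hm
  have hsl : √(l : ℝ) ^ 2 = l := Real.sq_sqrt (Nat.cast_nonneg l)
  have hm2 : m ^ 2 = n * (V * l + U * √(l : ℝ)) := by
    rw [hm, Real.sq_sqrt (by positivity), hUVε]
    linear_combination (n * V : ℝ) * hsl
  have hUVR : (U : ℝ) ^ 2 + 1 = l * (V : ℝ) ^ 2 := by exact_mod_cast congrArg (Int.cast : ℤ → ℝ) hUV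
  have hm4 : m ^ 4 - 2 * n * V * l * m ^ 2 + n ^ 2 * l = 0 := by
    linear_combination (m ^ 2 + n * (V * l + U * √(l : ℝ)) - 2 * n * V * l : ℝ) * hm2 +
      (n ^ 2 * U ^ 2 : ℝ) * hsl + (n ^ 2 * l : ℝ) * hUVR
  obtain ⟨μ, hμm⟩ : ∃ μ : IntermediateField.adjoin ℚ ({m} : Set ℝ), (μ : ℝ) = m :=
    ⟨⟨m, IntermediateField.mem_adjoin_simple_self ℚ m⟩, rfl⟩
  have hμ : μ ^ 4 - 2 * n * V * l * μ ^ 2 + n ^ 2 * l = 0 := by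
    apply Subtype.ext
    push_cast
    rw [hμm]
    exact hm4
  have hgen : ∀ F : Subfield (IntermediateField.adjoin ℚ ({m} : Set ℝ)), μ ∈ F → F = ⊤ := by
    intro F hF
    rw [eq_top_iff]
    rintro ⟨x, hx⟩ -
    induction hx using IntermediateField.adjoin_induction with
    | mem x hx =>
      obtain rfl : x = m := hx
      convert hF
      exact hμm.symm
    | algebraMap q => exact SubfieldClass.ratCast_mem F q
    | add x y hx hy h h' => exact F.add_mem h h'
    | inv x hx h => exact F.inv_mem h
    | mul x y hx hy h h' => exact F.mul_mem h h'
  constructor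
  · intro hodd
    by_contra hn1
    exact even_classNumber_of_root hl (by omega) hn0 hnsq hnl hn1 hUV hV hV4 hU4 μ hgen hμ hodd
  · rintro rfl
    exact odd_classNumber_of_root hl (by omega) hUV hV hV4 hU4 μ hgen
      (by simpa using hμ)
end

section
/- The class number of 𝕂 = ℚ(√(n·ε₀·√2)) is odd if and only if either n = 1 or n is a prime congruent to 3 (mod 4). -/
namespace SqrtTwo

theorem exists_round (a m : ℤ) (hm : m ≠ 0) : ∃ q : ℤ, |2 * (a - m * q)| ≤ |m| := by
  refine ⟨round ((a : ℚ) / m), ?_⟩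
  have h := abs_sub_round ((a : ℚ) / m)
  have hm' : (m : ℚ) ≠ 0 := by exact_mod_cast hm
  have : (2 * ((a : ℚ) - m * round ((a : ℚ) / m))) =
      2 * m * ((a : ℚ) / m - round ((a : ℚ) / m)) := by
    field_simp
  have h2 : |(2 * ((a : ℚ) - m * round ((a : ℚ) / m)))| ≤ |(m : ℚ)| := by
    rw [this, abs_mul, abs_mul, abs_two]
    nlinarith [abs_nonneg (m : ℚ)]
  exact_mod_cast h2

theorem norm_eq_zero_iff_of_abs_eq_two {d : ℤ} (hd : |d| = 2) (a : ℤ√d) : a.norm = 0 ↔ a = 0 := by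
  refine Zsqrtd.norm_eq_zero (fun n hn => ?_) a
  rcases (abs_eq (by norm_num)).1 hd with rfl | rfl
  · have h1 : n < 2 := by nlinarith
    have h2 : -2 < n := by nlinarith
    interval_cases n <;> omega
  · nlinarith

theorem exists_quotient {d : ℤ} (hd : |d| = 2) (x y : ℤ√d) (hy : y ≠ 0) :
    ∃ q : ℤ√d, (x - y * q).norm.natAbs < y.norm.natAbs := by
  have hm : y.norm ≠ 0 := fun h => hy ((norm_eq_zero_iff_of_abs_eq_two hd y).1 h)
  obtain ⟨q₁, h₁⟩ := exists_round (x * star y).re y.norm hm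
  obtain ⟨q₂, h₂⟩ := exists_round (x * star y).im y.norm hm
  refine ⟨⟨q₁, q₂⟩, ?_⟩
  set e := (x * star y).re - y.norm * q₁
  set f := (x * star y).im - y.norm * q₂
  have key : (x - y * ⟨q₁, q₂⟩) * star y = ⟨e, f⟩ := by
    ext <;> simp [e, f, Zsqrtd.norm_def] <;> ring
  have hN := congrArg Zsqrtd.norm key
  rw [Zsqrtd.norm_mul, Zsqrtd.norm_conj] at hN
  simp only [Zsqrtd.norm_def ⟨e, f⟩] at hN
  rw [← sq_le_sq] at h₁ h₂
  have hm2 : 0 < y.norm ^ 2 := by positivity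
  zify
  by_contra! hle
  have h3 : y.norm ^ 2 ≤ |(x - y * ⟨q₁, q₂⟩).norm * y.norm| := by
    rw [abs_mul, ← sq_abs]
    nlinarith [abs_nonneg y.norm]
  rw [hN] at h3
  rcases (abs_eq (by norm_num)).1 hd with rfl | rfl
  · rcases abs_cases (e * e - 2 * f * f) with h | h <;> nlinarith [sq_nonneg e, sq_nonneg f]
  · rcases abs_cases (e * e - -2 * f * f) with h | h <;> nlinarith [sq_nonneg e, sq_nonneg f]

open Classical in
/-- The norm-Euclidean structure on `ℤ[√d]` for `d = 2` and `d = -2`. -/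
noncomputable abbrev euclideanDomain {d : ℤ} (hd : |d| = 2) : EuclideanDomain (ℤ√d) :=
  { Zsqrtd.commRing, Zsqrtd.nontrivial with
    quotient := fun x y => if h : y = 0 then 0 else (exists_quotient hd x y h).choose
    quotient_zero := fun x => by simp
    remainder := fun x y => x - y * if h : y = 0 then 0 else (exists_quotient hd x y h).choose
    quotient_mul_add_remainder_eq := fun x y => by ring
    r := (measure (Int.natAbs ∘ Zsqrtd.norm)).1
    r_wellFounded := (measure (Int.natAbs ∘ Zsqrtd.norm)).2
    remainder_lt := fun x y hy => by
      simp only [dif_neg hy]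
      exact (exists_quotient hd x y hy).choose_spec
    mul_left_not_lt := fun a b hb => by
      have h1 : a.norm.natAbs ≤ (a * b).norm.natAbs := by
        rw [Zsqrtd.norm_mul, Int.natAbs_mul]
        refine Nat.le_mul_of_pos_right _ ?_
        exact Int.natAbs_pos.2 (fun h => hb ((norm_eq_zero_iff_of_abs_eq_two hd b).1 h))
      exact not_lt_of_ge h1 }

noncomputable instance : EuclideanDomain (ℤ√2) := euclideanDomain (by norm_num)

/-- If `d = ±2` is a square modulo a prime `p`, then `±p` is a norm from `ℤ[√d]`. -/
theorem exists_norm_eq_of_isSquare {d : ℤ} (hd : |d| = 2) {p : ℕ} [hp : Fact p.Prime]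
    (h : IsSquare (d : ZMod p)) :
    ∃ a b : ℤ√d, (p : ℤ√d) = a * b ∧ a.norm.natAbs = p ∧ b.norm.natAbs = p := by
  let _ := euclideanDomain hd
  obtain ⟨c, hc⟩ := h
  have hdvd : (p : ℤ) ∣ c.val ^ 2 - d := by
    rw [← ZMod.intCast_zmod_eq_zero_iff_dvd]
    simp [hc, sq]
  have hnp : ¬ Prime (p : ℤ√d) := by
    intro hP
    have h1 : (p : ℤ√d) ∣ ⟨c.val, 1⟩ * ⟨c.val, -1⟩ := by
      have h2 : (⟨c.val, 1⟩ * ⟨c.val, -1⟩ : ℤ√d) = ((c.val ^ 2 - d : ℤ) : ℤ√d) := by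
        rw [Zsqrtd.intCast_val]
        ext <;> simp [-ZMod.natCast_val]; ring
      rw [h2]
      have h3 := (Zsqrtd.intCast_dvd_intCast (d := d) p (c.val ^ 2 - d)).2 hdvd
      rwa [Int.cast_natCast] at h3
    have hp1 := hp.out.one_lt
    have key : ∀ e : ℤ, |e| = 1 → ¬ (p : ℤ√d) ∣ ⟨c.val, e⟩ := by
      intro e he h3
      have h4 := ((Zsqrtd.intCast_dvd (p : ℤ) _).1 (by exact_mod_cast h3)).2
      have h5 := Int.le_of_dvd (by norm_num) (he ▸ (dvd_abs _ _).2 h4)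
      omega
    rcases hP.dvd_or_dvd h1 with h3 | h3
    · exact key 1 (by norm_num) h3
    · exact key (-1) (by norm_num) h3
  have hni : ¬ Irreducible (p : ℤ√d) := fun h => hnp h.prime
  have hnu : ¬ IsUnit (p : ℤ√d) := by
    rw [← Zsqrtd.norm_eq_one_iff, Zsqrtd.norm_natCast, Int.natAbs_mul]
    simpa using hp.out.ne_one
  simp only [irreducible_iff, hnu, not_false_eq_true, true_and, not_forall, not_or] at hni
  obtain ⟨a, b, hab, ha, hb⟩ := hni
  rw [← Zsqrtd.norm_eq_one_iff] at ha hb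
  have hN : a.norm.natAbs * b.norm.natAbs = p * p := by
    rw [← Int.natAbs_mul, ← Zsqrtd.norm_mul, ← hab, Zsqrtd.norm_natCast, Int.natAbs_mul]
    simp
  have := (Nat.Prime.mul_eq_prime_sq_iff hp.out ha hb).1 (by rw [hN, sq])
  exact ⟨a, b, hab, this⟩

theorem isUnit_iff (a : ℤ√2) : IsUnit a ↔ a.norm = 1 ∨ a.norm = -1 := by
  rw [Zsqrtd.isUnit_iff_norm_isUnit, Int.isUnit_iff]

/-- The fundamental unit `1 + √2`. -/
def eps : ℤ√2 := ⟨1, 1⟩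

/-- The element `√2`. -/
def rt : ℤ√2 := ⟨0, 1⟩

theorem rt_sq : rt ^ 2 = 2 := by ext <;> simp [rt, sq]

theorem norm_eps : eps.norm = -1 := by simp [eps, Zsqrtd.norm_def]

theorem norm_rt : rt.norm = -2 := by simp [rt, Zsqrtd.norm_def]

theorem isUnit_eps : IsUnit eps := (isUnit_iff _).2 (Or.inr norm_eps)

theorem neg_one_not_sq {x y : ℤ√2} (h : x ^ 2 = -y ^ 2) : y = 0 := by
  have h1 := congrArg Zsqrtd.re h
  simp [sq] at h1
  have : y.re = 0 := by nlinarith [sq_nonneg x.re, sq_nonneg x.im, sq_nonneg y.re, sq_nonneg y.im]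
  have : y.im = 0 := by nlinarith [sq_nonneg x.re, sq_nonneg x.im, sq_nonneg y.re, sq_nonneg y.im]
  ext <;> simpa

theorem isFundamental :
    Pell.IsFundamental (Pell.Solution₁.mk 3 2 (by norm_num) : Pell.Solution₁ 2) := by
  refine ⟨by simp, by simp, fun {a} ha => ?_⟩
  simp only [Pell.Solution₁.x_mk]
  have h := a.prop
  by_contra! hlt
  have hx : a.x = 2 := by omega
  rw [hx] at h
  have : 2 * (a.y ^ 2) = 3 := by linarith
  omega

theorem eq_sq_of_norm_one {u : ℤ√2} (hu : u.norm = 1) :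
    ∃ w : ℤ√2, IsUnit w ∧ (u = w ^ 2 ∨ u = -w ^ 2) := by
  let a : Pell.Solution₁ 2 := Pell.Solution₁.mk u.re u.im (by rw [Zsqrtd.norm_def] at hu; linarith)
  have hau : (a : ℤ√2) = u := by ext <;> simp [a]
  have h3 : ((Pell.Solution₁.mk 3 2 (by norm_num) : Pell.Solution₁ 2) : ℤ√2) = eps ^ 2 := by
    ext <;> simp [eps, sq]
  obtain ⟨e, he⟩ := isUnit_eps
  have key : ∀ n : ℤ, (((Pell.Solution₁.mk 3 2 (by norm_num) : Pell.Solution₁ 2) ^ n : Pell.Solution₁ 2) : ℤ√2)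
      = ((e ^ n : (ℤ√2)ˣ) : ℤ√2) ^ 2 := by
    intro n
    let f : Pell.Solution₁ 2 →* (ℤ√2)ˣ := (Unitary.toUnits : unitary (ℤ√2) →* (ℤ√2)ˣ)
    have : ∀ (b : Pell.Solution₁ 2), (b : ℤ√2) = ((f b : (ℤ√2)ˣ) : ℤ√2) := fun b => rfl
    have hf : f (Pell.Solution₁.mk 3 2 (by norm_num)) = e ^ 2 := by
      ext1
      rw [← this, h3, ← he, Units.val_pow_eq_pow_val]
    rw [this, map_zpow, hf, ← Units.val_pow_eq_pow_val]
    congr 1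
    rw [← zpow_natCast, ← zpow_natCast, ← zpow_mul, ← zpow_mul, mul_comm]
  obtain ⟨n, hn⟩ := isFundamental.eq_zpow_or_neg_zpow a
  refine ⟨((e ^ n : (ℤ√2)ˣ) : ℤ√2), Units.isUnit _, ?_⟩
  rw [← hau, ← key n]
  rcases hn with hn | hn
  · left; rw [hn]
  · right; rw [hn]; rfl

theorem unit_cases {u : ℤ√2} (hu : IsUnit u) : ∃ w : ℤ√2, IsUnit w ∧
    (u = w ^ 2 ∨ u = -1 * w ^ 2 ∨ u = eps * w ^ 2 ∨ u = -eps * w ^ 2) := by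
  rcases (isUnit_iff u).1 hu with h | h
  · obtain ⟨w, hw, h | h⟩ := eq_sq_of_norm_one h
    · exact ⟨w, hw, by simp [h]⟩
    · exact ⟨w, hw, by simp [h]⟩
  · obtain ⟨e, he⟩ := isUnit_eps
    have hn : (u * eps).norm = 1 := by rw [Zsqrtd.norm_mul, h, norm_eps]; norm_num
    obtain ⟨w, hw, h⟩ := eq_sq_of_norm_one hn
    have h2 : ∀ x, u * eps = x → u = eps * x * ((e⁻¹ : (ℤ√2)ˣ) : ℤ√2) ^ 2 := by
      intro x hx
      rw [← hx, ← he]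
      have := e.mul_inv
      linear_combination (-u * (1 + (e : ℤ√2) * ((e⁻¹ : (ℤ√2)ˣ) : ℤ√2))) * this
    refine ⟨w * ((e⁻¹ : (ℤ√2)ˣ) : ℤ√2), hw.mul (Units.isUnit _), ?_⟩
    rcases h with h | h
    · right; right; left; rw [h2 _ h]; ring
    · right; right; right; rw [h2 _ h]; ring

theorem exists_sq_add_two_mul_sq {p : ℕ} [Fact p.Prime] (h : p % 8 = 3) :
    ∃ x y : ℤ, (p : ℤ) = x ^ 2 + 2 * y ^ 2 := by
  have hsq : IsSquare (((-2 : ℤ)) : ZMod p) := by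
    have := (ZMod.exists_sq_eq_neg_two_iff (p := p) (by omega)).2 (Or.inr h)
    simpa using this
  obtain ⟨a, b, -, ha, -⟩ := exists_norm_eq_of_isSquare (d := -2) (by norm_num) hsq
  have h1 := Zsqrtd.norm_nonneg (by norm_num) a
  refine ⟨a.re, a.im, ?_⟩
  have h2 : a.norm = p := by omega
  rw [← h2, Zsqrtd.norm_def]
  ring

theorem dvd_of_dvd_norm {p : ℕ} [hp : Fact p.Prime] (h : p % 8 = 3 ∨ p % 8 = 5) {z : ℤ√2}
    (hz : (p : ℤ) ∣ z.norm) : (p : ℤ√2) ∣ z := by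
  have hns : ¬ IsSquare (2 : ZMod p) := by
    rw [ZMod.exists_sq_eq_two_iff (by rintro rfl; omega)]
    omega
  have h0 : ((z.norm : ℤ) : ZMod p) = 0 := (ZMod.intCast_zmod_eq_zero_iff_dvd _ _).2 hz
  have h1 : (z.re : ZMod p) * z.re = 2 * (z.im * z.im) := by
    rw [Zsqrtd.norm_def] at h0
    push_cast at h0
    linear_combination h0
  have him : (z.im : ZMod p) = 0 := by
    by_contra hne
    refine hns ⟨z.re / z.im, ?_⟩
    field_simp
    linear_combination -h1
  have hre : (z.re : ZMod p) = 0 := by simpa [him] using h1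
  rw [ZMod.intCast_zmod_eq_zero_iff_dvd] at him hre
  exact_mod_cast (Zsqrtd.intCast_dvd (p : ℤ) z).2 ⟨hre, him⟩

theorem prime_of_inert {p : ℕ} [hp : Fact p.Prime] (h : p % 8 = 3 ∨ p % 8 = 5) :
    Prime (p : ℤ√2) := by
  refine ⟨by exact_mod_cast hp.out.ne_zero, ?_, fun a b hab => ?_⟩
  · rw [← Zsqrtd.norm_eq_one_iff, Zsqrtd.norm_natCast, Int.natAbs_mul]
    simpa using hp.out.ne_one
  · obtain ⟨c, hc⟩ := hab
    have h1 : (p : ℤ) ∣ a.norm * b.norm := by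
      rw [← Zsqrtd.norm_mul, hc, Zsqrtd.norm_mul, Zsqrtd.norm_natCast]
      exact ⟨p * c.norm, by ring⟩
    exact (Nat.prime_iff_prime_int.1 hp.out).dvd_or_dvd h1 |>.imp
      (dvd_of_dvd_norm h) (dvd_of_dvd_norm h)

theorem prime_of_norm {p : ℕ} [hp : Fact p.Prime] {a : ℤ√2} (ha : a.norm.natAbs = p) : Prime a := by
  rw [← irreducible_iff_prime]
  refine ⟨fun h => hp.out.ne_one ?_, fun x y hxy => ?_⟩
  · rw [← ha]; exact Zsqrtd.norm_eq_one_iff.2 h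
  · rw [← Zsqrtd.norm_eq_one_iff, ← Zsqrtd.norm_eq_one_iff]
    rw [hxy, Zsqrtd.norm_mul, Int.natAbs_mul] at ha
    have := hp.out
    rw [← ha, Nat.prime_mul_iff] at this
    tauto

/-- The factorization of a split prime in `ℤ[√2]`. -/
theorem exists_split {p : ℕ} [hp : Fact p.Prime] (h : p % 8 = 1 ∨ p % 8 = 7) :
    ∃ a b : ℤ√2, (p : ℤ√2) = a * b ∧ a.norm.natAbs = p ∧ b.norm.natAbs = p ∧ IsCoprime a b := by
  have hsq : IsSquare (((2 : ℤ)) : ZMod p) := by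
    have := (ZMod.exists_sq_eq_two_iff (p := p) (by omega)).2 h
    simpa using this
  obtain ⟨a, b, hab, ha, hb⟩ := exists_norm_eq_of_isSquare (d := 2) (by norm_num) hsq
  refine ⟨a, b, hab, ha, hb, ?_⟩
  have hpI := Nat.prime_iff_prime_int.1 hp.out
  have hp0 : (p : ℤ) ≠ 0 := hpI.ne_zero
  have hre : ¬ (p : ℤ) ∣ 2 * a.re := by
    intro hd
    have hd1 : (p : ℤ) ∣ a.re := by
      refine (hpI.dvd_or_dvd hd).resolve_left fun h2 => ?_
      have := Int.le_of_dvd (by norm_num) h2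
      have := hp.out.two_le
      omega
    have hN : (p : ℤ) ∣ a.norm := by rw [← ha]; simp
    have hd2 : (p : ℤ) ∣ 2 * (a.im * a.im) := by
      have : 2 * (a.im * a.im) = a.re * a.re - a.norm := by rw [Zsqrtd.norm_def]; ring
      rw [this]
      exact dvd_sub (hd1.mul_right _) hN
    have hd3 : (p : ℤ) ∣ a.im := by
      rcases hpI.dvd_or_dvd hd2 with h2 | h2
      · have := Int.le_of_dvd (by norm_num) h2
        have := hp.out.two_le
        omega
      · exact (hpI.dvd_or_dvd h2).elim id id
    have hd4 : (p : ℤ√2) ∣ a := by exact_mod_cast (Zsqrtd.intCast_dvd (p : ℤ) a).2 ⟨hd1, hd3⟩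
    have hu : IsUnit b := by
      obtain ⟨c, hc⟩ := hd4
      refine IsUnit.of_mul_eq_one c ?_
      have h0 : (p : ℤ√2) ≠ 0 := by exact_mod_cast hp.out.ne_zero
      refine mul_left_cancel₀ h0 ?_
      calc (p : ℤ√2) * (b * c) = (p * c) * b := by ring
        _ = a * b := by rw [← hc]
        _ = p * 1 := by rw [← hab, mul_one]
    exact hp.out.ne_one (hb ▸ Zsqrtd.norm_eq_one_iff.2 hu)
  have hcop : IsCoprime (p : ℤ) (2 * a.re) := (Prime.coprime_iff_not_dvd hpI).2 hre
  obtain ⟨u, v, huv⟩ := hcop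
  have h1 : (u : ℤ√2) * p + v * (a + star a) = 1 := by
    have : (a + star a) = ((2 * a.re : ℤ) : ℤ√2) := by ext <;> simp; ring
    rw [this]
    exact_mod_cast congrArg (Int.cast : ℤ → ℤ√2) huv
  have hst : star a = b ∨ star a = -b := by
    have ha0 : a ≠ 0 := by rintro rfl; simp at ha; exact hp.out.ne_zero ha.symm
    have h2 : a * star a = (a.norm : ℤ√2) := (Zsqrtd.norm_eq_mul_conj a).symm
    rcases Int.natAbs_eq a.norm with h3 | h3
    · left
      refine mul_left_cancel₀ ha0 ?_
      rw [h2, h3, ha, ← hab]; simp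
    · right
      refine mul_left_cancel₀ ha0 ?_
      rw [h2, h3, ha, mul_neg, ← hab]; simp
  rcases hst with hst | hst <;> rw [hst, hab] at h1
  · exact ⟨u * b + v, v, by linear_combination h1⟩
  · exact ⟨u * b + v, -v, by linear_combination h1⟩

theorem squarefree_prime_cast {p : ℕ} (hp : p.Prime) (h2 : p ≠ 2) : Squarefree (p : ℤ√2) := by
  have := Fact.mk hp
  have h8 : p % 8 = 1 ∨ p % 8 = 7 ∨ p % 8 = 3 ∨ p % 8 = 5 := by
    have := hp.eq_two_or_odd
    omega
  rcases h8 with h | h | h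
  · obtain ⟨a, b, hab, ha, hb, hc⟩ := exists_split (Or.inl h)
    rw [hab, squarefree_mul_iff]
    exact ⟨hc.isRelPrime, (prime_of_norm ha).irreducible.squarefree,
      (prime_of_norm hb).irreducible.squarefree⟩
  · obtain ⟨a, b, hab, ha, hb, hc⟩ := exists_split (Or.inr h)
    rw [hab, squarefree_mul_iff]
    exact ⟨hc.isRelPrime, (prime_of_norm ha).irreducible.squarefree,
      (prime_of_norm hb).irreducible.squarefree⟩
  · exact (prime_of_inert h).irreducible.squarefree

theorem isCoprime_natCast {a b : ℕ} (h : a.Coprime b) : IsCoprime (a : ℤ√2) b := by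
  have := (Nat.isCoprime_iff_coprime.2 h).map (Int.castRingHom (ℤ√2))
  simpa using this

theorem squarefree_natCast {n : ℕ} (hodd : Odd n) (hn : Squarefree n) : Squarefree (n : ℤ√2) := by
  rw [← Nat.prod_primeFactors_of_squarefree hn]
  push_cast
  refine Finset.squarefree_prod_of_pairwise_isCoprime (fun p hp q hq hpq => ?_) fun p hp => ?_
  · refine (isCoprime_natCast ?_).isRelPrime
    exact (Nat.coprime_primes (Nat.prime_of_mem_primeFactors hp)
      (Nat.prime_of_mem_primeFactors hq)).2 hpq
  · refine squarefree_prime_cast (Nat.prime_of_mem_primeFactors hp) ?_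
    rintro rfl
    exact absurd (Nat.dvd_of_mem_primeFactors hp) (by rw [← even_iff_two_dvd]; simpa using hodd)

theorem prime_rt : Prime rt := by
  have := Fact.mk Nat.prime_two
  exact prime_of_norm (p := 2) (by rw [norm_rt]; rfl)

theorem isCoprime_rt_natCast {n : ℕ} (hodd : Odd n) : IsCoprime rt (n : ℤ√2) := by
  have h : IsCoprime ((2 : ℕ) : ℤ√2) n := isCoprime_natCast (Nat.coprime_two_left.2 hodd)
  have h2 : ((2 : ℕ) : ℤ√2) = rt * rt := by rw [← sq, rt_sq]; rfl
  rw [h2] at h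
  exact h.of_mul_left_left

theorem exists_squarefree_mul_sq {g : ℤ√2} (hg : g ≠ 0) :
    ∃ f z : ℤ√2, Squarefree f ∧ g = f * z ^ 2 := by
  induction g using UniqueFactorizationMonoid.induction_on_prime with
  | h₁ => exact absurd rfl hg
  | h₂ x hx => exact ⟨x, 1, hx.squarefree, by simp⟩
  | h₃ a p ha hp ih =>
    obtain ⟨f, z, hf, rfl⟩ := ih ha
    by_cases hpf : p ∣ f
    · obtain ⟨f', rfl⟩ := hpf
      exact ⟨f', p * z, hf.squarefree_of_dvd (Dvd.intro_left _ rfl), by ring⟩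
    · refine ⟨p * f, z, ?_, by ring⟩
      rw [squarefree_mul_iff]
      exact ⟨(hp.irreducible.coprime_iff_not_dvd.2 hpf).isRelPrime, hp.irreducible.squarefree, hf⟩

end SqrtTwo

open SqrtTwo in
/-- A quadratic extension `O` of `ℤ[√2]` containing a square root `θ` of `n√2(1 + √2)`, with its
conjugation `σ`, whose fixed ring is `ℤ[√2]`. -/
structure QuarticData (O : Type*) [CommRing O] (n : ℕ) where
  /-- the embedding of the base ring -/
  ι : ℤ√2 →+* O
  ι_injective : Function.Injective ι
  /-- the conjugation over the base ring -/
  σ : O →+* O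
  σ_σ : ∀ x, σ (σ x) = x
  σ_ι : ∀ r, σ (ι r) = ι r
  exists_of_fixed : ∀ x, σ x = x → ∃ r, ι r = x
  /-- the generator -/
  θ : O
  θ_sq : θ ^ 2 = ι (n * rt * eps)
  σ_θ : σ θ = -θ

namespace QuarticData

open SqrtTwo

variable {O : Type*} [CommRing O] {n : ℕ} (S : QuarticData O n)

theorem exists_norm (x : O) : ∃ r, S.ι r = x * S.σ x :=
  S.exists_of_fixed _ (by rw [map_mul, S.σ_σ, mul_comm])

/-- The relative norm to `ℤ[√2]`. -/
noncomputable def N (x : O) : ℤ√2 := (S.exists_norm x).choose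

theorem ι_N (x : O) : S.ι (S.N x) = x * S.σ x := (S.exists_norm x).choose_spec

theorem exists_trace (x : O) : ∃ r, S.ι r = x + S.σ x :=
  S.exists_of_fixed _ (by rw [map_add, S.σ_σ, add_comm])

theorem N_mul (x y : O) : S.N (x * y) = S.N x * S.N y :=
  S.ι_injective (by simp only [map_mul, ι_N]; ring)

theorem N_ι (r : ℤ√2) : S.N (S.ι r) = r ^ 2 :=
  S.ι_injective (by simp only [ι_N, S.σ_ι, map_pow]; ring)

theorem N_one : S.N 1 = 1 := S.ι_injective (by simp [ι_N])

theorem ι_ne_zero {r : ℤ√2} : S.ι r ≠ 0 ↔ r ≠ 0 := by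
  rw [Ne, map_eq_zero_iff _ S.ι_injective]

theorem σ_ne_zero {x : O} (hx : x ≠ 0) : S.σ x ≠ 0 := fun h => hx (by rw [← S.σ_σ x, h, map_zero])

theorem isUnit_N {x : O} (hx : IsUnit x) : IsUnit (S.N x) := by
  obtain ⟨u, rfl⟩ := hx
  refine IsUnit.of_mul_eq_one (S.N ((u⁻¹ : Oˣ) : O)) ?_
  rw [← N_mul, Units.mul_inv, N_one]

theorem θ_ne_zero [IsDomain O] (hn : n ≠ 0) : S.θ ≠ 0 := by
  have h : S.ι (n * rt * eps) ≠ 0 :=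
    S.ι_ne_zero.2 (mul_ne_zero (mul_ne_zero (by exact_mod_cast hn) prime_rt.ne_zero)
      isUnit_eps.ne_zero)
  rw [← S.θ_sq] at h
  exact fun h' => h (by rw [h']; ring)

theorem N_ne_zero [IsDomain O] {x : O} (hx : x ≠ 0) : S.N x ≠ 0 :=
  S.ι_ne_zero.1 (by rw [ι_N]; exact mul_ne_zero hx (S.σ_ne_zero hx))

theorem ι_dvd [IsDomain O] {a b : ℤ√2} : S.ι a ∣ S.ι b ↔ a ∣ b := by
  refine ⟨fun ⟨c, hc⟩ => ?_, map_dvd _⟩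
  by_cases ha : a = 0
  · subst ha
    rw [map_zero, zero_mul] at hc
    rw [zero_dvd_iff, ← map_eq_zero_iff _ S.ι_injective, hc]
  · obtain ⟨r, rfl⟩ := S.exists_of_fixed c (by
      have h := congrArg S.σ hc
      rw [map_mul, S.σ_ι, S.σ_ι, hc] at h
      exact (mul_left_cancel₀ (S.ι_ne_zero.2 ha) h).symm)
    rw [← map_mul] at hc
    exact ⟨r, S.ι_injective hc⟩

theorem dvd_of_trace_norm [IsDomain O] [IsIntegrallyClosed O] {c : O} {g : ℤ√2}
    (h₁ : S.ι g ∣ c + S.σ c) (h₂ : S.ι g ^ 2 ∣ c * S.σ c) : S.ι g ∣ c := by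
  by_cases hg : g = 0
  · subst hg
    simp only [map_zero, ne_eq, OfNat.ofNat_ne_zero, not_false_eq_true, zero_pow, zero_dvd_iff] at *
    rcases mul_eq_zero.1 h₂ with h | h
    · exact h
    · simpa [h] using h₁
  obtain ⟨t, ht⟩ := h₁
  obtain ⟨m, hm⟩ := h₂
  have hg' : algebraMap O (FractionRing O) (S.ι g) ≠ 0 := by
    simpa using S.ι_ne_zero.2 hg
  have hintegral : IsIntegral O
      (algebraMap O (FractionRing O) c / algebraMap O (FractionRing O) (S.ι g)) := by
    refine ⟨Polynomial.X ^ 2 - Polynomial.C t * Polynomial.X + Polynomial.C m, by monicity!, ?_⟩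
    simp only [Polynomial.eval₂_add, Polynomial.eval₂_sub, Polynomial.eval₂_mul,
      Polynomial.eval₂_C, Polynomial.eval₂_X, Polynomial.eval₂_pow]
    field_simp
    have h : c ^ 2 - c * (S.ι g * t) + S.ι g ^ 2 * m = 0 := by
      rw [← ht, ← hm]; ring
    have h' := congrArg (algebraMap O (FractionRing O)) h
    simp only [map_add, map_sub, map_mul, map_pow, map_zero] at h'
    linear_combination h'
  obtain ⟨y, hy⟩ := IsIntegrallyClosed.isIntegral_iff.1 hintegral
  refine ⟨y, IsFractionRing.injective O (FractionRing O) ?_⟩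
  rw [map_mul, hy]
  field_simp

theorem mem_map_σ {I : Ideal O} {x : O} : x ∈ I.map S.σ ↔ S.σ x ∈ I := by
  constructor
  · intro h
    have : I.map S.σ ≤ I.comap S.σ := by
      rw [Ideal.map_le_iff_le_comap]
      intro y hy
      simpa [Ideal.mem_comap, S.σ_σ] using hy
    exact this h
  · intro h
    rw [← S.σ_σ x]
    exact Ideal.mem_map_of_mem _ h

theorem exists_mul_map_eq [IsDomain O] [IsIntegrallyClosed O] {I : Ideal O} (hI : I ≠ ⊥) :
    ∃ g : ℤ√2, g ≠ 0 ∧ I * I.map S.σ = Ideal.span {S.ι g} ∧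
      (∀ x D : ℤ√2, (∀ a ∈ I, x ∣ D * S.N a) → x ∣ D * g) := by
  obtain ⟨g, hg⟩ := IsPrincipalIdealRing.principal (Ideal.span (S.N '' I))
  change _ = Ideal.span {g} at hg
  have hdvd : ∀ a ∈ I, g ∣ S.N a := fun a ha => by
    rw [← Ideal.mem_span_singleton, ← hg]
    exact Ideal.subset_span ⟨a, ha, rfl⟩
  have hmem : g ∈ Ideal.span (S.N '' I) := by rw [hg]; exact Ideal.mem_span_singleton_self g
  refine ⟨g, ?_, le_antisymm ?_ ?_, fun x D hx => ?_⟩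
  · rintro rfl
    obtain ⟨a, ha, ha0⟩ := Submodule.exists_mem_ne_zero_of_ne_bot hI
    exact S.N_ne_zero ha0 (zero_dvd_iff.1 (hdvd a ha))
  · rw [Ideal.mul_le]
    intro a ha b' hb'
    obtain ⟨b, hb, rfl⟩ : ∃ b ∈ I, b' = S.σ b := ⟨S.σ b', S.mem_map_σ.1 hb', (S.σ_σ b').symm⟩
    rw [Ideal.mem_span_singleton]
    refine S.dvd_of_trace_norm ?_ ?_
    · have h : a * S.σ b + S.σ (a * S.σ b) = S.ι (S.N (a + b) - S.N a - S.N b) := by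
        simp only [map_sub, ι_N, map_add, map_mul, S.σ_σ]; ring
      rw [h, S.ι_dvd]
      exact dvd_sub (dvd_sub (hdvd _ (I.add_mem ha hb)) (hdvd _ ha)) (hdvd _ hb)
    · have h : a * S.σ b * S.σ (a * S.σ b) = S.ι (S.N a * S.N b) := by
        simp only [ι_N, map_mul, S.σ_σ]; ring
      rw [h, ← map_pow, S.ι_dvd, sq]
      exact mul_dvd_mul (hdvd _ ha) (hdvd _ hb)
  · rw [Ideal.span_singleton_le_iff_mem, ← Ideal.mem_comap]
    have : Ideal.span (S.N '' I) ≤ (I * I.map S.σ).comap S.ι := by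
      rw [Ideal.span_le]
      rintro _ ⟨a, ha, rfl⟩
      rw [SetLike.mem_coe, Ideal.mem_comap, ι_N]
      exact Ideal.mul_mem_mul ha (Ideal.mem_map_of_mem _ ha)
    exact this hmem
  · refine Submodule.span_induction (p := fun y _ => x ∣ D * y) ?_ (by simp) ?_ ?_ hmem
    · rintro _ ⟨a, ha, rfl⟩
      exact hx a ha
    · intro y z _ _ hy hz
      rw [mul_add]
      exact dvd_add hy hz
    · intro r y _ hy
      rw [smul_eq_mul, mul_left_comm]
      exact hy.mul_left r

theorem exists_of_N_eq_sq [IsDomain O] (hn : n ≠ 0) {c : O} {h : ℤ√2}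
    (hc : S.N c = h ^ 2) :
    ∃ t : O, t ≠ 0 ∧ c * S.σ t = S.ι h * t := by
  have hc' : c * S.σ c = S.ι h ^ 2 := by rw [← S.ι_N, hc, map_pow]
  by_cases h0 : S.ι h + c = 0
  · refine ⟨S.θ, S.θ_ne_zero hn, ?_⟩
    rw [S.σ_θ]
    linear_combination -S.θ * h0
  · refine ⟨S.ι h + c, h0, ?_⟩
    rw [map_add, S.σ_ι]
    linear_combination hc'

theorem ideal_eq_of_sq_eq [IsDedekindDomain O] {I J : Ideal O} (h : I ^ 2 = J ^ 2) : I = J := by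
  classical
  have key : ∀ {I J : Ideal O}, I ^ 2 = J ^ 2 → I ≤ J := fun {I J} h => by
    rw [← Ideal.dvd_iff_le]
    exact (UniqueFactorizationMonoid.pow_dvd_pow_iff_dvd two_ne_zero).1
      (Dvd.intro_left 1 (by rw [one_mul, h]))
  exact le_antisymm (key h) (key h.symm)

theorem exists_sq_eq_of_fixed {J : Ideal O} [IsDedekindDomain O]
    (hJ : J ≠ ⊥) (hσ : J.map S.σ = J) :
    ∃ δ z : ℤ√2, δ ∣ n ∧ z ≠ 0 ∧ (J ^ 2 = Ideal.span {S.ι (δ * z ^ 2)} ∨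
      (Ideal.span {S.θ} * J) ^ 2 = Ideal.span {S.ι (δ * z ^ 2)}) := by
  obtain ⟨g, hg0, hg, hmin⟩ := S.exists_mul_map_eq hJ
  rw [hσ, ← sq] at hg
  obtain ⟨f, z, hf, rfl⟩ := exists_squarefree_mul_sq hg0
  have hz : z ≠ 0 := by rintro rfl; simp at hg0
  have hf0 : f ≠ 0 := by rintro rfl; simp at hg0
  have hmem : ∀ a ∈ J, ∀ b ∈ J, S.ι (f * z ^ 2) ∣ a * b := fun a ha b hb => by
    rw [← Ideal.mem_span_singleton, ← hg, sq]; exact Ideal.mul_mem_mul ha hb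
  have hfd : f ∣ 4 * (n * rt * eps) := by
    have h1 : ∀ a ∈ J, f ^ 2 * z ^ 2 ∣ 4 * (n * rt * eps) * S.N a := by
      intro a ha
      have hσa : S.σ a ∈ J := S.mem_map_σ.1 (by rwa [hσ])
      obtain ⟨t, ht⟩ := S.exists_trace a
      have ht2 : f * z ^ 2 ∣ t ^ 2 := by
        rw [← S.ι_dvd, map_pow, ht]
        have : (a + S.σ a) ^ 2 = a * a + 2 * (a * S.σ a) + S.σ a * S.σ a := by ring
        rw [this]
        exact dvd_add (dvd_add (hmem _ ha _ ha) ((hmem _ ha _ hσa).mul_left _)) (hmem _ hσa _ hσa)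
      have hNa : f * z ^ 2 ∣ S.N a := by
        rw [← S.ι_dvd, ι_N]; exact hmem _ ha _ hσa
      have aux : ∀ x : ℤ√2, f * z ^ 2 ∣ x ^ 2 → f * z ∣ x := by
        intro x hx
        obtain ⟨y, rfl⟩ : z ∣ x :=
          (UniqueFactorizationMonoid.pow_dvd_pow_iff_dvd two_ne_zero).1 (dvd_of_mul_left_dvd hx)
        rw [mul_pow, mul_comm] at hx
        have h := (mul_dvd_mul_iff_left (pow_ne_zero 2 hz)).1 hx
        rw [hf.dvd_pow_iff_dvd two_ne_zero] at h
        rw [mul_comm]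
        exact mul_dvd_mul_left _ h
      obtain ⟨w, hw⟩ := S.exists_of_fixed ((a - S.σ a) * S.θ) (by
        rw [map_mul, map_sub, S.σ_σ, S.σ_θ]; ring)
      have hw2 : w ^ 2 = (t ^ 2 - 4 * S.N a) * (n * rt * eps) := by
        apply S.ι_injective
        rw [map_pow, hw, map_mul, ← S.θ_sq, map_sub, map_mul, ι_N, map_pow, ht, map_ofNat]
        ring
      have h2 : f * z ∣ w := aux w (by
        rw [hw2]
        exact (dvd_sub ht2 (hNa.mul_left _)).mul_right _)
      have h3 := pow_dvd_pow_of_dvd h2 2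
      have h4 := (pow_dvd_pow_of_dvd (aux t ht2) 2).mul_right (n * rt * eps)
      have h5 : 4 * (n * rt * eps) * S.N a = t ^ 2 * (n * rt * eps) - w ^ 2 := by
        rw [hw2]; ring
      rw [h5, ← mul_pow]
      exact dvd_sub h4 h3
    have h2 : f ^ 2 * z ^ 2 ∣ 4 * (n * rt * eps) * (f * z ^ 2) := hmin _ _ h1
    have h3 : f ^ 2 * z ^ 2 = f * (f * z ^ 2) := by ring
    rw [h3] at h2
    exact (mul_dvd_mul_iff_right hg0).1 h2
  have hfd' : f ∣ n * rt := by
    have h4 : (4 : ℤ√2) = rt ^ 4 := by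
      rw [show (4 : ℕ) = 2 * 2 from rfl, pow_mul, rt_sq]; norm_num
    have h5 : f ∣ (n * rt) ^ 5 := by
      have h6 : f ∣ eps * (n * rt ^ 5) := by
        rw [h4] at hfd; convert hfd using 1; ring
      have h7 := isUnit_eps.dvd_mul_left.1 h6
      rw [mul_pow]
      exact h7.trans (mul_dvd_mul_right (dvd_pow_self _ (by norm_num)) _)
    exact (hf.dvd_pow_iff_dvd (by norm_num)).1 h5
  by_cases hrt : rt ∣ f
  · obtain ⟨δ, rfl⟩ := hrt
    have h1 : δ ∣ n := by
      rw [mul_comm] at hfd'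
      exact (mul_dvd_mul_iff_right prime_rt.ne_zero).1 hfd'
    obtain ⟨δ', hδ'⟩ := h1
    have hδ0 : δ ≠ 0 := by rintro rfl; simp at hf0
    refine ⟨δ' * eps, rt * δ * z, ?_, mul_ne_zero (mul_ne_zero prime_rt.ne_zero hδ0) hz, Or.inr ?_⟩
    · rw [hδ', isUnit_eps.mul_right_dvd]; exact Dvd.intro_left _ rfl
    · rw [mul_pow, Ideal.span_singleton_pow, hg, Ideal.span_singleton_mul_span_singleton, S.θ_sq,
        ← map_mul, hδ']
      congr 3
      ring
  · refine ⟨f, z, ?_, hz, Or.inl hg⟩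
    have : IsCoprime f rt := ((Irreducible.coprime_iff_not_dvd prime_rt.irreducible).2 hrt).symm
    exact this.dvd_of_dvd_mul_right hfd'

theorem exists_ideal_sq [IsDomain O] {δ δ' : ℤ√2} (h : (n * rt * eps : ℤ√2) = δ * δ')
    (hc : IsCoprime δ δ') : ∃ J : Ideal O, J ^ 2 = Ideal.span {S.ι δ} := by
  refine ⟨Ideal.span {S.ι δ, S.θ}, ?_⟩
  have hθ : S.θ * S.θ = S.ι δ * S.ι δ' := by rw [← sq, S.θ_sq, h, map_mul]
  rw [sq, Ideal.span_pair_mul_span_pair]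
  apply le_antisymm
  · rw [Ideal.span_le]
    intro x hx
    simp only [Set.mem_insert_iff, Set.mem_singleton_iff] at hx
    rw [SetLike.mem_coe, Ideal.mem_span_singleton]
    rcases hx with rfl | rfl | rfl | rfl
    · exact Dvd.intro _ rfl
    · exact Dvd.intro _ rfl
    · exact Dvd.intro_left _ rfl
    · rw [hθ]; exact Dvd.intro _ rfl
  · rw [Ideal.span_singleton_le_iff_mem]
    obtain ⟨a, b, hab⟩ := hc
    have : S.ι δ = S.ι a * (S.ι δ * S.ι δ) + S.ι b * (S.θ * S.θ) := by
      rw [hθ]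
      simp only [← map_mul, ← map_add]
      congr 1
      linear_combination -δ * hab
    have h1 := Ideal.add_mem (Ideal.span {S.ι δ * S.ι δ, S.ι δ * S.θ, S.θ * S.ι δ, S.θ * S.θ})
      (Ideal.mul_mem_left _ (S.ι a) (Ideal.subset_span (a := S.ι δ * S.ι δ) (by simp)))
      (Ideal.mul_mem_left _ (S.ι b) (Ideal.subset_span (a := S.θ * S.θ) (by simp)))
    rwa [← this] at h1

end QuarticData

namespace SqrtTwo

theorem norm_modEq {p : ℤ} {a b : ℤ√2} (h : (p : ℤ√2) ∣ a - b) : p ∣ a.norm - b.norm := by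
  rw [Zsqrtd.intCast_dvd] at h
  obtain ⟨⟨c, hc⟩, ⟨e, he⟩⟩ := h
  rw [Zsqrtd.re_sub] at hc
  rw [Zsqrtd.im_sub] at he
  refine ⟨c * (a.re + b.re) - 2 * e * (a.im + b.im), ?_⟩
  rw [Zsqrtd.norm_def, Zsqrtd.norm_def]
  linear_combination (a.re + b.re) * hc - 2 * (a.im + b.im) * he

theorem not_rt_dvd {n : ℕ} (hodd : Odd n) {r : ℤ√2} (h : r ∣ n) : ¬ rt ∣ r := fun h' =>
  prime_rt.not_isUnit ((isCoprime_rt_natCast hodd).isUnit_of_dvd' dvd_rfl (h'.trans h))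

theorem not_natCast_dvd_rt {p : ℕ} (hp : p ≠ 1) : ¬ ((p : ℤ) : ℤ√2) ∣ rt := by
  rw [Zsqrtd.intCast_dvd]
  rintro ⟨-, h⟩
  have : (p : ℤ) ∣ 1 := h
  exact hp (by exact_mod_cast Int.eq_one_of_dvd_one (by positivity) this)

theorem eps_sq_add_one : eps ^ 2 + 1 = 2 * rt * eps := by rfl

theorem not_isUnit_natCast {p : ℕ} (hp : p ≠ 1) : ¬ IsUnit (p : ℤ√2) := by
  intro h
  have := (isUnit_iff_dvd_one.1 h).trans (one_dvd rt)
  exact not_natCast_dvd_rt hp (by exact_mod_cast this)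

theorem exists_sq_add_sq {n : ℕ} (h : ∀ p : ℕ, p.Prime → p ∣ n → p % 8 = 3) :
    ∃ x y : ℤ√2, (n : ℤ√2) = x ^ 2 + y ^ 2 := by
  induction n using Nat.recOnMul with
  | zero => exact ⟨0, 0, by simp⟩
  | one => exact ⟨1, 0, by simp⟩
  | prime p hp =>
    have : Fact p.Prime := ⟨hp⟩
    obtain ⟨x, y, hxy⟩ := exists_sq_add_two_mul_sq (h p hp dvd_rfl)
    refine ⟨x, rt * y, ?_⟩
    rw [mul_pow, rt_sq]
    exact_mod_cast hxy
  | mul a b ha hb =>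
    obtain ⟨x, y, hxy⟩ := ha fun p hp hd => h p hp (hd.mul_right _)
    obtain ⟨z, w, hzw⟩ := hb fun p hp hd => h p hp (hd.mul_left _)
    refine ⟨x * z - y * w, x * w + y * z, ?_⟩
    rw [Nat.cast_mul, hxy, hzw]
    ring

theorem exists_prime_dvd_coprime {n p : ℕ} (hsq : Squarefree n) (hp : p.Prime) (hpn : p ∣ n)
    (hn : ¬ n.Prime) : ∃ q : ℕ, q.Prime ∧ q ∣ n ∧ p.Coprime q := by
  obtain ⟨m, rfl⟩ := hpn
  have hm : m ≠ 1 := by rintro rfl; exact hn (by simpa using hp)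
  obtain ⟨q, hq, hqm⟩ := Nat.exists_prime_and_dvd hm
  exact ⟨q, hq, hqm.mul_left _, (Nat.coprime_of_squarefree_mul hsq).coprime_dvd_right hqm⟩

/-- The product of the `π k` with `k ∈ e`, times one of the units `±1`, `±(1 + √2)`. -/
noncomputable def unitMulProd {s : ℕ} (π : Fin s → ℤ√2) (x : Finset (Fin s) × Bool × Bool) : ℤ√2 :=
  (if x.2.1 then -1 else 1) * (if x.2.2 then eps else 1) * ∏ k ∈ x.1, π k

theorem isUnit_signs (i j : Bool) :
    IsUnit ((if i then -1 else 1) * (if j then eps else 1) : ℤ√2) := by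
  refine IsUnit.mul ?_ ?_ <;> split_ifs
  exacts [isUnit_one.neg, isUnit_one, isUnit_eps, isUnit_one]

theorem unitMulProd_dvd {s : ℕ} {π : Fin s → ℤ√2} {m : ℤ√2} (hd : ∀ k, π k ∣ m)
    (hc : Pairwise fun k l => IsCoprime (π k) (π l)) (x : Finset (Fin s) × Bool × Bool) :
    unitMulProd π x ∣ m := by
  rw [unitMulProd, (isUnit_signs _ _).mul_left_dvd]
  exact Finset.prod_dvd_of_coprime (fun k _ l _ hkl => hc hkl) fun k _ => hd k

theorem eq_of_unitMulProd_mul_eq_sq {s : ℕ} {π : Fin s → ℤ√2} (hp : ∀ k, Prime (π k))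
    (hc : Pairwise fun k l => IsCoprime (π k) (π l)) {x y : Finset (Fin s) × Bool × Bool} {z : ℤ√2}
    (h : unitMulProd π x * unitMulProd π y = z ^ 2) : x = y := by
  have key : ∀ {x y : Finset (Fin s) × Bool × Bool}, unitMulProd π x * unitMulProd π y = z ^ 2 →
      x.1 ⊆ y.1 := by
    intro x y h k hk
    by_contra hk'
    obtain ⟨c, hc'⟩ : π k ∣ z := by
      refine (hp k).dvd_of_dvd_pow (n := 2) ?_
      rw [← h, unitMulProd]
      exact ((Finset.dvd_prod_of_mem π hk).mul_left _).mul_right _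
    have h1 : ∀ l, l ≠ k → ¬ π k ∣ π l := fun l hl hd =>
      (hp k).not_isUnit ((hc hl.symm).isUnit_of_dvd' dvd_rfl hd)
    have h2 : π k * (((if x.2.1 then -1 else 1) * (if x.2.2 then eps else 1) *
        ∏ l ∈ x.1.erase k, π l) * unitMulProd π y) = π k * (π k * c ^ 2) := by
      rw [hc', unitMulProd, ← Finset.mul_prod_erase _ _ hk] at h
      linear_combination h
    have h3 := Dvd.intro _ (mul_left_cancel₀ (hp k).ne_zero h2).symm
    rcases (hp k).dvd_or_dvd h3 with h4 | h4
    · rw [(isUnit_signs _ _).dvd_mul_left] at h4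
      obtain ⟨l, hl, hd⟩ := ((hp k).dvd_finsetProd_iff _).1 h4
      exact h1 l (Finset.ne_of_mem_erase hl) hd
    · rw [unitMulProd, (isUnit_signs _ _).dvd_mul_left] at h4
      obtain ⟨l, hl, hd⟩ := ((hp k).dvd_finsetProd_iff _).1 h4
      exact h1 l (fun h => hk' (h ▸ hl)) hd
  have he : x.1 = y.1 := (key h).antisymm (key (by rw [mul_comm]; exact h))
  obtain ⟨e, i, j⟩ := x
  obtain ⟨e', i', j'⟩ := y
  obtain rfl : e = e' := he
  have hP : ∏ k ∈ e, π k ≠ 0 := Finset.prod_ne_zero_iff.2 fun k _ => (hp k).ne_zero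
  simp only [unitMulProd] at h
  set P := ∏ k ∈ e, π k
  obtain ⟨c, rfl⟩ : P ∣ z := by
    refine (UniqueFactorizationMonoid.pow_dvd_pow_iff_dvd two_ne_zero).1 ?_
    rw [← h]
    exact Dvd.intro_left (((if i then -1 else 1) * (if j then eps else 1)) *
      ((if i' then -1 else 1) * (if j' then eps else 1))) (by ring)
  have h' : ((if i then -1 else 1) * (if j then eps else 1) : ℤ√2) *
      ((if i' then -1 else 1) * (if j' then eps else 1)) = c ^ 2 := by
    refine mul_left_cancel₀ (pow_ne_zero 2 hP) ?_
    linear_combination h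
  have hs : ∀ b : Bool, (if b then -1 else 1 : ℤ√2).norm = 1 := by
    rintro (_ | _) <;> rfl
  have hs' : ∀ b : Bool, (if b then eps else 1 : ℤ√2).norm = if b then -1 else 1 := by
    rintro (_ | _) <;> rfl
  have hn := congrArg Zsqrtd.norm h'
  simp only [Zsqrtd.norm_mul, sq, hs, hs', one_mul] at hn
  have hsq := mul_self_nonneg c.norm
  rw [← hn] at hsq
  have hj : j = j' := by
    rcases j with _ | _ <;> rcases j' with _ | _ <;> first | rfl | norm_num at hsq
  subst hj
  have hi : i = i' := by
    by_contra hi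
    have h1 : c ^ 2 = -(if j then eps else 1) ^ 2 := by
      rw [← h']
      rcases i with _ | _ <;> rcases i' with _ | _
      · exact absurd rfl hi
      · rw [if_neg Bool.false_ne_true, if_pos rfl]; ring
      · rw [if_neg Bool.false_ne_true, if_pos rfl]; ring
      · exact absurd rfl hi
    have h2 := neg_one_not_sq h1
    split_ifs at h2
    · exact isUnit_eps.ne_zero h2
    · exact one_ne_zero h2
  rw [hi]

end SqrtTwo

namespace QuarticData

open SqrtTwo

variable {O : Type*} [CommRing O] {n : ℕ} (S : QuarticData O n)

theorem exists_sq_or_of_sq_eq [IsDomain O] {x : O} {r : ℤ√2} (h : x ^ 2 = S.ι r) :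
    ∃ z, r = z ^ 2 ∨ r * (n * rt * eps) = z ^ 2 := by
  have h1 : (S.σ x) ^ 2 = x ^ 2 := by rw [← map_pow, h, S.σ_ι]
  rcases sq_eq_sq_iff_eq_or_eq_neg.1 h1 with h2 | h2
  · obtain ⟨z, rfl⟩ := S.exists_of_fixed x h2
    exact ⟨z, Or.inl (S.ι_injective (by rw [map_pow, h]))⟩
  · obtain ⟨z, hz⟩ := S.exists_of_fixed (x * S.θ) (by rw [map_mul, h2, S.σ_θ]; ring)
    refine ⟨z, Or.inr (S.ι_injective ?_)⟩
    rw [map_pow, hz, mul_pow, map_mul, h, S.θ_sq]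

theorem exists_sq_of_sq_eq [IsDomain O] (hodd : Odd n) {x : O} {r : ℤ√2} (hr : ¬ rt ∣ r)
    (h : x ^ 2 = S.ι r) : ∃ z, r = z ^ 2 := by
  obtain ⟨z, hz | hz⟩ := S.exists_sq_or_of_sq_eq h
  · exact ⟨z, hz⟩
  · obtain ⟨y, rfl⟩ : rt ∣ z :=
      prime_rt.dvd_of_dvd_pow (n := 2) (hz ▸ Dvd.intro (r * n * eps) (by ring))
    have h1 : r * n * eps = rt * y ^ 2 := by
      refine mul_left_cancel₀ prime_rt.ne_zero ?_
      linear_combination hz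
    have h2 := isUnit_eps.dvd_mul_right.1 (Dvd.intro _ h1.symm)
    rcases prime_rt.dvd_or_dvd h2 with h3 | h3
    · exact absurd h3 hr
    · exact absurd h3 (not_rt_dvd hodd dvd_rfl)

theorem exists_sq_eq_of_dvd [IsDedekindDomain O] (hodd : Odd n) (hsq : Squarefree n)
    (hP : ∀ I : Ideal O, (∃ c, I ^ 2 = Ideal.span {c}) → ∃ a, I = Ideal.span {a})
    {δ : ℤ√2} (hδ : δ ∣ n) : ∃ (a : O) (v : Oˣ), a ^ 2 = v * S.ι δ := by
  obtain ⟨c, hc⟩ := hδ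
  have hcop : IsCoprime δ c := by
    have := squarefree_natCast hodd hsq
    rw [hc, squarefree_mul_iff] at this
    exact this.1.isCoprime
  have hrt : IsCoprime δ rt := by
    have := (isCoprime_rt_natCast hodd).symm
    rw [hc] at this
    exact this.of_mul_left_left
  obtain ⟨J, hJ⟩ := S.exists_ideal_sq (δ := δ) (δ' := c * rt * eps) (by rw [hc]; ring)
    ((isCoprime_mul_unit_right_right isUnit_eps _ _).2 (hcop.mul_right hrt))
  obtain ⟨a, rfl⟩ := hP J ⟨_, hJ⟩
  rw [Ideal.span_singleton_pow, Ideal.span_singleton_eq_span_singleton] at hJ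
  obtain ⟨u, hu⟩ := hJ.symm
  exact ⟨a, u, by rw [← hu, mul_comm]⟩

theorem exists_injective [IsDedekindDomain O] (hodd : Odd n) (hsq : Squarefree n)
    (hP : ∀ I : Ideal O, (∃ c, I ^ 2 = Ideal.span {c}) → ∃ a, I = Ideal.span {a})
    {s : ℕ} {π : Fin s → ℤ√2} (hp : ∀ k, Prime (π k)) (hd : ∀ k, π k ∣ n)
    (hc : Pairwise fun k l => IsCoprime (π k) (π l)) :
    ∃ f : Finset (Fin s) × Bool × Bool → Oˣ ⧸ (powMonoidHom 2 : Oˣ →* Oˣ).range,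
      Function.Injective f ∧ ∀ x, ∃ (v : Oˣ) (a : O), f x = v ∧ a ^ 2 = v * S.ι (unitMulProd π x) := by
  choose a v hav using fun x => S.exists_sq_eq_of_dvd hodd hsq hP (unitMulProd_dvd hd hc x)
  refine ⟨fun x => v x, fun x y hxy => ?_, fun x => ⟨v x, a x, rfl, hav x⟩⟩
  obtain ⟨u, hu⟩ := QuotientGroup.eq.1 hxy
  rw [powMonoidHom_apply, eq_inv_mul_iff_mul_eq] at hu
  have h1 : (a x * a y * ((v x * u)⁻¹ : Oˣ)) ^ 2 =
      S.ι (unitMulProd π x * unitMulProd π y) := by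
    have h2 : ((v x * u : Oˣ) : O) ^ 2 * ((v x * u)⁻¹ : Oˣ) ^ 2 = 1 := by
      rw [← mul_pow, Units.mul_inv, one_pow]
    have h3 : ((v x * u : Oˣ) : O) ^ 2 = v x * v y := by
      rw [← hu]; push_cast; ring
    rw [h3] at h2
    rw [mul_pow, mul_pow, hav, hav, map_mul]
    linear_combination S.ι (unitMulProd π x) * S.ι (unitMulProd π y) * h2
  have h4 : ¬ rt ∣ unitMulProd π x * unitMulProd π y := fun h => by
    rcases prime_rt.dvd_or_dvd h with h | h <;>
    exact not_rt_dvd hodd (unitMulProd_dvd hd hc _) h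
  obtain ⟨z, hz⟩ := S.exists_sq_of_sq_eq hodd h4 h1
  exact eq_of_unitMulProd_mul_eq_sq hp hc hz

theorem false_of_three_primes [IsDedekindDomain O] (S : QuarticData O n) (hodd : Odd n)
    (hsq : Squarefree n)
    (hP : ∀ I : Ideal O, (∃ c, I ^ 2 = Ideal.span {c}) → ∃ a, I = Ideal.span {a})
    (hU : Nat.card (Oˣ ⧸ (powMonoidHom 2 : Oˣ →* Oˣ).range) = 16)
    {π : Fin 3 → ℤ√2} (hp : ∀ k, Prime (π k)) (hd : ∀ k, π k ∣ n)
    (hc : Pairwise fun k l => IsCoprime (π k) (π l)) : False := by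
  obtain ⟨f, hf, -⟩ := S.exists_injective hodd hsq hP hp hd hc
  have : Finite (Oˣ ⧸ (powMonoidHom 2 : Oˣ →* Oˣ).range) :=
    Nat.finite_of_card_ne_zero (by rw [hU]; norm_num)
  have h := Nat.card_le_card_of_injective f hf
  rw [hU] at h
  simp at h

theorem N_unit_ne_neg_one [IsDedekindDomain O] (hodd : Odd n) (hsq : Squarefree n)
    (hP : ∀ I : Ideal O, (∃ c, I ^ 2 = Ideal.span {c}) → ∃ a, I = Ideal.span {a})
    (hU : Nat.card (Oˣ ⧸ (powMonoidHom 2 : Oˣ →* Oˣ).range) = 16)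
    {π : Fin 2 → ℤ√2} (hp : ∀ k, Prime (π k)) (hd : ∀ k, π k ∣ n)
    (hc : Pairwise fun k l => IsCoprime (π k) (π l)) (u : Oˣ) : S.N u ≠ -1 := by
  obtain ⟨f, hf, hf'⟩ := S.exists_injective hodd hsq hP hp hd hc
  have : Finite (Oˣ ⧸ (powMonoidHom 2 : Oˣ →* Oˣ).range) :=
    Nat.finite_of_card_ne_zero (by rw [hU]; norm_num)
  have hbij := hf.bijective_of_nat_card_le (by rw [hU]; simp)
  obtain ⟨x, hx⟩ := hbij.surjective u
  obtain ⟨v, a, hv, ha⟩ := hf' x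
  rw [hx] at hv
  obtain ⟨w, hw⟩ := QuotientGroup.eq.1 hv
  rw [powMonoidHom_apply, eq_inv_mul_iff_mul_eq] at hw
  intro hu
  have h1 := congrArg S.N ha
  rw [← hw, sq, Units.val_mul, Units.val_pow_eq_pow_val, sq] at h1
  simp only [N_mul, N_ι, hu] at h1
  have h2 : S.N a ^ 2 = -(S.N w * unitMulProd π x) ^ 2 := by linear_combination h1
  have h3 : unitMulProd π x ≠ 0 := fun h0 =>
    not_rt_dvd hodd (unitMulProd_dvd hd hc x) (h0 ▸ dvd_zero _)
  exact mul_ne_zero (S.isUnit_N w.isUnit).ne_zero h3 (neg_one_not_sq h2)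

theorem exists_N_unit_eq_neg_one [IsDedekindDomain O] (hodd : Odd n)
    (hP : ∀ I : Ideal O, (∃ c, I ^ 2 = Ideal.span {c}) → ∃ a, I = Ideal.span {a})
    {x y : ℤ√2} (hxy : (n : ℤ√2) = x ^ 2 + y ^ 2) : ∃ u : Oˣ, S.N u = -1 := by
  have heps := eps_sq_add_one
  obtain ⟨A, hA⟩ : ∃ A, A = x * eps - y := ⟨_, rfl⟩
  obtain ⟨C, hC⟩ : ∃ C, C = x + y * eps := ⟨_, rfl⟩
  have hAC : 2 * (n * rt * eps) = A ^ 2 + C ^ 2 := by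
    rw [hxy, hA, hC]; linear_combination -(x ^ 2 + y ^ 2) * heps
  have hC0 : C ≠ 0 := by
    intro h
    refine not_rt_dvd hodd dvd_rfl (Dvd.intro (y ^ 2 * 2 * eps) ?_)
    rw [hxy]
    rw [hC] at h
    linear_combination -y ^ 2 * heps - (x - y * eps) * h
  have hιC : S.ι C ≠ 0 := S.ι_ne_zero.2 hC0
  obtain ⟨β, hβ⟩ : ∃ β, β = S.ι A + S.ι rt * S.θ := ⟨_, rfl⟩
  have hσβ : S.σ β = S.ι A - S.ι rt * S.θ := by
    rw [hβ, map_add, map_mul, S.σ_ι, S.σ_ι, S.σ_θ]; ring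
  have hN : β * S.σ β = -S.ι C ^ 2 := by
    have h1 := congrArg S.ι hAC
    simp only [map_add, map_pow, map_mul S.ι 2] at h1
    rw [← S.θ_sq] at h1
    have h2 := congrArg S.ι rt_sq
    rw [map_pow] at h2
    rw [hσβ, hβ]
    linear_combination -S.θ ^ 2 * h2 - h1
  have hNβ : S.N β = -C ^ 2 := S.ι_injective (by rw [ι_N, hN, map_neg, map_pow])
  obtain ⟨I, hI⟩ : ∃ I : Ideal O, I = Ideal.span {S.ι C, β} := ⟨_, rfl⟩
  have hCI : S.ι C ∈ I := hI ▸ Ideal.subset_span (by simp)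
  have hI0 : I ≠ ⊥ := fun h => hιC (by rwa [h] at hCI)
  have hmap : Ideal.span {S.ι C} * I = Ideal.span {β} * I.map S.σ := by
    rw [hI, Ideal.map_span, Set.image_pair, S.σ_ι, Ideal.span_mul_span', Ideal.span_mul_span',
      Set.singleton_mul, Set.singleton_mul, Set.image_pair, Set.image_pair, hN, mul_comm β,
      ← sq, Set.pair_comm, Ideal.span_insert, Ideal.span_insert, ← Ideal.span_singleton_neg (S.ι C ^ 2)]
  obtain ⟨g, hg0, hg, -⟩ := S.exists_mul_map_eq hI0
  have h1 : Ideal.span {S.ι C} * I ^ 2 = Ideal.span {β * S.ι g} := by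
    rw [sq, ← mul_assoc, hmap, mul_assoc, mul_comm (I.map S.σ), hg,
      Ideal.span_singleton_mul_span_singleton]
  obtain ⟨c, hc⟩ : S.ι C ∣ β * S.ι g := by
    rw [← Ideal.mem_span_singleton]
    have h2 : β * S.ι g ∈ Ideal.span {S.ι C} * I ^ 2 := by
      rw [h1]; exact Ideal.mem_span_singleton_self _
    exact (Ideal.mul_le_left : Ideal.span {S.ι C} * I ^ 2 ≤ Ideal.span {S.ι C}) h2
  rw [hc, ← Ideal.span_singleton_mul_span_singleton] at h1
  have hspan : Ideal.span {S.ι C} ≠ ⊥ := by simpa using hιC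
  obtain ⟨a, ha⟩ := hP I ⟨c, mul_left_cancel₀ hspan h1⟩
  rw [ha, Ideal.map_span, Set.image_singleton, Ideal.span_singleton_mul_span_singleton,
    Ideal.span_singleton_mul_span_singleton, Ideal.span_singleton_eq_span_singleton] at hmap
  obtain ⟨u, hu⟩ := hmap
  have ha0 : a ≠ 0 := by rintro rfl; exact hI0 (by simpa using ha)
  refine ⟨u, ?_⟩
  have h2 := congrArg S.N hu
  have hσ : S.N (S.σ a) = S.N a := S.ι_injective (by rw [ι_N, ι_N, S.σ_σ, mul_comm])
  simp only [N_mul, N_ι, hNβ, hσ] at h2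
  have h3 : C ^ 2 * S.N a ≠ 0 := mul_ne_zero (pow_ne_zero 2 hC0) (S.N_ne_zero ha0)
  refine mul_left_cancel₀ h3 ?_
  linear_combination h2

theorem mod_eight_ne_five [IsDedekindDomain O] (S : QuarticData O n) (hodd : Odd n)
    (hsq : Squarefree n)
    (hP : ∀ I : Ideal O, (∃ c, I ^ 2 = Ideal.span {c}) → ∃ a, I = Ideal.span {a})
    {p : ℕ} [hp : Fact p.Prime] (hpn : p ∣ n) : p % 8 ≠ 5 := by
  intro hp5
  have hpp : Prime ((p : ℤ) : ℤ√2) := by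
    have := prime_of_inert (Or.inr hp5); exact_mod_cast this
  obtain ⟨J, hJ⟩ := S.exists_ideal_sq (δ := rt) (δ' := n * eps) (by ring)
    ((isCoprime_mul_unit_right_right isUnit_eps _ _).2 (isCoprime_rt_natCast hodd))
  obtain ⟨a, rfl⟩ := hP J ⟨_, hJ⟩
  rw [Ideal.span_singleton_pow, Ideal.span_singleton_eq_span_singleton] at hJ
  obtain ⟨v, hv⟩ := hJ.symm
  have h1 := congrArg S.N hv
  rw [N_mul, N_ι, sq a, N_mul, rt_sq, ← sq] at h1
  have hm : (S.N a).norm = 2 ∨ (S.N a).norm = -2 := by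
    have h2 := congrArg Zsqrtd.norm h1
    have h3 : (2 : ℤ√2).norm = 4 := rfl
    rw [Zsqrtd.norm_mul, h3, sq, Zsqrtd.norm_mul] at h2
    rcases (isUnit_iff _).1 (S.isUnit_N v.isUnit) with h4 | h4 <;> rw [h4] at h2
    · have : ((S.N a).norm - 2) * ((S.N a).norm + 2) = 0 := by linear_combination -h2
      rcases mul_eq_zero.1 this with h | h
      · left; linarith
      · right; linarith
    · nlinarith [mul_self_nonneg (S.N a).norm]
  obtain ⟨t, ht⟩ := S.exists_trace a
  obtain ⟨w, hw⟩ := S.exists_of_fixed ((a - S.σ a) * S.θ) (by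
    rw [map_mul, map_sub, S.σ_σ, S.σ_θ]; ring)
  have hw2 : w ^ 2 = (t ^ 2 - 4 * S.N a) * (n * rt * eps) := by
    apply S.ι_injective
    rw [map_pow, hw, map_mul, ← S.θ_sq, map_sub, map_mul, ι_N, map_pow, ht, map_ofNat]
    ring
  obtain ⟨k, rfl⟩ := hpn
  have hpk : ¬ p ∣ k := fun h => by
    have := hsq p (mul_dvd_mul_left _ h)
    exact hp.out.one_lt.ne' (Nat.isUnit_iff.1 this)
  obtain ⟨y, rfl⟩ : ((p : ℤ) : ℤ√2) ∣ w := by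
    refine hpp.dvd_of_dvd_pow (n := 2) ?_
    rw [hw2]
    exact Dvd.intro ((t ^ 2 - 4 * S.N a) * (k * rt * eps)) (by push_cast; ring)
  have h2 : ((p : ℤ) : ℤ√2) ∣ (t ^ 2 - 4 * S.N a) * (k * rt * eps) := by
    refine Dvd.intro (y ^ 2) (mul_left_cancel₀ hpp.ne_zero ?_)
    push_cast at hw2 ⊢
    linear_combination hw2
  have h3 : ((p : ℤ) : ℤ√2) ∣ t ^ 2 - 4 * S.N a := by
    rcases hpp.dvd_or_dvd h2 with h | h
    · exact h
    · rw [isUnit_eps.dvd_mul_right] at h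
      rcases hpp.dvd_or_dvd h with h | h
      · have : ((p : ℤ) : ℤ√2) ∣ ((k : ℤ) : ℤ√2) := by exact_mod_cast h
        rw [Zsqrtd.intCast_dvd_intCast] at this
        exact absurd (by exact_mod_cast this) hpk
      · exact absurd h (not_natCast_dvd_rt hp.out.ne_one)
  have h4 := norm_modEq h3
  rw [sq, Zsqrtd.norm_mul, Zsqrtd.norm_mul] at h4
  have h5 : (4 : ℤ√2).norm = 16 := rfl
  rw [h5, ← ZMod.intCast_zmod_eq_zero_iff_dvd] at h4
  push_cast at h4
  have hp2 : p ≠ 2 := by rintro rfl; simp at hp5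
  have h40 : (4 : ZMod p) ≠ 0 := by
    intro h
    have h' : ((4 : ℕ) : ZMod p) = 0 := by exact_mod_cast h
    rw [ZMod.natCast_eq_zero_iff, show (4 : ℕ) = 2 ^ 2 from rfl] at h'
    exact hp2 ((Nat.prime_dvd_prime_iff_eq hp.out Nat.prime_two).1 (hp.out.dvd_of_dvd_pow h'))
  set T : ZMod p := (t.norm : ZMod p)
  rcases hm with hm | hm <;> rw [hm] at h4
  · have : IsSquare (2 : ZMod p) := ⟨T / 4, by
      field_simp; push_cast at h4; linear_combination -h4⟩
    rw [ZMod.exists_sq_eq_two_iff hp2] at this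
    omega
  · have : IsSquare (-2 : ZMod p) := ⟨T / 4, by
      field_simp; push_cast at h4; linear_combination -h4⟩
    rw [ZMod.exists_sq_eq_neg_two_iff hp2] at this
    omega

theorem eq_one_or_prime [IsDedekindDomain O] (S : QuarticData O n) (hodd : Odd n)
    (hsq : Squarefree n)
    (hP : ∀ I : Ideal O, (∃ c, I ^ 2 = Ideal.span {c}) → ∃ a, I = Ideal.span {a})
    (hU : Nat.card (Oˣ ⧸ (powMonoidHom 2 : Oˣ →* Oˣ).range) = 16) :
    n = 1 ∨ n.Prime ∧ n % 4 = 3 := by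
  have hno : ∀ {π₁ π₂ x y : ℤ√2}, Prime π₁ → Prime π₂ → π₁ ∣ n → π₂ ∣ n → IsCoprime π₁ π₂ →
      (n : ℤ√2) = x ^ 2 + y ^ 2 → False := by
    intro π₁ π₂ x y h₁ h₂ h₃ h₄ hc hxy
    obtain ⟨u, hu⟩ := S.exists_N_unit_eq_neg_one hodd hP hxy
    refine S.N_unit_ne_neg_one hodd hsq hP hU (π := ![π₁, π₂]) ?_ ?_ ?_ u hu
    · simp [Fin.forall_fin_two, h₁, h₂]
    · simp [Fin.forall_fin_two, h₃, h₄]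
    · simp [Pairwise, Fin.forall_fin_two, hc, hc.symm]
  have hpodd : ∀ {p : ℕ}, p ∣ n → p % 2 = 1 := fun h => Nat.odd_iff.1 (hodd.of_dvd_nat h)
  by_contra hcon
  rw [not_or] at hcon
  obtain ⟨p, hp, hpn⟩ := Nat.exists_prime_and_dvd hcon.1
  have hcast : ∀ {p : ℕ}, p ∣ n → ((p : ℤ√2)) ∣ n := fun h => Nat.cast_dvd_cast h
  by_cases hprime : n.Prime
  · obtain rfl := (Nat.prime_dvd_prime_iff_eq hp hprime).1 hpn
    have : Fact p.Prime := ⟨hp⟩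
    have h5 := S.mod_eight_ne_five hodd hsq hP dvd_rfl
    have h2 := hpodd hpn
    have h4 : p % 4 ≠ 3 := fun h => hcon.2 ⟨hprime, h⟩
    have h1 : p % 8 = 1 := by omega
    obtain ⟨a, b, hab, ha, hb, hc⟩ := exists_split (Or.inl h1)
    obtain ⟨x, y, hxy⟩ := Nat.Prime.sq_add_sq (p := p) h4
    exact hno (x := x) (y := y) (prime_of_norm ha) (prime_of_norm hb) (hab ▸ Dvd.intro _ rfl)
      (hab ▸ Dvd.intro_left _ rfl) hc (by exact_mod_cast hxy.symm)
  by_cases h17 : ∃ p : ℕ, p.Prime ∧ p ∣ n ∧ (p % 8 = 1 ∨ p % 8 = 7)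
  · obtain ⟨p, hp, hpn, h17⟩ := h17
    have : Fact p.Prime := ⟨hp⟩
    obtain ⟨q, hq, hqn, hpq⟩ := exists_prime_dvd_coprime hsq hp hpn hprime
    obtain ⟨a, b, hab, ha, hb, hc⟩ := exists_split h17
    obtain ⟨π, hπ, hπq⟩ := WfDvdMonoid.exists_irreducible_factor (a := (q : ℤ√2))
      (not_isUnit_natCast hq.ne_one) (by exact_mod_cast hq.ne_zero)
    have hcop := isCoprime_natCast hpq
    rw [hab] at hcop
    have ha' := (hcop.of_mul_left_left).of_isCoprime_of_dvd_right hπq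
    have hb' := (hcop.of_mul_left_right).of_isCoprime_of_dvd_right hπq
    have hpn' := hcast hpn
    rw [hab] at hpn'
    refine S.false_of_three_primes hodd hsq hP hU (π := ![a, b, π]) ?_ ?_ ?_
    · simp [Fin.forall_fin_succ, prime_of_norm ha, prime_of_norm hb, hπ.prime]
    · simp [Fin.forall_fin_succ, dvd_of_mul_right_dvd hpn', dvd_of_mul_left_dvd hpn',
        hπq.trans (hcast hqn)]
    · simp [Pairwise, Fin.forall_fin_succ, hc, hc.symm, ha', ha'.symm, hb', hb'.symm]
  · have h3 : ∀ p : ℕ, p.Prime → p ∣ n → p % 8 = 3 := fun p hp hpn => by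
      have : Fact p.Prime := ⟨hp⟩
      have h5 := S.mod_eight_ne_five hodd hsq hP hpn
      have h2 := hpodd hpn
      have h17' : ¬(p % 8 = 1 ∨ p % 8 = 7) := fun h => h17 ⟨p, hp, hpn, h⟩
      omega
    obtain ⟨q, hq, hqn, hpq⟩ := exists_prime_dvd_coprime hsq hp hpn hprime
    obtain ⟨x, y, hxy⟩ := exists_sq_add_sq h3
    have : Fact p.Prime := ⟨hp⟩
    have : Fact q.Prime := ⟨hq⟩
    exact hno (prime_of_inert (Or.inl (h3 p hp hpn))) (prime_of_inert (Or.inl (h3 q hq hqn)))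
      (hcast hpn) (hcast hqn) (isCoprime_natCast hpq) hxy

end QuarticData

namespace SqrtTwo

/-- Representatives of the units of `ℤ[√2]` modulo squares. -/
noncomputable def unitReps : Finset (ℤ√2) :=
  open Classical in {1, -1, eps, -eps}

theorem card_unitReps_le : unitReps.card ≤ 4 := by
  classical exact Finset.card_le_four

theorem exists_mem_unitReps {u : ℤ√2} (hu : IsUnit u) :
    ∃ m ∈ unitReps, ∃ w, IsUnit w ∧ u = m * w ^ 2 := by
  classical
  obtain ⟨w, hw, h⟩ := unit_cases hu
  rcases h with h | h | h | h
  · exact ⟨1, by simp [unitReps], w, hw, by rw [h, one_mul]⟩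
  · exact ⟨-1, by simp [unitReps], w, hw, h⟩
  · exact ⟨eps, by simp [unitReps], w, hw, h⟩
  · exact ⟨-eps, by simp [unitReps], w, hw, h⟩

theorem exists_finset_mul_sq {n : ℤ√2} {Q : Finset (ℤ√2)}
    (hQ : ∀ δ, δ ∣ n → ∃ q ∈ Q, Associated q δ) :
    ∃ T : Finset (ℤ√2), T.card ≤ Q.card * 4 ∧
      ∀ δ, δ ∣ n → ∃ δ' ∈ T, ∃ w, IsUnit w ∧ δ = δ' * w ^ 2 := by
  classical
  refine ⟨Finset.image₂ (· * ·) Q unitReps, (Finset.card_image₂_le _ _ _).trans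
    (Nat.mul_le_mul_left _ card_unitReps_le), fun δ hδ => ?_⟩
  obtain ⟨q, hq, u, rfl⟩ := hQ δ hδ
  obtain ⟨m, hm, w, hw, h⟩ := exists_mem_unitReps u.isUnit
  exact ⟨q * m, Finset.mem_image₂_of_mem hq hm, w, hw, by rw [h, mul_assoc]⟩

theorem prime_star {π : ℤ√2} (h : Prime π) : Prime (star π) :=
  (MulEquiv.prime_iff (starMulAut : ℤ√2 ≃* ℤ√2)).2 h

theorem exists_coprime_reduction {w t h η D : ℤ√2} (hh : h ≠ 0)
    (hw : w ^ 2 = (t ^ 2 - η * h ^ 2) * D) :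
    ∃ w' t' h', IsCoprime t' h' ∧ w' ^ 2 = (t' ^ 2 - η * h' ^ 2) * D := by
  obtain ⟨t', ht⟩ := EuclideanDomain.gcd_dvd_left t h
  obtain ⟨h', hh'⟩ := EuclideanDomain.gcd_dvd_right t h
  have hk : EuclideanDomain.gcd t h ≠ 0 := fun h0 => hh (EuclideanDomain.gcd_eq_zero_iff.1 h0).2
  have hcop : IsCoprime t' h' := by
    refine ⟨EuclideanDomain.gcdA t h, EuclideanDomain.gcdB t h, mul_left_cancel₀ hk ?_⟩
    have h1 := EuclideanDomain.gcd_eq_gcd_ab t h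
    linear_combination -h1 - EuclideanDomain.gcdA t h * ht - EuclideanDomain.gcdB t h * hh'
  generalize EuclideanDomain.gcd t h = k at *
  obtain ⟨w', rfl⟩ : k ∣ w := by
    refine (UniqueFactorizationMonoid.pow_dvd_pow_iff_dvd two_ne_zero).1 ?_
    rw [hw, ht, hh']
    exact Dvd.intro ((t' ^ 2 - η * h' ^ 2) * D) (by ring)
  refine ⟨w', t', h', hcop, mul_left_cancel₀ (pow_ne_zero 2 hk) ?_⟩
  rw [← mul_pow, hw, ht, hh']
  ring

theorem dvd_sq_sub {p : ℕ} [hp : Fact p.Prime] (hodd : Odd p) {w t h η : ℤ√2}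
    (hw : w ^ 2 = (t ^ 2 - η * h ^ 2) * (p * rt * eps)) : (p : ℤ√2) ∣ t ^ 2 - η * h ^ 2 := by
  have hp0 : (p : ℤ√2) ≠ 0 := by exact_mod_cast hp.out.ne_zero
  obtain ⟨y, rfl⟩ : (p : ℤ√2) ∣ w := by
    refine ((squarefree_natCast hodd hp.out.squarefree).dvd_pow_iff_dvd two_ne_zero).1 ?_
    rw [hw]
    exact Dvd.intro ((t ^ 2 - η * h ^ 2) * (rt * eps)) (by ring)
  have h1 : (p : ℤ√2) ∣ (t ^ 2 - η * h ^ 2) * (rt * eps) := by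
    refine Dvd.intro (y ^ 2) (mul_left_cancel₀ hp0 ?_)
    linear_combination hw
  rw [← mul_assoc, isUnit_eps.dvd_mul_right] at h1
  exact (isCoprime_rt_natCast hodd).symm.dvd_of_dvd_mul_right h1

theorem norm_ne_neg_one {p : ℕ} [hp : Fact p.Prime] (hp4 : p % 4 = 3) {w t h η : ℤ√2} (hh : h ≠ 0)
    (hw : w ^ 2 = (t ^ 2 - η * h ^ 2) * (p * rt * eps)) : η.norm ≠ -1 := by
  intro hη
  obtain ⟨w, t, h, hc, hw⟩ := exists_coprime_reduction hh hw
  have h1 := dvd_sq_sub (Nat.odd_iff.2 (by omega)) hw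
  have h2 : (p : ℤ) ∣ t.norm := by
    have h3 := norm_modEq (p := p) (by exact_mod_cast h1)
    rw [sq, sq, Zsqrtd.norm_mul, Zsqrtd.norm_mul, Zsqrtd.norm_mul, hη,
      ← ZMod.intCast_zmod_eq_zero_iff_dvd] at h3
    rw [← ZMod.intCast_zmod_eq_zero_iff_dvd]
    by_contra h0
    push_cast at h3
    exact ZMod.mod_four_ne_three_of_sq_eq_neg_sq' (p := p) (y := (t.norm : ZMod p))
      (x := (h.norm : ZMod p)) h0 (by linear_combination h3) hp4
  obtain ⟨π, hπ, hπp⟩ := WfDvdMonoid.exists_irreducible_factor (a := (p : ℤ√2))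
    (not_isUnit_natCast hp.out.ne_one) (by exact_mod_cast hp.out.ne_zero)
  have key : ∀ π : ℤ√2, Prime π → π ∣ p → ¬ π ∣ t := fun π hπ hπp hπt => by
    have h3 := (dvd_sub_right (hπt.trans (dvd_pow_self _ two_ne_zero))).1 (hπp.trans h1)
    have hη' : IsUnit η := (isUnit_iff η).2 (Or.inr hη)
    rw [hη'.dvd_mul_left] at h3
    exact hπ.not_isUnit (hc.isUnit_of_dvd' hπt (hπ.dvd_of_dvd_pow h3))
  have h4 : π ∣ t * star t := by
    rw [← Zsqrtd.norm_eq_mul_conj]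
    refine hπp.trans ?_
    have : ((p : ℤ) : ℤ√2) ∣ (t.norm : ℤ√2) := (Zsqrtd.intCast_dvd_intCast _ _).2 h2
    exact_mod_cast this
  rcases hπ.prime.dvd_or_dvd h4 with h5 | ⟨c, hc'⟩
  · exact key π hπ.prime hπp h5
  · obtain ⟨e, he⟩ := hπp
    refine key (star π) (prime_star hπ.prime) ⟨star e, ?_⟩ ⟨star c, ?_⟩
    · rw [mul_comm, ← star_mul, ← he, star_natCast]
    · rw [mul_comm, ← star_mul, ← hc', star_star]

theorem sq_add_sq_mul_ne {p : ℕ} [hp : Fact p.Prime] (hp8 : p % 8 = 7) {w t h : ℤ√2} (hh : h ≠ 0)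
    (hw : w ^ 2 = (t ^ 2 - -1 * h ^ 2) * (p * rt * eps)) : False := by
  obtain ⟨w, t, h, ⟨u, v, huv⟩, hw⟩ := exists_coprime_reduction hh hw
  obtain ⟨k, hk⟩ := dvd_sq_sub (Nat.odd_iff.2 (by omega)) hw
  obtain ⟨r, hr⟩ := (ZMod.exists_sq_eq_two_iff (p := p) (by omega)).2 (Or.inr hp8)
  let f : ℤ√2 →+* ZMod p := Zsqrtd.lift ⟨r, by rw [← hr]; norm_num⟩
  have h1 := congrArg f hk
  have h2 := congrArg f huv
  simp only [map_sub, map_mul, map_pow, map_neg, map_one, map_natCast, map_add,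
    CharP.cast_eq_zero, zero_mul] at h1 h2
  have h3 : f t = 0 := by
    by_contra h0
    exact ZMod.mod_four_ne_three_of_sq_eq_neg_sq' h0
      (show f h ^ 2 = -f t ^ 2 by linear_combination h1) (by omega)
  have h4 : f h = 0 := by
    rw [h3] at h1
    simpa using h1
  rw [h3, h4] at h2
  simp at h2

end SqrtTwo

namespace QuarticData

open SqrtTwo

variable {O : Type*} [CommRing O] {n : ℕ} (S : QuarticData O n)

theorem exists_sq_eq_trace_mul (x : O) :
    ∃ w t : ℤ√2, w ^ 2 = (t ^ 2 - 4 * S.N x) * (n * rt * eps) := by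
  obtain ⟨t, ht⟩ := S.exists_trace x
  obtain ⟨w, hw⟩ := S.exists_of_fixed ((x - S.σ x) * S.θ) (by
    rw [map_mul, map_sub, S.σ_σ, S.σ_θ]; ring)
  refine ⟨w, t, S.ι_injective ?_⟩
  rw [map_pow, hw, map_mul, ← S.θ_sq, map_sub, map_mul, ι_N, map_pow, ht, map_ofNat]
  ring

theorem eq_span_of_span_mul_eq [IsDedekindDomain O] {x y : O} {I : Ideal O} (hx : x ≠ 0)
    (h : Ideal.span {x} * I = Ideal.span {y}) : ∃ a, I = Ideal.span {a} := by
  obtain ⟨a, rfl⟩ : x ∣ y := by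
    rw [← Ideal.mem_span_singleton]
    have h1 : y ∈ Ideal.span {x} * I := by rw [h]; exact Ideal.mem_span_singleton_self _
    exact (Ideal.mul_le_left : Ideal.span {x} * I ≤ Ideal.span {x}) h1
  rw [← Ideal.span_singleton_mul_span_singleton] at h
  exact ⟨a, mul_left_cancel₀ (by simpa using hx) h⟩

theorem associated_of_span_eq [IsDomain O] {a b : ℤ√2}
    (h : Ideal.span {S.ι a} = Ideal.span {S.ι b}) : Associated a b := by
  rw [Ideal.span_singleton_eq_span_singleton] at h
  exact associated_of_dvd_dvd (S.ι_dvd.1 h.dvd) (S.ι_dvd.1 h.symm.dvd)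

theorem exists_sq_eq_of_N_eq_sq [IsDedekindDomain O] (hn : n ≠ 0) {v : Oˣ} {w : ℤ√2}
    (hw : IsUnit w) (h : S.N v = w ^ 2) : ∃ (δ : ℤ√2) (a : O), δ ∣ n ∧ a ^ 2 = v * S.ι δ := by
  obtain ⟨t, ht0, ht⟩ := S.exists_of_N_eq_sq hn h
  have hJ : Ideal.span {t} ≠ ⊥ := by simpa using ht0
  have hσ : (Ideal.span {t}).map S.σ = Ideal.span {t} := by
    rw [Ideal.map_span, Set.image_singleton, ← Ideal.span_singleton_mul_left_unit v.isUnit, ht,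
      Ideal.span_singleton_mul_left_unit (hw.map S.ι)]
  obtain ⟨δ, z, hδ, hz, h1⟩ := S.exists_sq_eq_of_fixed hJ hσ
  obtain ⟨t', η, hη, ht', ht'2⟩ : ∃ (t' : O) (η : ℤ√2), IsUnit η ∧ v * S.σ t' = S.ι η * t' ∧
      Ideal.span {t' ^ 2} = Ideal.span {S.ι (δ * z ^ 2)} := by
    rcases h1 with h1 | h1
    · exact ⟨t, w, hw, ht, by rw [← h1, Ideal.span_singleton_pow]⟩
    · refine ⟨S.θ * t, -w, hw.neg, ?_, by
        rw [← h1, Ideal.span_singleton_mul_span_singleton, Ideal.span_singleton_pow]⟩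
      rw [map_mul, S.σ_θ, map_neg]
      linear_combination -S.θ * ht
  have h2 : v * S.ι (S.N t') = S.ι η * t' ^ 2 := by
    rw [ι_N]; linear_combination t' * ht'
  have h3 : Associated (δ * z ^ 2) (S.N t') := by
    refine S.associated_of_span_eq ?_
    rw [← ht'2, ← Ideal.span_singleton_mul_left_unit (hη.map S.ι), ← h2,
      Ideal.span_singleton_mul_left_unit v.isUnit]
  obtain ⟨e, he⟩ := h3
  obtain ⟨η', hη'⟩ := hη.exists_right_inv
  have h4 : t' ^ 2 = v * S.ι (δ * e * η') * S.ι z ^ 2 := by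
    have h5 := congrArg S.ι hη'
    rw [← he] at h2
    simp only [map_mul, map_one, map_pow] at h2 h5 ⊢
    linear_combination -t' ^ 2 * h5 - S.ι η' * h2
  obtain ⟨a, rfl⟩ : S.ι z ∣ t' :=
    (IsIntegrallyClosed.pow_dvd_pow_iff two_ne_zero).1 (h4 ▸ Dvd.intro_left _ rfl)
  refine ⟨δ * e * η', a, ?_, ?_⟩
  · rw [(IsUnit.of_mul_eq_one_right _ hη').mul_right_dvd, e.isUnit.mul_right_dvd]
    exact hδ
  · refine mul_left_cancel₀ (pow_ne_zero 2 (S.ι_ne_zero.2 hz)) ?_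
    linear_combination h4

/-- The parameters `T` and `M` for which the counting argument shows that every divisor of `n`
ramifies principally and every admissible norm class is the class of the norm of a unit. -/
structure IsTight (T M : Finset (ℤ√2)) : Prop where
  exists_mem : ∀ δ, δ ∣ (n : ℤ√2) → ∃ δ' ∈ T, ∃ w, IsUnit w ∧ δ = δ' * w ^ 2
  exists_norm : ∀ (x : O) (g η : ℤ√2), g ≠ 0 → IsUnit η → S.N x = η * g ^ 2 →
    ∃ m ∈ M, ∃ w, IsUnit w ∧ η = m * w ^ 2
  card_le : T.card * M.card ≤ 16

variable {S}

theorem quotient_eq_of_mul_eq_sq {v w : Oˣ} {y : O} (h : y ^ 2 = v * w) :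
    (v : Oˣ ⧸ (powMonoidHom 2 : Oˣ →* Oˣ).range) = w := by
  have hy : IsUnit y := (isUnit_pow_iff two_ne_zero).1 (h ▸ (v * w).isUnit)
  obtain ⟨y, rfl⟩ := hy
  rw [QuotientGroup.eq]
  refine ⟨v⁻¹ * y, ?_⟩
  have h' : y ^ 2 = v * w := Units.ext (by simpa using h)
  rw [powMonoidHom_apply, mul_pow, h', sq]
  group

theorem IsTight.forall_good [IsDedekindDomain O] {T M : Finset (ℤ√2)} (h : S.IsTight T M)
    (hn : n ≠ 0) (hU : Nat.card (Oˣ ⧸ (powMonoidHom 2 : Oˣ →* Oˣ).range) = 16) :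
    (∀ δ : ℤ√2, δ ∣ n → ∃ (a : O) (v : Oˣ), a ^ 2 = v * S.ι δ) ∧
    (∀ m ∈ M, ∃ (u : Oˣ) (w : ℤ√2), IsUnit w ∧ S.N u = m * w ^ 2) := by
  classical
  set G : ℤ√2 → Prop := fun δ => δ ≠ 0 ∧ ∃ (a : O) (v : Oˣ), a ^ 2 = v * S.ι δ with hG
  set T' := T.filter G with hT'
  have hnorm : ∀ u : Oˣ, ∃ m ∈ M, ∃ w, IsUnit w ∧ S.N u = m * w ^ 2 := fun u =>
    h.exists_norm u 1 _ one_ne_zero (S.isUnit_N u.isUnit) (by ring)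
  choose m hmM w hw hm using hnorm
  obtain ⟨b, hb⟩ : ∃ b : ℤ√2 → Oˣ, ∀ u, m (b (m u)) = m u := by
    refine ⟨fun μ => if h : ∃ u, m u = μ then h.choose else 1, fun u => ?_⟩
    have h1 : ∃ u', m u' = m u := ⟨u, rfl⟩
    simp only [h1, dif_pos]
    exact h1.choose_spec
  have hD : ∀ u : Oˣ, ∃ δ ∈ T', ∃ a : O, a ^ 2 = (u * b (m u) : Oˣ) * S.ι δ := by
    intro u
    have hmu : IsUnit (m u) := isUnit_of_mul_isUnit_left (hm u ▸ S.isUnit_N u.isUnit)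
    have h1 : S.N (u * b (m u) : Oˣ) = (m u * w u * w (b (m u))) ^ 2 := by
      rw [Units.val_mul, N_mul, hm, hm (b (m u)), hb]
      ring
    obtain ⟨δ, a, hδ, ha⟩ := S.exists_sq_eq_of_N_eq_sq hn ((hmu.mul (hw u)).mul (hw _)) h1
    obtain ⟨δ', hδ', k, hk, rfl⟩ := h.exists_mem δ hδ
    obtain ⟨k', hk'⟩ := hk.exists_right_inv
    have h2 : (a * S.ι k') ^ 2 = (u * b (m u) : Oˣ) * S.ι δ' := by
      have h3 := congrArg S.ι hk'
      simp only [map_mul, map_one, map_pow] at h3 ha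
      rw [mul_pow, ha]
      linear_combination ((u * b (m u) : Oˣ) : O) * S.ι δ' * (S.ι k * S.ι k' + 1) * h3
    refine ⟨δ', Finset.mem_filter.2 ⟨hδ', ?_, _, _, h2⟩, _, h2⟩
    rintro rfl
    rw [zero_mul, zero_dvd_iff] at hδ
    exact hn (by exact_mod_cast hδ)
  choose D hDT A hA using hD
  let F : Oˣ ⧸ (powMonoidHom 2 : Oˣ →* Oˣ).range → T' × M := fun q =>
    (⟨D q.out, hDT _⟩, ⟨m q.out, hmM _⟩)
  have hF : Function.Injective F := by
    intro q₁ q₂ hq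
    simp only [F, Prod.mk.injEq, Subtype.mk.injEq] at hq
    rw [← q₁.out_eq', ← q₂.out_eq']
    generalize q₁.out = u₁ at hq ⊢
    generalize q₂.out = u₂ at hq ⊢
    have h1 := hA u₁
    have h2 := hA u₂
    have hD0 : S.ι (D u₂) ≠ 0 := S.ι_ne_zero.2 (Finset.mem_filter.1 (hDT u₂)).2.1
    rw [hq.1, hq.2] at h1
    have h3 : (A u₁ * A u₂) ^ 2 = S.ι (D u₂) ^ 2 * ((u₁ * b (m u₂) * (u₂ * b (m u₂)) : Oˣ) : O) := by
      rw [mul_pow, h1, h2]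
      push_cast
      ring
    obtain ⟨y, hy⟩ : S.ι (D u₂) ∣ A u₁ * A u₂ :=
      (IsIntegrallyClosed.pow_dvd_pow_iff two_ne_zero).1 (h3 ▸ Dvd.intro _ rfl)
    have h4 : y ^ 2 = ((u₁ * b (m u₂) * (u₂ * b (m u₂)) : Oˣ) : O) := by
      rw [hy, mul_pow] at h3
      exact mul_left_cancel₀ (pow_ne_zero 2 hD0) h3
    refine quotient_eq_of_mul_eq_sq (y := y * ((b (m u₂))⁻¹ : Oˣ)) ?_
    have h5 := Units.mul_inv (b (m u₂))
    push_cast at h4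
    rw [mul_pow, h4]
    linear_combination u₁ * u₂ * (b (m u₂) * ((b (m u₂))⁻¹ : Oˣ) + 1) * h5
  have hcard := Nat.card_le_card_of_injective F hF
  rw [hU, Nat.card_prod, Nat.card_eq_fintype_card, Nat.card_eq_fintype_card, Fintype.card_coe,
    Fintype.card_coe] at hcard
  have hT'le : T'.card ≤ T.card := Finset.card_filter_le _ _
  have hMpos : 0 < M.card := Nat.pos_of_ne_zero fun h0 => by simp [h0] at hcard
  have hT'pos : 0 < T'.card := Nat.pos_of_ne_zero fun h0 => by simp [h0] at hcard
  have hTT' : T' = T := Finset.eq_of_subset_of_card_le (Finset.filter_subset _ _)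
    (Nat.le_of_mul_le_mul_right (h.card_le.trans hcard) hMpos)
  have hbij : Function.Bijective F := hF.bijective_of_nat_card_le (by
    rw [hU, Nat.card_prod, Nat.card_eq_fintype_card, Nat.card_eq_fintype_card, Fintype.card_coe,
      Fintype.card_coe, hTT']
    exact h.card_le)
  constructor
  · intro δ hδ
    obtain ⟨δ', hδ', k, hk, rfl⟩ := h.exists_mem δ hδ
    rw [← hTT', Finset.mem_filter] at hδ'
    obtain ⟨-, -, a, v, hav⟩ := hδ'
    exact ⟨a * S.ι k, v, by rw [mul_pow, hav, map_mul, map_pow, mul_assoc]⟩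
  · intro μ hμ
    obtain ⟨δ, hδ⟩ := Finset.card_pos.1 hT'pos
    obtain ⟨q, hq⟩ := hbij.surjective (⟨δ, hδ⟩, ⟨μ, hμ⟩)
    simp only [F, Prod.mk.injEq, Subtype.mk.injEq] at hq
    exact ⟨q.out, _, hw _, by rw [← hq.2]; exact hm _⟩

theorem IsTight.exists_eq_span [IsDedekindDomain O] {T M : Finset (ℤ√2)} (h : S.IsTight T M)
    (hn : n ≠ 0) (hU : Nat.card (Oˣ ⧸ (powMonoidHom 2 : Oˣ →* Oˣ).range) = 16) {I : Ideal O}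
    (hI : ∃ c, I ^ 2 = Ideal.span {c}) : ∃ a, I = Ideal.span {a} := by
  obtain ⟨hgood, hnorm⟩ := h.forall_good hn hU
  by_cases hI0 : I = ⊥
  · exact ⟨0, by simp [hI0]⟩
  obtain ⟨a₀, ha₀⟩ := hI
  obtain ⟨g, hg0, hg, -⟩ := S.exists_mul_map_eq hI0
  obtain ⟨η, hη⟩ : Associated (g ^ 2) (S.N a₀) := by
    refine S.associated_of_span_eq ?_
    rw [map_pow, ← Ideal.span_singleton_pow, ← hg, mul_pow, ← Ideal.map_pow, ha₀, Ideal.map_span,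
      Set.image_singleton, Ideal.span_singleton_mul_span_singleton, ι_N]
  obtain ⟨m, hm, w, hw, hmw⟩ := h.exists_norm a₀ g η hg0 η.isUnit (by rw [← hη, mul_comm])
  obtain ⟨u, w', hw', hu⟩ := hnorm m hm
  obtain ⟨k, hk, hku⟩ : ∃ k, IsUnit k ∧ (η : ℤ√2) = S.N u * k ^ 2 := by
    obtain ⟨k, hk⟩ := hw'.exists_right_inv
    refine ⟨w * k, hw.mul (IsUnit.of_mul_eq_one_right _ hk), ?_⟩
    rw [hmw, hu]
    linear_combination -m * w ^ 2 * (w' * k + 1) * hk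
  have huN : S.N u * S.N (u⁻¹ : Oˣ) = 1 := by rw [← N_mul, Units.mul_inv, N_one]
  have hc : S.N (a₀ * (u⁻¹ : Oˣ)) = (k * g) ^ 2 := by
    rw [N_mul, ← hη, hku]
    linear_combination g ^ 2 * k ^ 2 * huN
  have hcI : I ^ 2 = Ideal.span {a₀ * ((u⁻¹ : Oˣ) : O)} := by
    rw [Ideal.span_singleton_mul_right_unit (u⁻¹).isUnit, ha₀]
  generalize a₀ * ((u⁻¹ : Oˣ) : O) = c at hc hcI
  obtain ⟨t, ht0, ht⟩ := S.exists_of_N_eq_sq hn hc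
  have hσt := S.σ_ne_zero ht0
  have hgspan : Ideal.span {S.ι g} ≠ ⊥ := by simpa using S.ι_ne_zero.2 hg0
  have hfix : (Ideal.span {S.σ t} * I).map S.σ = Ideal.span {S.σ t} * I := by
    rw [Ideal.map_mul, Ideal.map_span, Set.image_singleton, S.σ_σ]
    refine mul_left_cancel₀ hgspan ?_
    rw [← mul_assoc, Ideal.span_singleton_mul_span_singleton,
      ← Ideal.span_singleton_mul_left_unit (hk.map S.ι), ← mul_assoc, ← map_mul, ← ht,
      ← Ideal.span_singleton_mul_span_singleton, ← hcI, ← hg]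
    ring
  have hJ0 : Ideal.span {S.σ t} * I ≠ ⊥ := mul_ne_zero (by simpa using hσt) hI0
  obtain ⟨δ, z, hδ, hz, h1⟩ := S.exists_sq_eq_of_fixed hJ0 hfix
  obtain ⟨a, v, hav⟩ := hgood δ hδ
  have h2 : Ideal.span {S.ι (δ * z ^ 2)} = Ideal.span {a * S.ι z} ^ 2 := by
    rw [Ideal.span_singleton_pow, mul_pow, hav, mul_assoc,
      Ideal.span_singleton_mul_left_unit v.isUnit, map_mul, map_pow]
  rw [h2] at h1
  rcases h1 with h1 | h1
  · exact eq_span_of_span_mul_eq hσt (ideal_eq_of_sq_eq h1)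
  · have h3 := ideal_eq_of_sq_eq h1
    rw [← mul_assoc, Ideal.span_singleton_mul_span_singleton] at h3
    exact eq_span_of_span_mul_eq (mul_ne_zero (S.θ_ne_zero hn) hσt) h3

theorem exists_isTight [IsDedekindDomain O] (h : n = 1 ∨ n.Prime ∧ n % 4 = 3) :
    ∃ T M, S.IsTight T M := by
  classical
  rcases h with rfl | ⟨hp, hp4⟩
  · obtain ⟨T, hT, hT'⟩ := exists_finset_mul_sq (n := ((1 : ℕ) : ℤ√2)) (Q := {1}) fun δ hδ =>
      ⟨1, by simp, (associated_one_iff_isUnit.2 (isUnit_of_dvd_one (by simpa using hδ))).symm⟩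
    refine ⟨T, unitReps, hT', fun x g η _ hη _ => exists_mem_unitReps hη, ?_⟩
    rw [Finset.card_singleton] at hT
    exact Nat.mul_le_mul hT card_unitReps_le
  have : Fact n.Prime := ⟨hp⟩
  have hnorm : ∀ (x : O) (g η : ℤ√2), g ≠ 0 → IsUnit η → S.N x = η * g ^ 2 →
      ∃ w, IsUnit w ∧ (η = w ^ 2 ∨ η = -w ^ 2) := by
    intro x g η hg hη hx
    obtain ⟨w, t, hw⟩ := S.exists_sq_eq_trace_mul x
    have h1 := norm_ne_neg_one hp4 (mul_ne_zero two_ne_zero hg)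
      (show w ^ 2 = (t ^ 2 - η * (2 * g) ^ 2) * _ by rw [hw, hx]; ring)
    exact eq_sq_of_norm_one (((isUnit_iff η).1 hη).resolve_right h1)
  have h8 : n % 8 = 3 ∨ n % 8 = 7 := by omega
  rcases h8 with h8 | h8
  · obtain ⟨T, hT, hT'⟩ := exists_finset_mul_sq (n := (n : ℤ√2)) (Q := {1, (n : ℤ√2)}) fun δ hδ => by
      rcases (prime_of_inert (Or.inl h8)).irreducible.dvd_iff.1 hδ with h | h
      · exact ⟨1, by simp, (associated_one_iff_isUnit.2 h).symm⟩
      · exact ⟨n, by simp, h⟩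
    refine ⟨T, {1, -1}, hT', fun x g η hg hη hx => ?_, ?_⟩
    · obtain ⟨w, hw, h | h⟩ := hnorm x g η hg hη hx
      · exact ⟨1, by simp, w, hw, by rw [h, one_mul]⟩
      · exact ⟨-1, by simp, w, hw, by rw [h]; ring⟩
    · have h1 := Finset.card_le_two (a := (1 : ℤ√2)) (b := (n : ℤ√2))
      have h2 := Finset.card_le_two (a := (1 : ℤ√2)) (b := -1)
      exact (Nat.mul_le_mul (hT.trans (Nat.mul_le_mul_right _ h1)) h2)
  · obtain ⟨a, b, hab, ha, hb, -⟩ := exists_split (p := n) (Or.inr h8)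
    have hdvd : ∀ {π δ : ℤ√2}, Prime π → δ ∣ π → Associated 1 δ ∨ Associated π δ := fun hπ hδ =>
      (hπ.irreducible.dvd_iff.1 hδ).imp_left fun h => (associated_one_iff_isUnit.2 h).symm
    obtain ⟨T, hT, hT'⟩ := exists_finset_mul_sq (n := (n : ℤ√2)) (Q := {1, a, b, a * b}) fun δ hδ => by
      rw [hab] at hδ
      obtain ⟨δ₁, δ₂, h₁, h₂, rfl⟩ := exists_dvd_and_dvd_of_dvd_mul hδ
      rcases hdvd (prime_of_norm ha) h₁ with h₁ | h₁ <;>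
      rcases hdvd (prime_of_norm hb) h₂ with h₂ | h₂
      · exact ⟨1, by simp, by simpa using h₁.mul_mul h₂⟩
      · exact ⟨b, by simp, by simpa using h₁.mul_mul h₂⟩
      · exact ⟨a, by simp, by simpa using h₁.mul_mul h₂⟩
      · exact ⟨a * b, by simp, h₁.mul_mul h₂⟩
    refine ⟨T, {1}, hT', fun x g η hg hη hx => ?_, ?_⟩
    · obtain ⟨k, hk, h | h⟩ := hnorm x g η hg hη hx
      · exact ⟨1, by simp, k, hk, by rw [h, one_mul]⟩
      · obtain ⟨w, t, hw⟩ := S.exists_sq_eq_trace_mul x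
        exact (sq_add_sq_mul_ne h8 (mul_ne_zero (mul_ne_zero two_ne_zero hk.ne_zero) hg)
          (show w ^ 2 = (t ^ 2 - -1 * (2 * k * g) ^ 2) * _ by rw [hw, hx, h]; ring)).elim
    · have h1 := Finset.card_le_four (a := (1 : ℤ√2)) (b := a) (c := b) (d := a * b)
      rw [Finset.card_singleton, mul_one]
      exact hT.trans (Nat.mul_le_mul_right _ h1)

theorem forall_sq_principal_iff [IsDedekindDomain O] (S : QuarticData O n) (hodd : Odd n)
    (hsq : Squarefree n) (hU : Nat.card (Oˣ ⧸ (powMonoidHom 2 : Oˣ →* Oˣ).range) = 16) :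
    (∀ I : Ideal O, (∃ c, I ^ 2 = Ideal.span {c}) → ∃ a, I = Ideal.span {a}) ↔
      n = 1 ∨ n.Prime ∧ n % 4 = 3 := by
  refine ⟨fun hP => S.eq_one_or_prime hodd hsq hP hU, fun h I hI => ?_⟩
  obtain ⟨T, M, hTM⟩ := exists_isTight (S := S) h
  exact hTM.exists_eq_span hodd.pos.ne' hU hI

end QuarticData

section NumberField

open NumberField

theorem odd_classNumber_iff (K : Type*) [Field K] [NumberField K] :
    Odd (classNumber K) ↔
      ∀ I : Ideal (𝓞 K), (∃ c, I ^ 2 = Ideal.span {c}) → ∃ a, I = Ideal.span {a} := by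
  classical
  have hcard : classNumber K = Nat.card (ClassGroup (𝓞 K)) := by
    rw [classNumber, Nat.card_eq_fintype_card]
  rw [hcard]
  constructor
  · rintro hodd I ⟨c, hc⟩
    by_cases hI : I = 0
    · exact ⟨0, by simp [hI]⟩
    have hmem : I ∈ nonZeroDivisors (Ideal (𝓞 K)) := mem_nonZeroDivisors_of_ne_zero hI
    have h2 : ClassGroup.mk0 ⟨I, hmem⟩ ^ 2 = 1 := by
      rw [← map_pow, ClassGroup.mk0_eq_one_iff]
      exact ⟨c, by simpa using hc⟩
    have h1 : ClassGroup.mk0 ⟨I, hmem⟩ = 1 := by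
      rw [← orderOf_eq_one_iff, ← Nat.dvd_one, ← Nat.Coprime.gcd_eq_one hodd.coprime_two_left]
      exact Nat.dvd_gcd (orderOf_dvd_of_pow_eq_one h2) (orderOf_dvd_natCard _)
    rw [ClassGroup.mk0_eq_one_iff] at h1
    obtain ⟨a, ha⟩ := h1
    exact ⟨a, by simpa using ha⟩
  · intro h
    by_contra hodd
    rw [Nat.not_odd_iff_even, even_iff_two_dvd] at hodd
    obtain ⟨g, hg⟩ := exists_prime_orderOf_dvd_card' 2 hodd
    obtain ⟨⟨I, hI⟩, rfl⟩ := ClassGroup.mk0_surjective g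
    have h2 := pow_orderOf_eq_one (ClassGroup.mk0 ⟨I, hI⟩)
    rw [hg, ← map_pow, ClassGroup.mk0_eq_one_iff] at h2
    obtain ⟨c, hc⟩ := h2
    obtain ⟨a, ha⟩ := h I ⟨c, by simpa using hc⟩
    have h1 : ClassGroup.mk0 ⟨I, hI⟩ = 1 := by
      rw [ClassGroup.mk0_eq_one_iff]
      exact ⟨a, by simpa using ha⟩
    rw [h1, orderOf_one] at hg
    omega

theorem eq_one_or_neg_one_of_mem_torsion {K : Type*} [Field K] [NumberField K]
    [IsTotallyReal K] {ζ : (𝓞 K)ˣ} (hζ : ζ ∈ Units.torsion K) : ζ = 1 ∨ ζ = -1 := by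
  obtain ⟨w⟩ := (inferInstance : Nonempty (InfinitePlace K))
  have hw := (Units.mem_torsion K).1 hζ w
  have hreal := IsTotallyReal.isReal w
  rw [← InfinitePlace.norm_embedding_of_isReal hreal, Real.norm_eq_abs,
    abs_eq zero_le_one] at hw
  rcases hw with hw | hw
  · left
    apply Units.coe_injective K
    exact (InfinitePlace.embedding_of_isReal hreal).injective (by simpa using hw)
  · right
    apply Units.coe_injective K
    exact (InfinitePlace.embedding_of_isReal hreal).injective (by simpa using hw)

theorem card_torsion_of_isTotallyReal (K : Type*) [Field K] [NumberField K]
    [IsTotallyReal K] : Nat.card (Units.torsion K) = 2 := by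
  classical
  let := Fintype.ofFinite (Units.torsion K)
  rw [Nat.card_eq_fintype_card]
  refine (Finset.card_eq_two.2 ⟨1, ⟨-1, by
      rw [Units.torsion, CommGroup.mem_torsion, isOfFinOrder_iff_pow_eq_one]
      exact ⟨2, two_pos, by simp⟩⟩,
    by simp [← Subtype.coe_ne_coe], Finset.ext fun x ↦ ⟨fun _ ↦ ?_, fun _ ↦ Finset.mem_univ _⟩⟩)
  rw [Finset.mem_insert, Finset.mem_singleton, ← Subtype.val_inj, ← Subtype.val_inj]
  exact eq_one_or_neg_one_of_mem_torsion x.2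

theorem card_units_quotient_squares (K : Type*) [Field K] [NumberField K] [IsTotallyReal K] :
    Nat.card ((𝓞 K)ˣ ⧸ (powMonoidHom 2 : (𝓞 K)ˣ →* (𝓞 K)ˣ).range) =
      2 ^ Module.finrank ℚ K := by
  classical
  have hrank : Units.rank K + 1 = Module.finrank ℚ K := by
    rw [Units.rank, InfinitePlace.card_eq_nrRealPlaces_add_nrComplexPlaces,
      IsTotallyReal.nrComplexPlaces_eq_zero, IsTotallyReal.finrank]
    have : 0 < InfinitePlace.nrRealPlaces K := by
      rw [← IsTotallyReal.finrank]; exact Module.finrank_pos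
    omega
  let f : Units.torsion K × (Fin (Units.rank K) → Fin 2) →
      (𝓞 K)ˣ ⧸ (powMonoidHom 2 : (𝓞 K)ˣ →* (𝓞 K)ˣ).range :=
    fun p => QuotientGroup.mk ((p.1 : (𝓞 K)ˣ) *
      ∏ i, Units.fundSystem K i ^ ((p.2 i : ℕ) : ℤ))
  have hf : Function.Bijective f := by
    constructor
    · rintro ⟨ζ, b⟩ ⟨ζ', b'⟩ h
      rw [QuotientGroup.eq] at h
      obtain ⟨u, hu⟩ := h
      obtain ⟨⟨ξ, c⟩, hc, -⟩ := Units.exist_unique_eq_mul_prod K u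
      have hξ : (ξ : (𝓞 K)ˣ) ^ 2 = 1 := by
        rcases eq_one_or_neg_one_of_mem_torsion ξ.2 with h | h <;> simp [h]
      have hu' : (ζ' : (𝓞 K)ˣ) * ∏ i, Units.fundSystem K i ^ ((b' i : ℕ) : ℤ) =
          (ζ : (𝓞 K)ˣ) * ∏ i, Units.fundSystem K i ^ (((b i : ℕ) : ℤ) + 2 * c i) := by
        simp only [zpow_add, Finset.prod_mul_distrib, mul_comm (2 : ℤ), zpow_mul]
        rw [← eq_inv_mul_iff_mul_eq.1 hu, ← mul_assoc]
        congr 1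
        simp only [powMonoidHom_apply]
        rw [hc, mul_pow, hξ, one_mul, ← Finset.prod_pow]
        rfl
      have := (Units.exist_unique_eq_mul_prod K _).unique
        (y₁ := (ζ', fun i => ((b' i : ℕ) : ℤ))) (y₂ := (ζ, fun i => ((b i : ℕ) : ℤ) + 2 * c i))
        rfl hu'
      rw [Prod.mk.injEq] at this
      refine Prod.ext this.1.symm (funext fun i => Fin.ext ?_)
      have h3 := congrFun this.2 i
      have := (b i).2
      have := (b' i).2
      dsimp only at h3 ⊢
      omega
    · intro q
      obtain ⟨u, rfl⟩ := QuotientGroup.mk_surjective q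
      obtain ⟨⟨ξ, c⟩, hc, -⟩ := Units.exist_unique_eq_mul_prod K u
      refine ⟨(ξ, fun i => ⟨(c i % 2).toNat, by omega⟩), ?_⟩
      rw [QuotientGroup.eq]
      refine ⟨∏ i, Units.fundSystem K i ^ (c i / 2), ?_⟩
      rw [eq_inv_mul_iff_mul_eq, hc, mul_assoc, powMonoidHom_apply, ← Finset.prod_pow,
        ← Finset.prod_mul_distrib]
      congr 1
      refine Finset.prod_congr rfl fun i _ => ?_
      have h4 : c i = (((c i % 2).toNat : ℕ) : ℤ) + c i / 2 * 2 := by omega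
      calc Units.fundSystem K i ^ (((c i % 2).toNat : ℕ) : ℤ) *
            (Units.fundSystem K i ^ (c i / 2)) ^ 2
          = Units.fundSystem K i ^ ((((c i % 2).toNat : ℕ) : ℤ) + c i / 2 * 2) := by
            rw [zpow_add, zpow_mul]; rfl
        _ = Units.fundSystem K i ^ c i := by rw [← h4]
  rw [← Nat.card_eq_of_bijective f hf, Nat.card_prod, card_torsion_of_isTotallyReal,
    Nat.card_eq_fintype_card, Fintype.card_fun, Fintype.card_fin, Fintype.card_fin, ← hrank,
    pow_succ']

end NumberField

section QuarticField

open NumberField Polynomial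

/-- The minimal polynomial of `√(n(2 + √2))` for odd `n`. -/
noncomputable def quarticPoly (n : ℕ) : ℤ[X] := X ^ 4 + C (-4 * n : ℤ) * X ^ 2 + C (2 * n ^ 2 : ℤ)

theorem quarticPoly_natDegree (n : ℕ) : (quarticPoly n).natDegree = 4 := by
  rw [quarticPoly]
  compute_degree!

theorem quarticPoly_monic (n : ℕ) : (quarticPoly n).Monic := by
  rw [quarticPoly]
  monicity!

theorem quarticPoly_irreducible {n : ℕ} (hodd : Odd n) : Irreducible (quarticPoly n) := by
  have hprime : (Ideal.span {(2 : ℤ)}).IsPrime :=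
    (Ideal.span_singleton_prime two_ne_zero).2 Int.prime_two
  refine IsEisensteinAt.irreducible (𝓟 := Ideal.span {(2 : ℤ)}) ⟨?_, fun {m} hm => ?_, ?_⟩ hprime
    (quarticPoly_monic n).isPrimitive (by rw [quarticPoly_natDegree]; norm_num)
  · rw [(quarticPoly_monic n).leadingCoeff, Ideal.mem_span_singleton]
    norm_num
  · rw [quarticPoly_natDegree] at hm
    rw [Ideal.mem_span_singleton]
    simp only [quarticPoly, coeff_add, coeff_C_mul, coeff_X_pow, coeff_C]
    interval_cases m
    · exact ⟨n ^ 2, by simp⟩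
    · simp
    · exact ⟨-2 * n, by simp; ring⟩
    · simp
  · have h0 : (quarticPoly n).coeff 0 = 2 * n ^ 2 := by
      rw [coeff_zero_eq_eval_zero]
      simp [quarticPoly]
    rw [h0, Ideal.span_singleton_pow, Ideal.mem_span_singleton]
    rintro ⟨c, hc⟩
    obtain ⟨m, rfl⟩ := hodd
    push_cast at hc
    have : 2 * (m ^ 2 + m : ℤ) * 2 + 1 = 2 * c := by linarith
    omega

variable {K : Type*} [Field K] [NumberField K] {n : ℕ} {θ : K}

theorem aeval_quarticPoly {R : Type*} [CommRing R] [Algebra ℚ R] (n : ℕ) (x : R) :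
    aeval x ((quarticPoly n).map (algebraMap ℤ ℚ)) = x ^ 4 - 4 * n * x ^ 2 + 2 * n ^ 2 := by
  simp [quarticPoly, map_ofNat]
  ring

theorem minpoly_eq_quarticPoly (hodd : Odd n) (hθ : θ ^ 4 - 4 * n * θ ^ 2 + 2 * n ^ 2 = 0) :
    minpoly ℚ θ = (quarticPoly n).map (algebraMap ℤ ℚ) := by
  refine (minpoly.eq_of_irreducible_of_monic ?_ ?_ ((quarticPoly_monic n).map _)).symm
  · exact ((quarticPoly_monic n).irreducible_iff_irreducible_map_fraction_map).1
      (quarticPoly_irreducible hodd)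
  · rw [aeval_quarticPoly, hθ]

/-- The power basis of `K` generated by `θ`. -/
noncomputable def quarticBasis (htop : Algebra.adjoin ℚ {θ} = ⊤) : PowerBasis ℚ K :=
  PowerBasis.ofAdjoinEqTop (Algebra.IsIntegral.isIntegral θ) htop

theorem quarticBasis_gen (htop : Algebra.adjoin ℚ {θ} = ⊤) : (quarticBasis htop).gen = θ :=
  PowerBasis.ofAdjoinEqTop_gen _ _

theorem quarticBasis_dim (hodd : Odd n) (hθ : θ ^ 4 - 4 * n * θ ^ 2 + 2 * n ^ 2 = 0)
    (htop : Algebra.adjoin ℚ {θ} = ⊤) : (quarticBasis htop).dim = 4 := by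
  rw [quarticBasis, PowerBasis.ofAdjoinEqTop_dim, minpoly_eq_quarticPoly hodd hθ,
    (quarticPoly_monic n).natDegree_map, quarticPoly_natDegree]

theorem finrank_quartic (hodd : Odd n) (hθ : θ ^ 4 - 4 * n * θ ^ 2 + 2 * n ^ 2 = 0)
    (htop : Algebra.adjoin ℚ {θ} = ⊤) : Module.finrank ℚ K = 4 := by
  rw [(quarticBasis htop).finrank, quarticBasis_dim hodd hθ]

theorem exists_quartic_coords (hodd : Odd n) (hθ : θ ^ 4 - 4 * n * θ ^ 2 + 2 * n ^ 2 = 0)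
    (htop : Algebra.adjoin ℚ {θ} = ⊤) (x : K) :
    ∃ a b c d : ℚ, x = a + b * θ + c * θ ^ 2 + d * θ ^ 3 := by
  have hdim := quarticBasis_dim hodd hθ htop
  obtain ⟨f, hf, hx⟩ := (quarticBasis htop).exists_eq_aeval x
  rw [hdim] at hf
  refine ⟨f.coeff 0, f.coeff 1, f.coeff 2, f.coeff 3, ?_⟩
  rw [hx, quarticBasis_gen, aeval_eq_sum_range' hf]
  simp [Finset.sum_range_succ, Algebra.smul_def]

theorem exists_quartic_algHom {L : Type*} [Field L] [Algebra ℚ L] (hodd : Odd n)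
    (hθ : θ ^ 4 - 4 * n * θ ^ 2 + 2 * n ^ 2 = 0) (htop : Algebra.adjoin ℚ {θ} = ⊤) {y : L}
    (hy : y ^ 4 - 4 * n * y ^ 2 + 2 * n ^ 2 = 0) : ∃ φ : K →ₐ[ℚ] L, φ θ = y := by
  have h : aeval y (minpoly ℚ (quarticBasis htop).gen) = 0 := by
    rw [quarticBasis_gen, minpoly_eq_quarticPoly hodd hθ, aeval_quarticPoly, hy]
  refine ⟨(quarticBasis htop).lift y h, ?_⟩
  exact (congrArg _ (quarticBasis_gen htop).symm).trans ((quarticBasis htop).lift_gen y h)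

theorem isTotallyReal_quartic (hodd : Odd n) (hθ : θ ^ 4 - 4 * n * θ ^ 2 + 2 * n ^ 2 = 0)
    (htop : Algebra.adjoin ℚ {θ} = ⊤) : IsTotallyReal K := by
  have hn : 0 < (n : ℝ) := by exact_mod_cast hodd.pos
  refine ⟨fun v => ?_⟩
  rw [InfinitePlace.isReal_iff]
  generalize v.embedding = φ
  have hφ : (φ θ) ^ 4 - 4 * n * (φ θ) ^ 2 + 2 * n ^ 2 = 0 := by
    simpa [map_ofNat] using congrArg φ hθ
  have h2 : (Real.sqrt 2 : ℝ) ^ 2 = 2 := Real.sq_sqrt zero_le_two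
  have hlt : Real.sqrt 2 < 2 := by nlinarith [Real.sqrt_nonneg 2]
  have hreal : ∃ r : ℝ, φ θ = r := by
    have key : ∀ t : ℝ, 0 < t → φ θ ^ 2 = t → ∃ r : ℝ, φ θ = r := by
      intro t ht h
      have hs : ((Real.sqrt t : ℝ) : ℂ) ^ 2 = t := by
        rw [← Complex.ofReal_pow, Real.sq_sqrt ht.le]
      rw [← hs, sq_eq_sq_iff_eq_or_eq_neg] at h
      rcases h with h | h
      · exact ⟨_, h⟩
      · exact ⟨-Real.sqrt t, by rw [h]; simp⟩
    have h2c : ((Real.sqrt 2 : ℝ) : ℂ) ^ 2 = 2 := by exact_mod_cast congrArg Complex.ofReal h2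
    have hprod : (φ θ ^ 2 - n * (2 + Real.sqrt 2)) * (φ θ ^ 2 - n * (2 - Real.sqrt 2)) = 0 := by
      linear_combination hφ - n ^ 2 * h2c
    rcases mul_eq_zero.1 hprod with h | h
    · exact key (n * (2 + Real.sqrt 2)) (by positivity) (by push_cast; linear_combination h)
    · exact key (n * (2 - Real.sqrt 2)) (mul_pos hn (by linarith))
        (by push_cast; linear_combination h)
  obtain ⟨r, hr⟩ := hreal
  rw [ComplexEmbedding.isReal_iff]
  have : (ComplexEmbedding.conjugate φ).toRatAlgHom = φ.toRatAlgHom := by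
    refine (quarticBasis htop).algHom_ext ?_
    rw [quarticBasis_gen]
    simp [hr]
  ext x
  exact DFunLike.congr_fun this x

theorem sq_ne_two_rat (q : ℚ) : q ^ 2 ≠ 2 := by
  intro h
  have : IsSquare (2 : ℚ) := ⟨q, by rw [← h, sq]⟩
  rw [show (2 : ℚ) = ((2 : ℕ) : ℚ) by norm_num, Rat.isSquare_natCast_iff] at this
  exact Nat.prime_two.prime.irreducible.not_isSquare this

theorem exists_int_eq_of_isIntegral {q : ℚ} (h : IsIntegral ℤ (q : K)) : ∃ m : ℤ, q = m := by
  have : IsIntegral ℤ q := by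
    rw [← isIntegral_algebraMap_iff (algebraMap ℚ K).injective]
    simpa using h
  obtain ⟨m, hm⟩ := IsIntegrallyClosed.isIntegral_iff.1 this
  exact ⟨m, by rw [← hm]; simp⟩

theorem isIntegral_of_sq_eq_two {K : Type*} [Field K] {s : K} (hs : s ^ 2 = 2) :
    IsIntegral ℤ s := by
  refine IsIntegral.of_pow two_pos ?_
  rw [hs]
  simpa using isIntegral_algebraMap (R := ℤ) (A := K) (x := 2)

theorem exists_int_of_integral_conj {s x : K} (hs : s ^ 2 = 2) {τ : K →+* K} (hτ : τ s = -s)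
    {a b : ℚ} (hx : x = a + b * s) (hintegral : IsIntegral ℤ x) : ∃ c d : ℤ, x = c + d * s := by
  have hτx : τ x = a - b * s := by
    rw [hx]
    simp [hτ, sub_eq_add_neg]
  have hτint : IsIntegral ℤ (τ x) := hintegral.map (τ : K →+* K).toIntAlgHom
  have hsint := isIntegral_of_sq_eq_two hs
  obtain ⟨A, hA⟩ := exists_int_eq_of_isIntegral (K := K) (q := 2 * a) (by
    refine (congrArg (IsIntegral ℤ) (?_ : _ = x + τ x)).mpr (hintegral.add hτint)
    rw [hτx, hx]; push_cast; ring)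
  obtain ⟨C, hC⟩ := exists_int_eq_of_isIntegral (K := K) (q := 4 * b) (by
    refine (congrArg (IsIntegral ℤ) (?_ : _ = (x - τ x) * s)).mpr ((hintegral.sub hτint).mul hsint)
    rw [hτx, hx]; push_cast; linear_combination (-2 * b : K) * hs)
  obtain ⟨N, hN⟩ := exists_int_eq_of_isIntegral (K := K) (q := a ^ 2 - 2 * b ^ 2) (by
    refine (congrArg (IsIntegral ℤ) (?_ : _ = x * τ x)).mpr (hintegral.mul hτint)
    rw [hτx, hx]; push_cast; linear_combination (b ^ 2 : K) * hs)
  have h1 : 2 * A ^ 2 - C ^ 2 = 8 * N := by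
    have : (2 * A ^ 2 - C ^ 2 : ℚ) = 8 * N := by
      rw [← hA, ← hC, ← hN]; ring
    exact_mod_cast this
  have hC2 : Even C := by
    have : Even (C ^ 2) := ⟨A ^ 2 - 4 * N, by linarith⟩
    exact (Int.even_pow.1 this).1
  obtain ⟨B, rfl⟩ := hC2
  have hA2 : Even A := by
    have : Even (A ^ 2) := ⟨B ^ 2 + 2 * N, by nlinarith⟩
    exact (Int.even_pow.1 this).1
  obtain ⟨A, rfl⟩ := hA2
  have hB2 : Even B := by
    have : Even (B ^ 2) := ⟨A ^ 2 - N, by nlinarith⟩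
    exact (Int.even_pow.1 this).1
  obtain ⟨B, rfl⟩ := hB2
  refine ⟨A, B, ?_⟩
  have ha : a = A := by push_cast at hA; linarith
  have hb : b = B := by push_cast at hC; linarith
  rw [hx, ha, hb]
  simp

theorem nonempty_quarticData (hodd : Odd n) (hθ : θ ^ 4 - 4 * n * θ ^ 2 + 2 * n ^ 2 = 0)
    (htop : Algebra.adjoin ℚ {θ} = ⊤) : Nonempty (QuarticData (𝓞 K) n) := by
  have hn : (n : K) ≠ 0 := by exact_mod_cast hodd.pos.ne'
  have hθ0 : θ ≠ 0 := by
    rintro rfl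
    simp [hn] at hθ
  obtain ⟨s, hs⟩ : ∃ s : K, s = θ ^ 2 / n - 2 := ⟨_, rfl⟩
  have hθs : θ ^ 2 = n * (s + 2) := by rw [hs]; field_simp; ring
  have hs2 : s ^ 2 = 2 := by
    rw [hs]; field_simp; linear_combination hθ
  have hsint := isIntegral_of_sq_eq_two hs2
  have hθint : IsIntegral ℤ θ := by
    refine IsIntegral.of_pow two_pos ?_
    rw [hθs]
    simpa using (isIntegral_algebraMap (R := ℤ) (A := K) (x := n)).mul
      (hsint.add (isIntegral_algebraMap (R := ℤ) (A := K) (x := 2)))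
  obtain ⟨σ, hσ⟩ := exists_quartic_algHom (L := K) (y := -θ) hodd hθ htop
    (by linear_combination hθ)
  have hy : (n * s / θ) ^ 2 = n * (2 - s) := by
    rw [div_pow, div_eq_iff (pow_ne_zero 2 hθ0), hθs]
    linear_combination (2 * n ^ 2 : K) * hs2
  obtain ⟨τ, hτ⟩ := exists_quartic_algHom (L := K) (y := n * s / θ) hodd hθ htop (by
    linear_combination ((n * s / θ) ^ 2 + n * (2 - s) - 4 * n) * hy + (n ^ 2 : K) * hs2)
  have hσs : σ s = s := by rw [hs]; simp [hσ, map_ofNat]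
  have hτs : τ s = -s := by
    have : τ s = (n * s / θ) ^ 2 / n - 2 := by
      conv_lhs => rw [hs]
      simp [hτ, map_ofNat]
    rw [this, hy]
    field_simp
    ring
  have hσσ : ∀ x, σ (σ x) = x := by
    have : σ.comp σ = AlgHom.id ℚ K := by
      refine (quarticBasis htop).algHom_ext ?_
      rw [quarticBasis_gen]
      simp [hσ]
    exact fun x => DFunLike.congr_fun this x
  have hfix : ∀ x, σ x = x → IsIntegral ℤ x → ∃ c d : ℤ, x = c + d * s := by
    intro x hx hintegral
    obtain ⟨a, b, c, d, rfl⟩ := exists_quartic_coords hodd hθ htop x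
    have h1 : 2 * θ * (b + d * n * (s + 2)) = 0 := by
      simp only [map_add, map_mul, map_pow, hσ, map_ratCast] at hx
      linear_combination -hx - 2 * d * θ * hθs
    have h2 : (b : K) + d * n * (s + 2) = 0 := by simpa [hθ0] using h1
    have hd : d = 0 := by
      by_contra hd
      have hdn : (d * n : ℚ) ≠ 0 := mul_ne_zero hd (by exact_mod_cast hodd.pos.ne')
      refine sq_ne_two_rat (-b / (d * n) - 2) ?_
      have hdK : (d : K) ≠ 0 := by exact_mod_cast hd
      have : ((-b / (d * n) - 2 : ℚ) : K) = s := by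
        push_cast
        field_simp
        linear_combination -h2
      have h3 : (((-b / (d * n) - 2) ^ 2 : ℚ) : K) = (2 : ℚ) := by
        rw [Rat.cast_pow, this, hs2]; norm_num
      exact_mod_cast h3
    have hb : b = 0 := by
      rw [hd] at h2
      simpa using h2
    refine exists_int_of_integral_conj (a := a + 2 * c * n) (b := c * n) hs2 (τ := τ) hτs ?_
      hintegral
    rw [hd, hb, hθs]
    push_cast
    ring
  obtain ⟨t, ht⟩ : ∃ t : 𝓞 K, (t : K) = s := ⟨⟨s, hsint⟩, rfl⟩
  have hsO : t * t = ((2 : ℤ) : 𝓞 K) := by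
    have h : (t : K) * t = 2 := by rw [ht, ← sq, hs2]
    apply RingOfIntegers.ext
    simpa [map_ofNat] using h
  have hι : ∀ r : ℤ√2, ((Zsqrtd.lift ⟨t, hsO⟩ r : 𝓞 K) : K) = r.re + r.im * s := by
    intro r
    simp [Zsqrtd.lift, ht]
  exact ⟨{
    ι := Zsqrtd.lift ⟨t, hsO⟩
    ι_injective := Zsqrtd.lift_injective _ (fun m hm => by
      have := sq_ne_two_rat m
      exact this (by rw [sq]; exact_mod_cast hm.symm))
    σ := RingOfIntegers.mapRingHom (σ : K →+* K)
    σ_σ := fun x => RingOfIntegers.ext (hσσ x)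
    σ_ι := fun r => RingOfIntegers.ext (by
      rw [RingOfIntegers.mapRingHom_apply, hι]
      simp [hσs])
    exists_of_fixed := fun x hx => by
      obtain ⟨c, d, h⟩ := hfix x (congrArg (algebraMap (𝓞 K) K) hx) x.isIntegral_coe
      exact ⟨⟨c, d⟩, RingOfIntegers.ext (by rw [hι, h])⟩
    θ := ⟨θ, hθint⟩
    θ_sq := RingOfIntegers.ext (by
      rw [hι]
      change θ ^ 2 = _
      rw [hθs]
      simp [SqrtTwo.rt, SqrtTwo.eps]
      ring)
    σ_θ := RingOfIntegers.ext hσ }⟩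

theorem odd_classNumber_iff_of_generator
    (hodd : Odd n) (hsq : Squarefree n) (hθ : θ ^ 4 - 4 * n * θ ^ 2 + 2 * n ^ 2 = 0)
    (htop : Algebra.adjoin ℚ {θ} = ⊤) :
    Odd (classNumber K) ↔ n = 1 ∨ n.Prime ∧ n % 4 = 3 := by
  obtain ⟨S⟩ := nonempty_quarticData hodd hθ htop
  have := isTotallyReal_quartic hodd hθ htop
  rw [odd_classNumber_iff]
  refine S.forall_sq_principal_iff hodd hsq ?_
  rw [card_units_quotient_squares, finrank_quartic hodd hθ htop]
  norm_num

end QuarticField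

/-- `n` odd squarefree positive, `𝕂 = ℚ(√(n·(1+√2)·√2))`.
The class number of `𝕂` is odd iff `n = 1` or `n` is a prime `≡ 3 (mod 4)`. -/
theorem stmt_16
    (n : ℕ) (hnodd : Odd n) (hnsq : Squarefree n) (hn0 : 0 < n)
    (K : IntermediateField ℚ ℝ)
    (hK : K = IntermediateField.adjoin ℚ
      ({Real.sqrt ((n : ℝ) * ((1 : ℝ) + Real.sqrt 2) * Real.sqrt 2)} : Set ℝ))
    [NumberField K] :
    Odd (NumberField.classNumber K) ↔ (n = 1 ∨ (n.Prime ∧ n % 4 = 3)) := by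
  subst hK
  have h2 : Real.sqrt 2 ^ 2 = 2 := Real.sq_sqrt zero_le_two
  have hx := Real.sq_sqrt (x := (n : ℝ) * ((1 : ℝ) + Real.sqrt 2) * Real.sqrt 2) (by positivity)
  revert hx
  generalize Real.sqrt ((n : ℝ) * ((1 : ℝ) + Real.sqrt 2) * Real.sqrt 2) = x at *
  intro hx
  refine odd_classNumber_iff_of_generator
    (θ := IntermediateField.AdjoinSimple.gen ℚ x) hnodd hnsq ?_ ?_
  · apply (algebraMap (IntermediateField.adjoin ℚ {x}) ℝ).injective
    simp only [map_add, map_sub, map_mul, map_pow, map_ofNat, map_natCast, map_zero,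
      IntermediateField.AdjoinSimple.algebraMap_gen]
    have : x ^ 2 = n * (Real.sqrt 2 + 2) := by rw [hx]; linear_combination (n : ℝ) * h2
    linear_combination (x ^ 2 + n * (Real.sqrt 2 + 2) - 4 * n) * this + (n ^ 2 : ℝ) * h2
  · have hintegral : IsIntegral ℚ x :=
      (Algebra.IsIntegral.isIntegral (IntermediateField.AdjoinSimple.gen ℚ x)).map
        (IntermediateField.val _)
    have := (IntermediateField.adjoin.powerBasis hintegral).adjoin_gen_eq_top
    rwa [IntermediateField.adjoin.powerBasis_gen] at this
end
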